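/- Let T and U be computable consistent extensions of PA and n ≥ 1. The following are equivalent: (1) (T,U) is a C⁻_n-pair; (2) there is a Σ_n ∧ Π_n sentence in HCons(Σ_n↓Π_n,T) ∩ HCons(Σ_n↓Π_n,U) \ (Th(T) ∪ Th(U)); (3) there is a sentence in HCons(Σ_n↓Π_n,T) ∩ HCons(Σ_n↓Π_n,U) \ (Th(T) ∪ Th(U)); (4) HCons(Σ_n↓Π_n,T) \ Th(U) ≠ ∅. -/

import Mathlib

open FirstOrder Language
open scoped FirstOrder

namespace Guaspari

/-- The first-order language of arithmetic: a constant `0`, a unary function `S`,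
binary functions `+` (coded `false`) and `·` (coded `true`), and a binary relation `≤`. -/
def LA : FirstOrder.Language :=
  ⟨fun n => match n with | 0 => Unit | 1 => Unit | 2 => Bool | _ => Empty,
   fun n => match n with | 2 => Unit | _ => Empty⟩

/-- Sentences of the language of arithmetic. -/
abbrev Snt : Type := LA.Sentence

/-- Theories (sets of sentences) in the language of arithmetic. -/
abbrev Thy : Type := LA.Theory

/-- The term `0`. -/
def zeroT {α : Type} {n : ℕ} : LA.Term (α ⊕ Fin n) :=
  Constants.term (show LA.Constants from Unit.unit)

/-- The term `S t`. -/
def succT {α : Type} {n : ℕ} (t : LA.Term (α ⊕ Fin n)) : LA.Term (α ⊕ Fin n) :=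
  Functions.apply₁ (show LA.Functions 1 from Unit.unit) t

/-- The term `t + u`. -/
def addT {α : Type} {n : ℕ} (t u : LA.Term (α ⊕ Fin n)) : LA.Term (α ⊕ Fin n) :=
  Functions.apply₂ (show LA.Functions 2 from false) t u

/-- The term `t * u`. -/
def mulT {α : Type} {n : ℕ} (t u : LA.Term (α ⊕ Fin n)) : LA.Term (α ⊕ Fin n) :=
  Functions.apply₂ (show LA.Functions 2 from true) t u

/-- The atomic formula `t ≤ u`. -/
def leF {α : Type} {n : ℕ} (t u : LA.Term (α ⊕ Fin n)) : LA.BoundedFormula α n :=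
  Relations.boundedFormula₂ (show LA.Relations 2 from Unit.unit) t u

/-- The `i`-th (de Bruijn-indexed) bound variable as a term. -/
def vT {m : ℕ} (i : Fin m) : LA.Term (Empty ⊕ Fin m) := Term.var (Sum.inr i)

/-- The induction axiom for the formula `φ(x₀,…,x_{k-1}, x_k)` with induction on `x_k`,
universally closed over the parameters `x₀,…,x_{k-1}`. -/
def indAxiom {k : ℕ} (φ : LA.BoundedFormula Empty (k + 1)) : Snt :=
  let base := ∀' ((vT (Fin.last k) =' zeroT) ⟹ φ)
  let step := ∀' (φ ⟹
    ∀' ((vT (Fin.last (k + 1)) =' succT (vT (Fin.castSucc (Fin.last k)))) ⟹ φ.liftAt 1 k))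
  ((base ⊓ step) ⟹ ∀' φ).alls

/-- The axioms of Peano arithmetic `PA`: the basic axioms for `0`, `S`, `+`, `·`, `≤`,
together with the full induction scheme. -/
def PAAx : Thy :=
  {∀' ∼(succT (vT 0) =' zeroT),
   ∀' ∀' ((succT (vT 0) =' succT (vT 1)) ⟹ (vT 0 =' vT 1)),
   ∀' (addT (vT 0) zeroT =' vT 0),
   ∀' ∀' (addT (vT 0) (succT (vT 1)) =' succT (addT (vT 0) (vT 1))),
   ∀' (mulT (vT 0) zeroT =' zeroT),
   ∀' ∀' (mulT (vT 0) (succT (vT 1)) =' addT (mulT (vT 0) (vT 1)) (vT 0)),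
   ∀' ∀' (leF (vT 0) (vT 1) ⇔ ∃' (addT (vT 2) (vT 0) =' vT 1))} ∪
  {φ | ∃ (k : ℕ) (ψ : LA.BoundedFormula Empty (k + 1)), φ = indAxiom ψ}

/-- `Prv T φ`: the sentence `φ` is provable from the theory `T` (equivalently, by the
Gödel completeness theorem, `φ` holds in every model of `T`). -/
def Prv (T : Thy) (φ : Snt) : Prop := T ⊨ᵇ φ

/-- `Th T`: the set of sentences provable from `T`. -/
def Th (T : Thy) : Set Snt := {φ | Prv T φ}

/-- `Con T`: the theory `T` is consistent. -/
def Con (T : Thy) : Prop := ¬ Prv T ⊥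

/-- The theory `T + φ`. -/
def add (T : Thy) (φ : Snt) : Thy := insert φ T

/-- `T` is an extension of `PA`. -/
def ExtPA (T : Thy) : Prop := ∀ φ ∈ PAAx, Prv T φ

/-- `V` is a subtheory of `T` (containing `PA`, as assumed throughout the paper). -/
def SubThy (V T : Thy) : Prop := ExtPA V ∧ ∀ φ, Prv V φ → Prv T φ

/-- Δ₀ (bounded) formulas. -/
inductive IsDelta0 : ∀ {m : ℕ}, LA.BoundedFormula Empty m → Prop
  | falsum {m : ℕ} : IsDelta0 (⊥ : LA.BoundedFormula Empty m)
  | equal {m : ℕ} (t u : LA.Term (Empty ⊕ Fin m)) : IsDelta0 (t =' u)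
  | le {m : ℕ} (t u : LA.Term (Empty ⊕ Fin m)) : IsDelta0 (leF t u)
  | imp {m : ℕ} {φ ψ : LA.BoundedFormula Empty m} :
      IsDelta0 φ → IsDelta0 ψ → IsDelta0 (φ ⟹ ψ)
  | ball {m : ℕ} (t : LA.Term (Empty ⊕ Fin m)) {φ : LA.BoundedFormula Empty (m + 1)} :
      IsDelta0 φ →
      IsDelta0 (∀' (leF (vT (Fin.last m)) (t.relabel (Sum.map id Fin.castSucc)) ⟹ φ))
  | bex {m : ℕ} (t : LA.Term (Empty ⊕ Fin m)) {φ : LA.BoundedFormula Empty (m + 1)} :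
      IsDelta0 φ →
      IsDelta0 (∃' (leF (vT (Fin.last m)) (t.relabel (Sum.map id Fin.castSucc)) ⊓ φ))

mutual
  /-- `Σ_k` formulas (cumulatively: every `Π_k` formula is `Σ_{k+1}`). -/
  inductive IsSigmaFml : ℕ → ∀ {m : ℕ}, LA.BoundedFormula Empty m → Prop
    | ofDelta0 {m : ℕ} {φ : LA.BoundedFormula Empty m} : IsDelta0 φ → IsSigmaFml 0 φ
    | ofPi {k : ℕ} {m : ℕ} {φ : LA.BoundedFormula Empty m} :
        IsPiFml k φ → IsSigmaFml (k + 1) φ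
    | ex {k : ℕ} {m : ℕ} {φ : LA.BoundedFormula Empty (m + 1)} :
        IsSigmaFml (k + 1) φ → IsSigmaFml (k + 1) (∃' φ)
  /-- `Π_k` formulas (cumulatively: every `Σ_k` formula is `Π_{k+1}`). -/
  inductive IsPiFml : ℕ → ∀ {m : ℕ}, LA.BoundedFormula Empty m → Prop
    | ofDelta0 {m : ℕ} {φ : LA.BoundedFormula Empty m} : IsDelta0 φ → IsPiFml 0 φ
    | ofSigma {k : ℕ} {m : ℕ} {φ : LA.BoundedFormula Empty m} :
        IsSigmaFml k φ → IsPiFml (k + 1) φ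
    | all {k : ℕ} {m : ℕ} {φ : LA.BoundedFormula Empty (m + 1)} :
        IsPiFml (k + 1) φ → IsPiFml (k + 1) (∀' φ)
end

/-- The set of `Σ_k` sentences. -/
def SigmaS (k : ℕ) : Set Snt := {φ | IsSigmaFml k φ}

/-- The set of `Π_k` sentences. -/
def PiS (k : ℕ) : Set Snt := {φ | IsPiFml k φ}

/-- The set of `Σ_k ∧ Π_k` sentences, i.e. sentences of the form `σ ∧ π` with
`σ` a `Σ_k` sentence and `π` a `Π_k` sentence. -/
def SigAndPiS (k : ℕ) : Set Snt :=
  {φ | ∃ σ ∈ SigmaS k, ∃ π ∈ PiS k, φ = σ ⊓ π}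

/-- `B(Σ_k)` sentences: Boolean combinations of `Σ_k` sentences. -/
inductive IsBoolSigma (k : ℕ) : Snt → Prop
  | base {φ : Snt} : φ ∈ SigmaS k → IsBoolSigma k φ
  | not {φ : Snt} : IsBoolSigma k φ → IsBoolSigma k (∼φ)
  | imp {φ ψ : Snt} : IsBoolSigma k φ → IsBoolSigma k ψ → IsBoolSigma k (φ ⟹ ψ)
  | inf {φ ψ : Snt} : IsBoolSigma k φ → IsBoolSigma k ψ → IsBoolSigma k (φ ⊓ ψ)
  | sup {φ ψ : Snt} : IsBoolSigma k φ → IsBoolSigma k ψ → IsBoolSigma k (φ ⊔ ψ)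

/-- The set of `B(Σ_k)` sentences. -/
def BSigmaS (k : ℕ) : Set Snt := {φ | IsBoolSigma k φ}

/-- The set of `Γ` sentences provable in `T`, `Th_Γ(T)`. -/
def ThIn (Γ : Set Snt) (T : Thy) : Set Snt := Γ ∩ Th T

instance (i : ℕ) : Encodable (LA.Functions i) :=
  match i with
  | 0 => inferInstanceAs (Encodable Unit)
  | 1 => inferInstanceAs (Encodable Unit)
  | 2 => inferInstanceAs (Encodable Bool)
  | (_ + 3) => inferInstanceAs (Encodable Empty)

instance (i : ℕ) : Encodable (LA.Relations i) :=
  match i with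
  | 0 => inferInstanceAs (Encodable Empty)
  | 1 => inferInstanceAs (Encodable Empty)
  | 2 => inferInstanceAs (Encodable Unit)
  | (_ + 3) => inferInstanceAs (Encodable Empty)

/-- A Gödel numbering of sentences, via Mathlib's encoding of bounded formulas. -/
def gnum (φ : Snt) : ℕ :=
  Encodable.encode
    (show List ((Σ k, LA.Term (Empty ⊕ Fin k)) ⊕ ((Σ n, LA.Relations n) ⊕ ℕ)) from
      BoundedFormula.encoding.encode (⟨0, φ⟩ : Σ n, LA.BoundedFormula Empty n))

/-- The (axiom set of the) theory `T` is computable. -/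
def CompThy (T : Thy) : Prop :=
  ComputablePred (fun m : ℕ => ∃ φ ∈ T, gnum φ = m)

/-- `T` is a computable consistent extension of `PA`. -/
def GoodThy (T : Thy) : Prop := CompThy T ∧ Con T ∧ ExtPA T

/-- `φ` is `Γ`-conservative over `T` for a class of sentences `Γ`:
every `Γ` sentence provable in `T + φ` is provable in `T`. -/
def ConsIn (Γ : Set Snt) (T : Thy) (φ : Snt) : Prop :=
  ∀ γ ∈ Γ, Prv (add T φ) γ → Prv T γ

/-- `φ` is hereditarily `Γ`-conservative over `T`: `Γ`-conservative over every
subtheory of `T` (containing `PA`). -/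
def HConsIn (Γ : Set Snt) (T : Thy) (φ : Snt) : Prop :=
  ∀ V : Thy, SubThy V T → ConsIn Γ V φ

/-- `φ` is `Σ_k↓Π_k`-conservative over `V`. -/
def SPCons (k : ℕ) (V : Thy) (φ : Snt) : Prop :=
  ∀ σ ∈ SigmaS k, ∀ π ∈ PiS k, Prv (add V φ) (σ ⊓ π) → Prv V (σ ⊔ π)

/-- `φ` is hereditarily `Σ_k↓Π_k`-conservative over `T`. -/
def HSPCons (k : ℕ) (T : Thy) (φ : Snt) : Prop :=
  ∀ V : Thy, SubThy V T → SPCons k V φ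

/-- The theory `S` is `Σ_k↓Π_k`-conservative over `PA`. -/
def ThySPConsPA (k : ℕ) (S : Thy) : Prop :=
  ∀ σ ∈ SigmaS k, ∀ π ∈ PiS k, Prv S (σ ⊓ π) → Prv PAAx (σ ⊔ π)

/-- `δ` is a `Δ_k(S)` sentence: `S`-provably equivalent to both a `Σ_k` sentence
and a `Π_k` sentence. -/
def IsDeltaIn (k : ℕ) (S : Thy) (δ : Snt) : Prop :=
  (∃ σ ∈ SigmaS k, Prv S (δ ⇔ σ)) ∧ ∃ π ∈ PiS k, Prv S (δ ⇔ π)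

/-- `φ` is `Δ_k(S)`-conservative over `V`. -/
def DeltaConsRel (k : ℕ) (S V : Thy) (φ : Snt) : Prop :=
  ∀ δ : Snt, IsDeltaIn k S δ → Prv (add V φ) δ → Prv V δ

/-- `φ` is `Δ_k`-conservative over `T`, i.e. `Δ_k(Th(T))`-conservative over `T`. -/
def DeltaCons (k : ℕ) (T : Thy) (φ : Snt) : Prop := DeltaConsRel k (Th T) T φ

/-- `φ` is hereditarily `Δ_k`-conservative over `T`. -/
def HDeltaCons (k : ℕ) (T : Thy) (φ : Snt) : Prop :=
  ∀ V : Thy, SubThy V T → DeltaConsRel k (Th V) V φ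

/-- `φ` is doubly `Π_k`-conservative over `T`: `φ` is `Π_k`-conservative and `¬φ` is
`Σ_k`-conservative over `T`. -/
def DCons (k : ℕ) (T : Thy) (φ : Snt) : Prop :=
  ConsIn (PiS k) T φ ∧ ConsIn (SigmaS k) T (∼φ)

/-- `φ` is hereditarily doubly `Π_k`-conservative over `T`. -/
def HDCons (k : ℕ) (T : Thy) (φ : Snt) : Prop :=
  ∀ V : Thy, SubThy V T → DCons k V φ

/-- `(T,U)` is a `B_n`-pair. -/
def Bpair (n : ℕ) (T U : Thy) : Prop :=
  (¬ ThIn (PiS n) T ⊆ Th U ∨ Con (T ∪ ThIn (PiS n) U)) ∧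
  (¬ ThIn (PiS n) U ⊆ Th T ∨ Con (U ∪ ThIn (PiS n) T))

/-- `(T,U)` is a `C_n`-pair. -/
def Cpair (n : ℕ) (T U : Thy) : Prop :=
  Con (T ∪ ThIn (PiS n) U) ∧ Con (U ∪ ThIn (PiS n) T)

/-- `(T,U)` is a `C⁻_n`-pair. -/
def Cmpair (n : ℕ) (T U : Thy) : Prop :=
  Con (T ∪ ThIn (PiS n) U) ∨ Con (U ∪ ThIn (PiS n) T)

/-- `(T,U)` is a `C^∧_n`-pair. -/
def Capair (n : ℕ) (T U : Thy) : Prop :=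
  Con (T ∪ ThIn (SigAndPiS n) U) ∧ Con (U ∪ ThIn (SigAndPiS n) T)

/-- `(T,U)` is a `C^B_n`-pair. -/
def CBpair (n : ℕ) (T U : Thy) : Prop :=
  Con (T ∪ ThIn (BSigmaS n) U)



/-- A bundled model of PA. -/
structure Mod where
  carrier : Type
  str : LA.Structure carrier
  pa : carrier ⊨ PAAx

instance : CoeSort Mod Type := ⟨Mod.carrier⟩
instance (M : Mod) : LA.Structure M := M.str

section Raw
variable {M : Mod}

instance : Zero M := ⟨Structure.funMap (L := LA) (show LA.Functions 0 from Unit.unit) ![]⟩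
instance : Add M := ⟨fun x y => Structure.funMap (L := LA) (show LA.Functions 2 from false) ![x, y]⟩
instance : Mul M := ⟨fun x y => Structure.funMap (L := LA) (show LA.Functions 2 from true) ![x, y]⟩
instance : LE M := ⟨fun x y => Structure.RelMap (L := LA) (show LA.Relations 2 from Unit.unit) ![x, y]⟩
/-- Successor. -/
def sc (x : M) : M := Structure.funMap (L := LA) (show LA.Functions 1 from Unit.unit) ![x]

variable {α : Type} {m : ℕ}

@[simp] theorem rz_zero (v : α ⊕ Fin m → M) : (zeroT : LA.Term (α ⊕ Fin m)).realize v = 0 := by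
  show Structure.funMap _ _ = Structure.funMap _ _
  congr 1
  exact Subsingleton.elim _ _
@[simp] theorem rz_succ (v : α ⊕ Fin m → M) (t : LA.Term (α ⊕ Fin m)) :
    (succT t).realize v = sc (t.realize v) := by
  exact Term.realize_functions_apply₁
@[simp] theorem rz_add (v : α ⊕ Fin m → M) (t u : LA.Term (α ⊕ Fin m)) :
    (addT t u).realize v = t.realize v + u.realize v := by
  exact Term.realize_functions_apply₂
@[simp] theorem rz_mul (v : α ⊕ Fin m → M) (t u : LA.Term (α ⊕ Fin m)) :
    (mulT t u).realize v = t.realize v * u.realize v := by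
  exact Term.realize_functions_apply₂
@[simp] theorem rz_v (v : Empty → M) (w : Fin m → M) (i : Fin m) :
    (vT i).realize (Sum.elim v w) = w i := rfl
@[simp] theorem rz_le (v : α → M) (w : Fin m → M) (t u : LA.Term (α ⊕ Fin m)) :
    (leF t u).Realize v w ↔ t.realize (Sum.elim v w) ≤ u.realize (Sum.elim v w) := by
  exact BoundedFormula.realize_rel₂

/-- terms with parameters in `M` -/
class Tm (f : (Fin m → M) → M) : Prop where
  ex : ∃ t : LA.Term (M ⊕ Fin m), ∀ v, t.realize (Sum.elim id v) = f v
/-- definable with parameters in `M` -/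
class Df (R : (Fin m → M) → Prop) : Prop where
  ex : ∃ ψ : LA.BoundedFormula M m, ∀ v, ψ.Realize id v ↔ R v

instance tm_var (i : Fin m) : Tm (M := M) (fun v => v i) := ⟨Term.var (Sum.inr i), fun _ => rfl⟩
instance tm_const (c : M) : Tm (M := M) (m := m) (fun _ => c) := ⟨Term.var (Sum.inl c), fun _ => rfl⟩
instance tm_sc (f : (Fin m → M) → M) [hf : Tm f] : Tm (fun v => sc (f v)) := by
  obtain ⟨t, ht⟩ := hf.ex; exact ⟨succT t, fun v => by simp [ht]⟩
instance tm_add (f g : (Fin m → M) → M) [hf : Tm f] [hg : Tm g] : Tm (fun v => f v + g v) := by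
  obtain ⟨t, ht⟩ := hf.ex; obtain ⟨u, hu⟩ := hg.ex; exact ⟨addT t u, fun v => by simp [ht, hu]⟩
instance tm_mul (f g : (Fin m → M) → M) [hf : Tm f] [hg : Tm g] : Tm (fun v => f v * g v) := by
  obtain ⟨t, ht⟩ := hf.ex; obtain ⟨u, hu⟩ := hg.ex; exact ⟨mulT t u, fun v => by simp [ht, hu]⟩

instance df_const (p : Prop) : Df (M := M) (m := m) (fun _ => p) := by
  by_cases h : p
  · exact ⟨⊤, fun v => by simp [h]⟩
  · exact ⟨⊥, fun v => by simp [h]⟩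
instance df_eq (f g : (Fin m → M) → M) [hf : Tm f] [hg : Tm g] : Df (fun v => f v = g v) := by
  obtain ⟨t, ht⟩ := hf.ex; obtain ⟨u, hu⟩ := hg.ex
  exact ⟨t =' u, fun v => by simp [ht, hu]⟩
instance df_le (f g : (Fin m → M) → M) [hf : Tm f] [hg : Tm g] : Df (fun v => f v ≤ g v) := by
  obtain ⟨t, ht⟩ := hf.ex; obtain ⟨u, hu⟩ := hg.ex
  exact ⟨leF t u, fun v => by simp [ht, hu]⟩
instance df_imp (P Q : (Fin m → M) → Prop) [hf : Df P] [hg : Df Q] : Df (fun v => P v → Q v) := by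
  obtain ⟨t, ht⟩ := hf.ex; obtain ⟨u, hu⟩ := hg.ex
  exact ⟨t ⟹ u, fun v => by simp [ht, hu]⟩
instance df_and (P Q : (Fin m → M) → Prop) [hf : Df P] [hg : Df Q] : Df (fun v => P v ∧ Q v) := by
  obtain ⟨t, ht⟩ := hf.ex; obtain ⟨u, hu⟩ := hg.ex
  exact ⟨t ⊓ u, fun v => by simp [ht, hu]⟩
instance df_or (P Q : (Fin m → M) → Prop) [hf : Df P] [hg : Df Q] : Df (fun v => P v ∨ Q v) := by
  obtain ⟨t, ht⟩ := hf.ex; obtain ⟨u, hu⟩ := hg.ex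
  exact ⟨t ⊔ u, fun v => by simp [ht, hu]⟩
instance df_iff (P Q : (Fin m → M) → Prop) [hf : Df P] [hg : Df Q] : Df (fun v => P v ↔ Q v) := by
  obtain ⟨t, ht⟩ := hf.ex; obtain ⟨u, hu⟩ := hg.ex
  exact ⟨t ⇔ u, fun v => by simp [ht, hu]⟩
instance df_not (P : (Fin m → M) → Prop) [hf : Df P] : Df (fun v => ¬ P v) := by
  obtain ⟨t, ht⟩ := hf.ex
  exact ⟨∼t, fun v => by simp [ht]⟩
instance df_all (Q : (Fin m → M) → M → Prop)
    [hf : Df (m := m + 1) (fun w => Q (fun i => w i.castSucc) (w (Fin.last m)))] :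
    Df (fun v => ∀ x, Q v x) := by
  obtain ⟨t, ht⟩ := hf.ex
  exact ⟨∀' t, fun v => by simp [ht]⟩
instance df_ex (Q : (Fin m → M) → M → Prop)
    [hf : Df (m := m + 1) (fun w => Q (fun i => w i.castSucc) (w (Fin.last m)))] :
    Df (fun v => ∃ x, Q v x) := by
  obtain ⟨t, ht⟩ := hf.ex
  exact ⟨∃' t, fun v => by simp [ht]⟩

example (c d : M) : Df (m := 1) (fun v : Fin 1 → M => ∀ x, (∃ y, x + y = v 0 * c ∧ y ≤ d) → x = v 0) :=
  inferInstance

/-- one-variable definable sets -/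
theorem induct (P : M → Prop) [hP : Df (m := 1) (fun v => P (v 0))] (h0 : P 0)
    (hs : ∀ x, P x → P (sc x)) (x : M) : P x := by
  classical
  obtain ⟨ψ, hψ⟩ := hP.ex
  let k := ψ.freeVarFinset.card
  let e : ψ.freeVarFinset ≃ Fin k := ψ.freeVarFinset.equivFin
  let χ : LA.BoundedFormula Empty (k + 1) :=
    BoundedFormula.relabel (fun i : Fin k => (Sum.inr i : Empty ⊕ Fin k)) (ψ.restrictFreeVar e)
  let pr : Fin k → M := fun i => (e.symm i).1
  have hχ : ∀ (d : Empty → M) (y : M) , χ.Realize d (Fin.snoc pr y) ↔ P y := by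
    intro d y
    rw [BoundedFormula.realize_relabel]
    rw [BoundedFormula.realize_restrictFreeVar (v' := id)]
    · rw [hψ]
      have : ((Fin.snoc pr y : Fin (k+1) → M) ∘ Fin.natAdd k) (0 : Fin 1) = y := by
        have : Fin.natAdd k (0 : Fin 1) = Fin.last k := rfl
        simp only [Function.comp, this, Fin.snoc_last]
      rw [this]
    · intro a
      have : (Fin.castAdd 1 (e a)) = Fin.castSucc (e a) := rfl
      simp only [Function.comp, Sum.elim_inr, this, Fin.snoc_castSucc, pr]
      simp
  have hax : M ⊨ indAxiom χ := M.pa.realize_of_mem _ (Or.inr ⟨k, χ, rfl⟩)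
  have h2 : ∀ xs : Fin k → M, _ := BoundedFormula.realize_alls.1 hax
  have h3 := h2 pr
  simp only [BoundedFormula.realize_imp, BoundedFormula.realize_inf, BoundedFormula.realize_all] at h3
  have := h3 ⟨?_, ?_⟩ x
  · exact (hχ _ _).1 this
  · intro a ha
    simp at ha
    subst ha
    exact (hχ _ _).2 h0
  · intro a ha b hb
    rw [BoundedFormula.realize_liftAt_one (by omega)]
    simp only [BoundedFormula.realize_bdEqual, rz_v, rz_succ, Fin.snoc_last, Fin.snoc_castSucc] at hb
    have : ((Fin.snoc (Fin.snoc pr a : Fin (k+1) → M) b : Fin (k+2) → M) ∘ fun i : Fin (k+1) =>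
      if (i : ℕ) < k then i.castSucc else i.succ) = (Fin.snoc pr b : Fin (k+1) → M) := by
      funext i
      refine Fin.lastCases ?_ (fun i => ?_) i
      · simp
      · simp [Fin.snoc]
    rw [this, hχ, hb]
    exact hs a ((hχ _ _).1 ha)

end Raw

section Alg
variable {M : Mod}

theorem ax_mem (φ : Snt) (h : φ ∈ PAAx) : (M : Type) ⊨ φ := M.pa.realize_of_mem _ h

theorem sc_ne (x : M) : sc x ≠ 0 := by
  have h := ax_mem (M := M) (∀' ∼(succT (vT 0) =' zeroT)) (Or.inl (by simp))
  have h2 := h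
  simp only [Sentence.Realize, Formula.Realize, BoundedFormula.realize_all] at h2
  have := h2 x
  simpa [Fin.snoc] using this
theorem sc_inj {x y : M} (hxy : sc x = sc y) : x = y := by
  have h := ax_mem (M := M) (∀' ∀' ((succT (vT 0) =' succT (vT 1)) ⟹ (vT 0 =' vT 1))) (Or.inl (by simp))
  have h2 := h
  simp only [Sentence.Realize, Formula.Realize, BoundedFormula.realize_all] at h2
  have := h2 x y
  simp [Fin.snoc] at this
  exact this hxy
theorem raw_add_zero (x : M) : x + 0 = x := by
  have h := ax_mem (M := M) (∀' (addT (vT 0) zeroT =' vT 0)) (Or.inl (by simp))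
  have h2 := h
  simp only [Sentence.Realize, Formula.Realize, BoundedFormula.realize_all] at h2
  have := h2 x
  simpa [Fin.snoc] using this
theorem raw_add_sc (x y : M) : x + sc y = sc (x + y) := by
  have h := ax_mem (M := M) (∀' ∀' (addT (vT 0) (succT (vT 1)) =' succT (addT (vT 0) (vT 1)))) (Or.inl (by simp))
  have h2 := h
  simp only [Sentence.Realize, Formula.Realize, BoundedFormula.realize_all] at h2
  have := h2 x y
  simpa [Fin.snoc] using this
theorem raw_mul_zero (x : M) : x * 0 = 0 := by
  have h := ax_mem (M := M) (∀' (mulT (vT 0) zeroT =' zeroT)) (Or.inl (by simp))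
  have h2 := h
  simp only [Sentence.Realize, Formula.Realize, BoundedFormula.realize_all] at h2
  have := h2 x
  simpa [Fin.snoc] using this
theorem raw_mul_sc (x y : M) : x * sc y = x * y + x := by
  have h := ax_mem (M := M) (∀' ∀' (mulT (vT 0) (succT (vT 1)) =' addT (mulT (vT 0) (vT 1)) (vT 0))) (Or.inl (by simp))
  have h2 := h
  simp only [Sentence.Realize, Formula.Realize, BoundedFormula.realize_all] at h2
  have := h2 x y
  simpa [Fin.snoc] using this
theorem raw_le (x y : M) : x ≤ y ↔ ∃ z, z + x = y := by
  have h := ax_mem (M := M) (∀' ∀' (leF (vT 0) (vT 1) ⇔ ∃' (addT (vT 2) (vT 0) =' vT 1))) (Or.inl (by simp))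
  have h2 := h
  simp only [Sentence.Realize, Formula.Realize, BoundedFormula.realize_all] at h2
  have := h2 x y
  simpa [Fin.snoc] using this

theorem raw_zero_add (x : M) : 0 + x = x := by
  refine induct (fun x : M => 0 + x = x) (raw_add_zero _) (fun x h => ?_) x
  rw [raw_add_sc, h]
theorem raw_sc_add (x y : M) : sc x + y = sc (x + y) := by
  refine induct (fun y : M => sc x + y = sc (x + y)) (by rw [raw_add_zero, raw_add_zero]) (fun y h => ?_) y
  rw [raw_add_sc, h, raw_add_sc]
theorem raw_add_comm (x y : M) : x + y = y + x := by
  refine induct (fun y : M => x + y = y + x) (by rw [raw_add_zero, raw_zero_add]) (fun y h => ?_) y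
  rw [raw_add_sc, h, raw_sc_add]
theorem raw_add_assoc (x y z : M) : x + y + z = x + (y + z) := by
  refine induct (fun z : M => x + y + z = x + (y + z)) (by rw [raw_add_zero, raw_add_zero]) (fun z h => ?_) z
  rw [raw_add_sc, h, raw_add_sc, raw_add_sc]
theorem raw_add_cancel {x y z : M} : x + z = y + z → x = y := by
  refine induct (fun z : M => x + z = y + z → x = y) (by rw [raw_add_zero, raw_add_zero]; exact id) (fun z h => ?_) z
  rw [raw_add_sc, raw_add_sc]; exact fun h' => h (sc_inj h')
theorem raw_zero_mul (x : M) : 0 * x = 0 := by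
  refine induct (fun x : M => 0 * x = 0) (raw_mul_zero _) (fun x h => ?_) x
  rw [raw_mul_sc, h, raw_add_zero]
theorem raw_sc_mul (x y : M) : sc x * y = x * y + y := by
  refine induct (fun y : M => sc x * y = x * y + y) (by simp only [raw_mul_zero, raw_add_zero]) (fun y h => ?_) y
  rw [raw_mul_sc, h, raw_mul_sc, raw_add_sc, raw_add_sc, raw_add_assoc, raw_add_assoc, raw_add_comm y]
theorem raw_mul_comm (x y : M) : x * y = y * x := by
  refine induct (fun y : M => x * y = y * x) (by rw [raw_mul_zero, raw_zero_mul]) (fun y h => ?_) y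
  rw [raw_mul_sc, h, raw_sc_mul]
theorem raw_mul_add (x y z : M) : x * (y + z) = x * y + x * z := by
  refine induct (fun z : M => x * (y + z) = x * y + x * z) (by rw [raw_add_zero, raw_mul_zero, raw_add_zero]) (fun z h => ?_) z
  rw [raw_add_sc, raw_mul_sc, h, raw_mul_sc, raw_add_assoc]
theorem raw_mul_assoc (x y z : M) : x * y * z = x * (y * z) := by
  refine induct (fun z : M => x * y * z = x * (y * z)) (by simp only [raw_mul_zero]) (fun z h => ?_) z
  rw [raw_mul_sc, h, raw_mul_sc, raw_mul_add]

instance : One M := ⟨sc 0⟩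
theorem one_def : (1 : M) = sc 0 := rfl
theorem raw_mul_one (x : M) : x * 1 = x := by rw [one_def, raw_mul_sc, raw_mul_zero, raw_zero_add]
theorem sc_eq (x : M) : sc x = x + 1 := by rw [one_def, raw_add_sc, raw_add_zero]

instance instCS : CommSemiring M where
  add_assoc := raw_add_assoc
  zero_add := raw_zero_add
  add_zero := raw_add_zero
  add_comm := raw_add_comm
  mul_assoc := raw_mul_assoc
  zero_mul := raw_zero_mul
  mul_zero := raw_mul_zero
  one_mul x := by rw [raw_mul_comm, raw_mul_one]
  mul_one := raw_mul_one
  left_distrib := raw_mul_add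
  right_distrib x y z := by rw [raw_mul_comm, raw_mul_add, raw_mul_comm z, raw_mul_comm z]
  mul_comm := raw_mul_comm
  nsmul := nsmulRec

theorem mcases (x : M) : x = 0 ∨ ∃ y, x = y + 1 :=
  induct (fun x : M => x = 0 ∨ ∃ y, x = y + sc 0) (Or.inl rfl) (fun x _ => Or.inr ⟨x, sc_eq x⟩) x

theorem raw_total (x y : M) : x ≤ y ∨ y ≤ x := by
  refine induct (fun x : M => x ≤ y ∨ y ≤ x) (Or.inl ((raw_le _ _).2 ⟨y, add_zero y⟩)) (fun x h => ?_) x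
  rcases h with h | h
  · obtain ⟨z, rfl⟩ := (raw_le _ _).1 h
    rcases mcases z with rfl | ⟨z, rfl⟩
    · right; rw [raw_le]; exact ⟨1, by rw [sc_eq]; ring⟩
    · left; rw [raw_le]; exact ⟨z, by rw [sc_eq]; ring⟩
  · obtain ⟨z, rfl⟩ := (raw_le _ _).1 h
    right; rw [raw_le]; exact ⟨z + 1, by rw [sc_eq]; ring⟩

theorem raw_add_eq_zero {x y : M} (h : x + y = 0) : y = 0 := by
  rcases mcases y with rfl | ⟨z, rfl⟩
  · rfl
  · rw [← add_assoc, ← sc_eq] at h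
    exact absurd h (sc_ne _)

noncomputable instance instLO : LinearOrder M where
  le_refl x := (raw_le _ _).2 ⟨0, zero_add x⟩
  le_trans x y z h1 h2 := by
    obtain ⟨a, rfl⟩ := (raw_le _ _).1 h1
    obtain ⟨b, rfl⟩ := (raw_le _ _).1 h2
    exact (raw_le _ _).2 ⟨b + a, by ring⟩
  le_antisymm x y h1 h2 := by
    obtain ⟨a, rfl⟩ := (raw_le _ _).1 h1
    obtain ⟨b, h⟩ := (raw_le _ _).1 h2
    have : b + a + x = 0 + x := by rw [zero_add]; rw [← add_assoc] at h; exact h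
    have := raw_add_eq_zero (raw_add_cancel this)
    rw [this, zero_add]
  le_total := raw_total
  toDecidableLE := Classical.decRel _

theorem m_le_iff {x y : M} : x ≤ y ↔ ∃ z, y = x + z := by
  rw [raw_le]; constructor <;> rintro ⟨z, h⟩ <;> exact ⟨z, by rw [add_comm, h]⟩

instance : CanonicallyOrderedAdd M where
  exists_add_of_le h := m_le_iff.1 h
  le_add_self _ y := m_le_iff.2 ⟨y, add_comm _ _⟩
  le_self_add _ y := m_le_iff.2 ⟨y, rfl⟩

instance : IsCancelAdd M where
  add_left_cancel x y z h := by
    have h : x + y = x + z := h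
    rw [add_comm x, add_comm x] at h; exact raw_add_cancel h
  add_right_cancel x y z h := raw_add_cancel h

instance : IsOrderedAddMonoid M where
  add_le_add_left x y h z := by
    obtain ⟨w, rfl⟩ := m_le_iff.1 h
    exact m_le_iff.2 ⟨w, by ring⟩
instance : IsOrderedCancelAddMonoid M where
  le_of_add_le_add_left x y z h := by
    obtain ⟨w, h⟩ := m_le_iff.1 h
    rw [add_assoc] at h
    exact m_le_iff.2 ⟨w, add_left_cancel h⟩

instance : Nontrivial M := ⟨0, 1, fun h => sc_ne (0 : M) h.symm⟩

theorem m_lt_iff {x y : M} : x < y ↔ x + 1 ≤ y := by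
  constructor
  · intro h
    obtain ⟨w, rfl⟩ := m_le_iff.1 h.le
    rcases mcases w with rfl | ⟨z, rfl⟩
    · simp at h
    · exact m_le_iff.2 ⟨z, by ring⟩
  · intro h
    refine lt_of_lt_of_le ?_ h
    refine lt_of_le_of_ne (m_le_iff.2 ⟨1, rfl⟩) (fun h' => ?_)
    have : x + 0 = x + 1 := by rw [add_zero]; exact h'
    exact zero_ne_one (add_left_cancel this)
theorem m_lt_add_one {x y : M} : x < y + 1 ↔ x ≤ y := by
  rw [m_lt_iff]; exact add_le_add_iff_right 1

instance : NoZeroDivisors M where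
  eq_zero_or_eq_zero_of_mul_eq_zero {x y} h := by
    rcases mcases x with rfl | ⟨z, rfl⟩
    · exact Or.inl rfl
    · right
      have : z * y + y = 0 := by rw [← h]; ring
      exact raw_add_eq_zero this

instance : IsStrictOrderedRing M := by
  have hm : ∀ a b c : M, a < b → 0 < c → c * a < c * b := by
    intro a b c h hc
    obtain ⟨w, rfl⟩ := m_le_iff.1 (m_lt_iff.1 h)
    have : c * (a + 1 + w) = c * a + (c + c * w) := by ring
    rw [this]
    exact lt_add_of_pos_right _ (lt_of_lt_of_le hc le_self_add)
  exact { zero_le_one := zero_le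
          mul_lt_mul_of_pos_left := fun c hc a b h => hm a b c h hc
          mul_lt_mul_of_pos_right := fun c hc a b h => by
            have := hm a b c h hc
            simpa [mul_comm] using this }

instance tm_one {m : ℕ} : Tm (M := M) (m := m) (fun _ => 1) := inferInstance
instance df_lt {m : ℕ} (f g : (Fin m → M) → M) [hf : Tm f] [hg : Tm g] : Df (fun v => f v < g v) := by
  simp only [m_lt_iff]; infer_instance

instance df_dvd {m : ℕ} (f g : (Fin m → M) → M) [hf : Tm f] [hg : Tm g] : Df (fun v => f v ∣ g v) := by
  obtain ⟨t, ht⟩ := hf.ex; obtain ⟨u, hu⟩ := hg.ex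
  have h1 : Tm (m := m + 1) (fun w => f (fun i => w i.castSucc)) :=
    ⟨t.relabel (Sum.map id Fin.castSucc), fun w => by
      rw [Term.realize_relabel, ← ht]; congr 1; ext x; cases x <;> rfl⟩
  have h2 : Tm (m := m + 1) (fun w => g (fun i => w i.castSucc)) :=
    ⟨u.relabel (Sum.map id Fin.castSucc), fun w => by
      rw [Term.realize_relabel, ← hu]; congr 1; ext x; cases x <;> rfl⟩
  simp only [dvd_def]
  infer_instance

/-- induction -/
theorem ind1 (P : M → Prop) [hP : Df (m := 1) (fun v => P (v 0))] (h0 : P 0)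
    (hs : ∀ x, P x → P (x + 1)) (x : M) : P x :=
  induct P h0 (fun x h => by rw [sc_eq]; exact hs x h) x

theorem df_shift {m k : ℕ} (R : (Fin k → M) → Prop) [hR : Df R] :
    Df (M := M) (m := m + k) (fun v => R (fun i => v (Fin.natAdd m i))) := by
  obtain ⟨ψ, hψ⟩ := hR.ex
  refine ⟨(ψ.relabel (n := m) (fun c => Sum.inl c)), fun v => ?_⟩
  rw [BoundedFormula.realize_relabel]
  have : (Sum.elim id (v ∘ Fin.castAdd k) ∘ fun c : M => (Sum.inl c : M ⊕ Fin m)) = id := rfl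
  rw [this, hψ]; rfl

theorem tm_lift {m : ℕ} (f : (Fin m → M) → M) [hf : Tm f] :
    Tm (m := m + 1) (fun w => f (fun i => w i.castSucc)) := by
  obtain ⟨t, ht⟩ := hf.ex
  exact ⟨t.relabel (Sum.map id Fin.castSucc), fun w => by
      rw [Term.realize_relabel, ← ht]; congr 1; ext x; cases x <;> rfl⟩

theorem df_comp1 {m : ℕ} (P : M → Prop) (hP : Df (m := 1) (fun v => P (v 0)))
    (t : (Fin m → M) → M) [ht : Tm t] : Df (fun v => P (t v)) := by
  have h1 : Df (M := M) (m := m + 1) (fun v => P (v (Fin.last m))) := df_shift (m := m) (fun v : Fin 1 → M => P (v 0))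
  have h2 := tm_lift t
  have : (fun v => P (t v)) = fun v => ∀ x, x = t v → P x := by
    funext v; simp
  rw [this]; infer_instance

theorem df_comp2 {m : ℕ} (P : M → M → Prop) (hP : Df (m := 2) (fun v => P (v 0) (v 1)))
    (t u : (Fin m → M) → M) [ht : Tm t] [hu : Tm u] : Df (fun v => P (t v) (u v)) := by
  have h1 : Df (M := M) (m := m + 1 + 1) (fun v => P (v (Fin.last m).castSucc) (v (Fin.last (m+1)))) :=
    df_shift (m := m) (fun v : Fin 2 → M => P (v 0) (v 1))
  have h2 := tm_lift t
  have h3 := tm_lift u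
  have h4 := tm_lift _ (hf := h2)
  have h5 := tm_lift _ (hf := h3)
  have : (fun v => P (t v) (u v)) = fun v => ∀ x y, x = t v → y = u v → P x y := by
    funext v; simp
  rw [this]; infer_instance

/-- least number principle -/
theorem lnp (P : M → Prop) [hP : Df (m := 1) (fun v => P (v 0))] {x : M} (hx : P x) :
    ∃ y, P y ∧ ∀ z < y, ¬ P z := by
  by_contra hc
  push Not at hc
  have : Df (M := M) (m := 1) (fun v => ∀ z, z < v 0 → ¬ P z) := by
    have : Df (M := M) (m := 2) (fun v => P (v (Fin.last 1))) := df_comp1 P hP _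
    infer_instance
  have := ind1 (fun x : M => ∀ z, z < x → ¬ P z) (by simp) (fun x ih z hz hPz => by
    rcases lt_or_eq_of_le (m_lt_add_one.1 hz) with h | rfl
    · exact ih _ h hPz
    · obtain ⟨w, hw, h2⟩ := hc _ hPz
      exact ih _ hw h2) (x + 1) x (m_lt_add_one.2 le_rfl)
  exact this hx

/-- collection -/
theorem coll (P : M → M → Prop) (hP : Df (m := 2) (fun v => P (v 0) (v 1))) (b : M)
    (h : ∀ x < b, ∃ y, P x y) : ∃ N, ∀ x < b, ∃ y ≤ N, P x y := by
  have h3 : Df (M := M) (m := 4) (fun v => P (v 2) (v 3)) := df_comp2 P hP _ _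
  have h4 : Df (M := M) (m := 1) (fun v => v 0 ≤ b → ∃ N, ∀ x, x < v 0 → ∃ y, y ≤ N ∧ P x y) := by
    have : Df (M := M) (m := 4) (fun v => P (v (Fin.last 2).castSucc) (v (Fin.last 3))) := h3
    infer_instance
  refine ind1 (fun c : M => c ≤ b → ∃ N, ∀ x, x < c → ∃ y, y ≤ N ∧ P x y) (hP := h4) ?_ ?_ b le_rfl
  · exact fun _ => ⟨0, by simp⟩
  · intro c ih hc
    obtain ⟨N, hN⟩ := ih (le_trans le_self_add hc)
    obtain ⟨y, hy⟩ := h c (m_lt_iff.2 hc)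
    refine ⟨max N y, fun x hx => ?_⟩
    rcases lt_or_eq_of_le (m_lt_add_one.1 hx) with h | rfl
    · obtain ⟨z, hz, h2⟩ := hN _ h
      exact ⟨z, le_trans hz (le_max_left _ _), h2⟩
    · exact ⟨y, le_max_right _ _, hy⟩

/-- standard elements are an initial segment -/
theorem le_nat {k : ℕ} {x : M} (h : x ≤ (k : M)) : ∃ j : ℕ, j ≤ k ∧ x = j := by
  induction k generalizing x with
  | zero => exact ⟨0, le_rfl, by simpa using h⟩
  | succ k ih =>
    rcases lt_or_eq_of_le h with h | rfl
    · push_cast at h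
      obtain ⟨j, hj, rfl⟩ := ih (m_lt_add_one.1 h)
      exact ⟨j, by omega, rfl⟩
    · exact ⟨k + 1, le_rfl, rfl⟩

theorem nat_lt_nonst {x : M} (h : ∀ j : ℕ, x ≠ j) (k : ℕ) : (k : M) < x := by
  by_contra hc
  obtain ⟨j, -, rfl⟩ := le_nat (not_lt.1 hc)
  exact h j rfl

end Alg

section Compr
variable {M : Mod}

/-- moduli -/
def md (k d : M) : M := 1 + (k + 1) * d
instance tm_md {m : ℕ} (f g : (Fin m → M) → M) [hf : Tm f] [hg : Tm g] : Tm (fun v => md (f v) (g v)) := by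
  unfold md; infer_instance

theorem m_dvd_sub {m a b : M} (h1 : m ∣ a + b) (h2 : m ∣ a) : m ∣ b := by
  obtain ⟨q, hq⟩ := h1
  obtain ⟨p, rfl⟩ := h2
  rcases eq_or_ne m 0 with rfl | hm
  · simp at hq; simp [hq]
  have hm' : 0 < m := pos_of_ne_zero hm
  have : m * p ≤ m * q := by rw [← hq]; exact le_self_add
  have hpq : p ≤ q := le_of_mul_le_mul_left this hm'
  obtain ⟨r, rfl⟩ := m_le_iff.1 hpq
  exact ⟨r, by rw [mul_add] at hq; exact add_left_cancel hq⟩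

theorem md_cop_d {k d x : M} (h : md k d ∣ d * x) : md k d ∣ x := by
  have h1 : md k d ∣ (k + 1) * d * x + x := ⟨x, by unfold md; ring⟩
  refine m_dvd_sub h1 ?_
  rw [mul_assoc]; exact Dvd.dvd.mul_left h _

/-- weak coprimality -/
def cop (m c : M) : Prop := ∀ x, m ∣ c * x → m ∣ x
instance df_cop {m : ℕ} (f g : (Fin m → M) → M) [hf : Tm f] [hg : Tm g] : Df (fun v => cop (f v) (g v)) := by
  have := tm_lift f; have := tm_lift g
  unfold cop; infer_instance

theorem md_cop_aux {i e d B x : M} (hd : ∀ e, 0 < e → e ≤ B → e ∣ d) (he : 0 < e) (heB : e ≤ B)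
    (k : M) (h : md k d ∣ e * d * x) : md k d ∣ x := by
  obtain ⟨f, hf⟩ := hd e he heB
  have h1 : md k d ∣ e * x := md_cop_d (by convert h using 1; ring)
  have h2 : md k d ∣ d * x := by
    have : d * x = f * (e * x) := by rw [hf]; ring
    rw [this]; exact Dvd.dvd.mul_left h1 _
  exact md_cop_d h2

theorem md_cop {i j d B : M} (hd : ∀ e, 0 < e → e ≤ B → e ∣ d) (hi : i < B) (hj : j < B)
    (hij : i ≠ j) : cop (md i d) (md j d) := by
  intro x hx
  rcases lt_or_gt_of_ne hij with h | h
  · obtain ⟨e, rfl⟩ := m_le_iff.1 h.le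
    have he : 0 < e := pos_of_ne_zero (by rintro rfl; simp at hij)
    refine md_cop_aux (i := i) (e := e) hd he (le_trans le_add_self hj.le) i ?_
    have : md (i + e) d * x = md i d * x + e * d * x := by unfold md; ring
    rw [this] at hx
    exact m_dvd_sub hx ⟨x, rfl⟩
  · obtain ⟨e, rfl⟩ := m_le_iff.1 h.le
    have he : 0 < e := pos_of_ne_zero (by rintro rfl; simp at hij)
    refine md_cop_aux (i := j) (e := e) hd he (le_trans le_add_self hi.le) (j + e) ?_
    have : md (j + e) d * x = md j d * x + e * d * x := by unfold md; ring
    have h3 : md (j + e) d ∣ md j d * x + e * d * x := ⟨x, this.symm⟩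
    exact m_dvd_sub h3 hx

theorem compr_aux (D : M → Prop) [hD : Df (m := 1) (fun v => D (v 0))] {B d F : M}
    (hd0 : 0 < d) (hd : ∀ e, 0 < e → e ≤ B → e ∣ d)
    (hF : ∀ k < B, md k d ∣ F) : ∃ c, c ∣ F ∧ ∀ k < B, (md k d ∣ c ↔ D k) := by
  have h3 : Df (M := M) (m := 4) (fun v => D (v (Fin.last 3))) := df_comp1 D hD _
  have key := ind1 (fun B' : M => B' ≤ B → ∃ c r, c * r = F ∧ (∀ k, k < B' → D k → md k d ∣ c) ∧
    (∀ k, k < B → ¬ (k < B' ∧ D k) → cop (md k d) c) ∧ (∀ k, B' ≤ k → k < B → md k d ∣ r))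
    ?_ ?_ B le_rfl
  · obtain ⟨c, r, h1, h2, h4, -⟩ := key
    refine ⟨c, ⟨r, h1.symm⟩, fun k hk => ⟨fun h => ?_, h2 k hk⟩⟩
    by_contra hc
    have := h4 k hk (fun h => hc h.2) 1 (by rwa [mul_one])
    obtain ⟨q, hq⟩ := this
    have hq0 : 0 < q := pos_of_ne_zero (by rintro rfl; simp at hq)
    have h5 : md k d ≤ 1 := by
      calc md k d = md k d * 1 := (mul_one _).symm
        _ ≤ md k d * q := mul_le_mul_of_nonneg_left (by simpa using m_lt_iff.1 hq0) zero_le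
        _ = 1 := hq.symm
    have h6 : 1 < md k d := by
      unfold md
      refine lt_add_of_pos_right _ (mul_pos ?_ hd0)
      exact lt_of_lt_of_le zero_lt_one le_add_self
    exact absurd h6 (not_lt.2 h5)
  · intro _
    exact ⟨1, F, one_mul _, by simp, fun k _ _ x hx => by rwa [one_mul] at hx, fun k _ => hF k⟩
  · intro B' ih hB
    obtain ⟨c, r, h1, h2, h4, h5⟩ := ih (le_trans le_self_add hB)
    have hB' : B' < B := m_lt_iff.2 hB
    by_cases hDB : D B'
    · obtain ⟨r', rfl⟩ := h5 B' le_rfl hB'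
      refine ⟨c * md B' d, r', by rw [← h1]; ring, ?_, ?_, ?_⟩
      · intro k hk hDk
        rcases lt_or_eq_of_le (m_lt_add_one.1 hk) with h | rfl
        · exact Dvd.dvd.mul_right (h2 k h hDk) _
        · exact Dvd.intro_left _ rfl
      · intro k hk hn x hx
        have hne : k ≠ B' := by
          rintro rfl; exact hn ⟨m_lt_add_one.2 le_rfl, hDB⟩
        rw [mul_assoc] at hx
        exact md_cop hd hk hB' hne x (h4 k hk (fun h => hn ⟨lt_of_lt_of_le h.1 le_self_add, h.2⟩) _ hx)
      · intro k hk hkB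
        have h6 := m_lt_iff.2 hk
        exact md_cop hd hkB hB' h6.ne' _ (h5 k h6.le hkB)
    · refine ⟨c, r, h1, ?_, ?_, ?_⟩
      · intro k hk hDk
        rcases lt_or_eq_of_le (m_lt_add_one.1 hk) with h | rfl
        · exact h2 k h hDk
        · exact absurd hDk hDB
      · intro k hk hn
        exact h4 k hk (fun h => hn ⟨lt_of_lt_of_le h.1 le_self_add, h.2⟩)
      · exact fun k hk => h5 k (le_trans le_self_add hk)

theorem exists_d (B : M) : ∃ d, 0 < d ∧ ∀ e, 0 < e → e ≤ B → e ∣ d := by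
  refine ind1 (fun B : M => ∃ d, 0 < d ∧ ∀ e, 0 < e → e ≤ B → e ∣ d) ?_ ?_ B
  · exact ⟨1, zero_lt_one, fun e he he' => absurd he (not_lt.2 he')⟩
  · rintro B ⟨d, hd, h⟩
    refine ⟨d * (B + 1), mul_pos hd (lt_of_lt_of_le zero_lt_one le_add_self), fun e he he' => ?_⟩
    rcases lt_or_eq_of_le he' with h' | rfl
    · exact Dvd.dvd.mul_right (h e he (m_lt_add_one.1 h')) _
    · exact Dvd.intro_left _ rfl

theorem exists_F (B d : M) : ∃ F, 0 < F ∧ ∀ k, k < B → md k d ∣ F := by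
  refine ind1 (fun B : M => ∃ F, 0 < F ∧ ∀ k, k < B → md k d ∣ F) ?_ ?_ B
  · exact ⟨1, zero_lt_one, by simp⟩
  · rintro B ⟨F, hd, h⟩
    refine ⟨F * md B d, mul_pos hd (lt_of_lt_of_le zero_lt_one le_self_add), fun e he => ?_⟩
    rcases lt_or_eq_of_le (m_lt_add_one.1 he) with h' | rfl
    · exact Dvd.dvd.mul_right (h e h') _
    · exact Dvd.intro_left _ rfl

/-- membership in the set coded by `(B,c,d)` -/
def Mem (k B c d : M) : Prop := k < B ∧ md k d ∣ c

theorem compr (D : M → Prop) (hD : Df (m := 1) (fun v => D (v 0))) (B : M) :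
    ∃ c d, ∀ k, Mem k B c d ↔ (k < B ∧ D k) := by
  obtain ⟨d, h1, h2⟩ := exists_d B
  obtain ⟨F, h3, h4⟩ := exists_F B d
  obtain ⟨c, -, h⟩ := compr_aux D h1 h2 h4
  exact ⟨c, d, fun k => and_congr_right (h k)⟩

/-- pairing -/
def pr (x y : M) : M := (x + y) * (x + y) + x
instance tm_pr {m : ℕ} (f g : (Fin m → M) → M) [hf : Tm f] [hg : Tm g] : Tm (fun v => pr (f v) (g v)) := by
  unfold pr; infer_instance

theorem pr_inj {x y x' y' : M} (h : pr x y = pr x' y') : x = x' ∧ y = y' := by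
  have aux : ∀ {x y x' y' : M}, x + y < x' + y' → pr x y < pr x' y' := by
    intro x y x' y' h
    unfold pr
    obtain ⟨w, hw⟩ := m_le_iff.1 (m_lt_iff.1 h)
    rw [hw]
    refine lt_of_lt_of_le (b := (x + y + 1 + w) * (x + y + 1 + w)) ?_ le_self_add
    have : (x + y + 1 + w) * (x + y + 1 + w) = ((x + y) * (x + y) + x) + 1 + (x + y + y + w * (x + y + 1 + w) + (x + y + 1) * w) := by ring
    rw [this]
    exact m_lt_iff.2 le_self_add
  have hs : x + y = x' + y' := by
    rcases lt_trichotomy (x + y) (x' + y') with h' | h' | h'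
    · exact absurd h (aux h').ne
    · exact h'
    · exact absurd h (aux h').ne'
  unfold pr at h
  rw [hs] at h
  have hx := add_left_cancel h
  subst hx
  exact ⟨rfl, add_left_cancel hs⟩
@[simp] theorem pr_iff {x y x' y' : M} : pr x y = pr x' y' ↔ x = x' ∧ y = y' :=
  ⟨pr_inj, fun ⟨h1, h2⟩ => by rw [h1, h2]⟩

theorem m_le_sq (x : M) : x ≤ x * x := by
  rcases mcases x with rfl | ⟨y, rfl⟩
  · simp
  · have : (y + 1) * (y + 1) = (y + 1) + y * (y + 1) := by ring
    rw [this]; exact le_self_add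
theorem le_pr_left (x y : M) : x ≤ pr x y := le_add_self
theorem le_pr_right (x y : M) : y ≤ pr x y :=
  le_trans (le_trans le_add_self (m_le_sq (x + y))) le_self_add

end Compr


/-- uniform relations -/
abbrev Rl (m : ℕ) := ∀ M : Mod, (Fin m → M) → Prop
/-- uniform functions -/
abbrev Fn (m : ℕ) := ∀ M : Mod, (Fin m → M) → M

class UT {m : ℕ} (f : Fn m) : Prop where
  ex : ∃ t : LA.Term (Empty ⊕ Fin m), ∀ M v, t.realize (Sum.elim default v) = f M v
class D0 {m : ℕ} (R : Rl m) : Prop where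
  ex : ∃ θ : LA.BoundedFormula Empty m, IsDelta0 θ ∧ ∀ M v, θ.Realize default v ↔ R M v

section
variable {m : ℕ}

instance ut_var (i : Fin m) : UT (fun _ v => v i) := ⟨vT i, fun _ _ => rfl⟩
instance ut_zero : UT (m := m) (fun _ _ => 0) := ⟨zeroT, fun _ _ => by simp⟩
instance ut_sc (f : Fn m) [hf : UT f] : UT (fun M v => sc (f M v)) := by
  obtain ⟨t, ht⟩ := hf.ex; exact ⟨succT t, fun _ v => by simp [ht]⟩
instance ut_one : UT (m := m) (fun _ _ => 1) := ut_sc (fun _ _ => 0)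
instance ut_add (f g : Fn m) [hf : UT f] [hg : UT g] : UT (fun M v => f M v + g M v) := by
  obtain ⟨t, ht⟩ := hf.ex; obtain ⟨u, hu⟩ := hg.ex; exact ⟨addT t u, fun _ v => by simp [ht, hu]⟩
instance ut_mul (f g : Fn m) [hf : UT f] [hg : UT g] : UT (fun M v => f M v * g M v) := by
  obtain ⟨t, ht⟩ := hf.ex; obtain ⟨u, hu⟩ := hg.ex; exact ⟨mulT t u, fun _ v => by simp [ht, hu]⟩
instance ut_nat (k : ℕ) : UT (m := m) (fun _ _ => (k : ℕ)) := by
  induction k with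
  | zero => simp only [Nat.cast_zero]; infer_instance
  | succ k ih => simp only [Nat.cast_succ]; infer_instance
instance ut_ofNat (k : ℕ) [k.AtLeastTwo] : UT (m := m) (fun _ _ => (OfNat.ofNat k)) := ut_nat k
instance ut_md (f g : Fn m) [hf : UT f] [hg : UT g] : UT (fun M v => md (f M v) (g M v)) := by
  unfold md; infer_instance
instance ut_pr (f g : Fn m) [hf : UT f] [hg : UT g] : UT (fun M v => pr (f M v) (g M v)) := by
  unfold pr; infer_instance

theorem ut_lift (f : Fn m) [hf : UT f] : UT (m := m + 1) (fun M w => f M (fun i => w i.castSucc)) := by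
  obtain ⟨t, ht⟩ := hf.ex
  exact ⟨t.relabel (Sum.map id Fin.castSucc), fun M w => by
      rw [Term.realize_relabel, ← ht]; congr 1; ext x; cases x <;> rfl⟩

/-- lifted term substitution -/
def liftS {k : ℕ} (s : Fin m → LA.Term (Empty ⊕ Fin k)) : Fin (m + 1) → LA.Term (Empty ⊕ Fin (k + 1)) :=
  Fin.snoc (fun i => (s i).relabel (Sum.map id Fin.castSucc)) (vT (Fin.last k))

/-- term substitution -/
def tsub {k : ℕ} (s : Fin m → LA.Term (Empty ⊕ Fin k)) (t : LA.Term (Empty ⊕ Fin m)) : LA.Term (Empty ⊕ Fin k) :=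
  t.subst (Sum.elim (fun e => Term.var (Sum.inl e)) s)

/-- formula substitution -/
def fsub : ∀ {m : ℕ}, LA.BoundedFormula Empty m → ∀ {k : ℕ}, (Fin m → LA.Term (Empty ⊕ Fin k)) →
    LA.BoundedFormula Empty k
  | _, .falsum, _, _ => .falsum
  | _, .equal t u, _, s => .equal (tsub s t) (tsub s u)
  | _, .rel R ts, _, s => .rel R (fun i => tsub s (ts i))
  | _, .imp φ ψ, _, s => .imp (fsub φ s) (fsub ψ s)
  | _, .all φ, _, s => .all (fsub φ (liftS s))

theorem realize_tsub {k : ℕ} {M : Mod} (s : Fin m → LA.Term (Empty ⊕ Fin k)) (t : LA.Term (Empty ⊕ Fin m))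
    (w : Fin k → M) : (tsub s t).realize (Sum.elim default w) =
      t.realize (Sum.elim default (fun i => (s i).realize (Sum.elim default w))) := by
  unfold tsub
  rw [Term.realize_subst]
  congr 1; ext x; rcases x with x | x
  · exact x.elim
  · rfl

theorem realize_liftS {k : ℕ} {M : Mod} (s : Fin m → LA.Term (Empty ⊕ Fin k)) (w : Fin k → M) (x : M) :
    (fun i => (liftS s i).realize (Sum.elim default (Fin.snoc w x : Fin (k+1) → M))) =
      (Fin.snoc (fun i => (s i).realize (Sum.elim default w)) x : Fin (m + 1) → M) := by
  funext i
  refine Fin.lastCases ?_ (fun i => ?_) i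
  · simp [liftS]
  · simp only [liftS, Fin.snoc_castSucc, Term.realize_relabel]
    congr 1; ext x; rcases x with x | x
    · exact x.elim
    · simp

theorem realize_fsub {M : Mod} : ∀ {m : ℕ} (φ : LA.BoundedFormula Empty m) {k : ℕ}
    (s : Fin m → LA.Term (Empty ⊕ Fin k)) (w : Fin k → M), (fsub φ s).Realize default w ↔
      φ.Realize default (fun i => (s i).realize (Sum.elim default w))
  | _, .falsum, _, _, _ => Iff.rfl
  | _, .equal t u, _, s, w => by
    simp only [fsub, BoundedFormula.Realize, realize_tsub]
  | _, .rel R ts, _, s, w => by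
    simp only [fsub, BoundedFormula.Realize, realize_tsub]
  | _, .imp φ ψ, _, s, w => by
    simp only [fsub, BoundedFormula.Realize, realize_fsub φ, realize_fsub ψ]
  | _, .all φ, _, s, w => by
    simp only [fsub, BoundedFormula.Realize, realize_fsub φ, realize_liftS]

theorem tsub_lift {k : ℕ} (s : Fin m → LA.Term (Empty ⊕ Fin k)) (t : LA.Term (Empty ⊕ Fin m)) :
    tsub (liftS s) (t.relabel (Sum.map id Fin.castSucc)) = (tsub s t).relabel (Sum.map id Fin.castSucc) := by
  unfold tsub
  induction t with
  | var x =>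
    rcases x with x | x
    · exact x.elim
    · simp [liftS, Term.subst, Term.relabel]
  | func f ts ih =>
    simp only [Term.subst, Term.relabel]
    congr 1; funext i; exact ih i

theorem tsub_last {k : ℕ} (s : Fin m → LA.Term (Empty ⊕ Fin k)) :
    tsub (liftS s) (vT (Fin.last m)) = vT (Fin.last k) := by
  simp [tsub, vT, liftS, Term.subst]

theorem fsub_leF {k : ℕ} (s : Fin m → LA.Term (Empty ⊕ Fin k)) (t u : LA.Term (Empty ⊕ Fin m)) :
    fsub (leF t u) s = leF (tsub s t) (tsub s u) := by
  simp only [leF, Relations.boundedFormula₂, Relations.boundedFormula, fsub]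
  congr 1; funext i
  refine Fin.cases rfl (fun i => ?_) i
  refine Fin.cases rfl (fun i => i.elim0) i

theorem delta0_sub : ∀ {m : ℕ} {φ : LA.BoundedFormula Empty m}, IsDelta0 φ → ∀ {k : ℕ}
    (s : Fin m → LA.Term (Empty ⊕ Fin k)), IsDelta0 (fsub φ s) := by
  intro m φ h
  induction h with
  | falsum => intro k s; exact .falsum
  | equal t u => intro k s; exact .equal _ _
  | le t u => intro k s; rw [fsub_leF]; exact .le _ _
  | imp _ _ ih1 ih2 => intro k s; exact .imp (ih1 s) (ih2 s)
  | ball t _ ih =>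
    intro k s
    have := IsDelta0.ball (tsub s t) (ih (liftS s))
    rw [← tsub_lift, ← tsub_last, ← fsub_leF] at this
    exact this
  | bex t _ ih =>
    intro k s
    have := IsDelta0.bex (tsub s t) (ih (liftS s))
    rw [← tsub_lift, ← tsub_last, ← fsub_leF] at this
    exact this

theorem D0.sub {k : ℕ} {R : Rl m} (hR : D0 R) (f : Fin m → Fn k) (hf : ∀ i, UT (f i)) :
    D0 (fun M v => R M (fun i => f i M v)) := by
  obtain ⟨θ, h1, h2⟩ := hR.ex
  choose s hs using fun i => (hf i).ex
  refine ⟨fsub θ s, delta0_sub h1 s, fun M v => ?_⟩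
  rw [realize_fsub, h2]
  simp only [hs]

theorem D0.congr {R R' : Rl m} (h : D0 R) (h2 : ∀ M v, R' M v ↔ R M v) : D0 R' := by
  have : R' = R := by funext M v; exact propext (h2 M v)
  rwa [this]

instance d0_imp (P Q : Rl m) [hf : D0 P] [hg : D0 Q] : D0 (fun M v => P M v → Q M v) := by
  obtain ⟨t, h1, ht⟩ := hf.ex; obtain ⟨u, h2, hu⟩ := hg.ex
  exact ⟨t ⟹ u, .imp h1 h2, fun M v => by simp [ht, hu]⟩
instance d0_const (p : Prop) : D0 (m := m) (fun _ _ => p) := by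
  by_cases h : p
  · exact ⟨.imp ⊥ ⊥, .imp .falsum .falsum, fun M v => by simp [h]⟩
  · exact ⟨⊥, .falsum, fun M v => by simp [h]⟩
instance d0_eq (f g : Fn m) [hf : UT f] [hg : UT g] : D0 (fun M v => f M v = g M v) := by
  obtain ⟨t, ht⟩ := hf.ex; obtain ⟨u, hu⟩ := hg.ex
  exact ⟨t =' u, .equal _ _, fun M v => by simp [ht, hu]⟩
instance d0_le (f g : Fn m) [hf : UT f] [hg : UT g] : D0 (fun M v => f M v ≤ g M v) := by
  obtain ⟨t, ht⟩ := hf.ex; obtain ⟨u, hu⟩ := hg.ex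
  exact ⟨leF t u, .le _ _, fun M v => by simp [ht, hu]⟩
instance d0_lt (f g : Fn m) [hf : UT f] [hg : UT g] : D0 (fun M v => f M v < g M v) := by
  simp only [m_lt_iff]; infer_instance
instance d0_not (P : Rl m) [hf : D0 P] : D0 (fun M v => ¬ P M v) :=
  d0_imp P (fun _ _ => False)
instance d0_and (P Q : Rl m) [hf : D0 P] [hg : D0 Q] : D0 (fun M v => P M v ∧ Q M v) :=
  (d0_not (fun M v => P M v → ¬ Q M v)).congr (fun M v => by simp)
instance d0_or (P Q : Rl m) [hf : D0 P] [hg : D0 Q] : D0 (fun M v => P M v ∨ Q M v) :=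
  (d0_imp (fun M v => ¬ P M v) Q).congr (fun M v => by tauto)
instance d0_iff (P Q : Rl m) [hf : D0 P] [hg : D0 Q] : D0 (fun M v => P M v ↔ Q M v) :=
  (d0_and (fun M v => P M v → Q M v) (fun M v => Q M v → P M v)).congr (fun M v => by tauto)
instance d0_ball (t : Fn m) (Q : ∀ M : Mod, (Fin m → M) → M → Prop) [ht : UT t]
    [hf : D0 (m := m + 1) (fun M w => Q M (fun i => w i.castSucc) (w (Fin.last m)))] :
    D0 (fun M v => ∀ x, x ≤ t M v → Q M v x) := by
  obtain ⟨θ, h1, h2⟩ := hf.ex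
  obtain ⟨u, hu⟩ := ht.ex
  refine ⟨_, .ball u h1, fun M v => ?_⟩
  simp only [BoundedFormula.realize_all, BoundedFormula.realize_imp, rz_le, Term.realize_relabel, rz_v, h2,
    Fin.snoc_last, Fin.snoc_castSucc]
  have : ∀ x : M, (Sum.elim (default : Empty → M) (Fin.snoc v x : Fin (m+1) → M)) ∘ Sum.map id Fin.castSucc = Sum.elim default v := by
    intro x; ext y; rcases y with y | y
    · exact y.elim
    · simp
  simp only [this, hu]
instance d0_bex (t : Fn m) (Q : ∀ M : Mod, (Fin m → M) → M → Prop) [ht : UT t]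
    [hf : D0 (m := m + 1) (fun M w => Q M (fun i => w i.castSucc) (w (Fin.last m)))] :
    D0 (fun M v => ∃ x, x ≤ t M v ∧ Q M v x) :=
  (d0_not (fun M v => ∀ x, x ≤ t M v → ¬ Q M v x)).congr (fun M v => by simp)
instance d0_ball' (t : Fn m) (Q : ∀ M : Mod, (Fin m → M) → M → Prop) [ht : UT t]
    [hf : D0 (m := m + 1) (fun M w => Q M (fun i => w i.castSucc) (w (Fin.last m)))] :
    D0 (fun M v => ∀ x, x < t M v → Q M v x) := by
  have := ut_lift t
  exact (d0_ball t (fun M v x => x < t M v → Q M v x)).congr (fun M v =>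
    ⟨fun h x _ => h x, fun h x hx => h x hx.le hx⟩)
instance d0_bex' (t : Fn m) (Q : ∀ M : Mod, (Fin m → M) → M → Prop) [ht : UT t]
    [hf : D0 (m := m + 1) (fun M w => Q M (fun i => w i.castSucc) (w (Fin.last m)))] :
    D0 (fun M v => ∃ x, x < t M v ∧ Q M v x) :=
  (d0_not (fun M v => ∀ x, x < t M v → ¬ Q M v x)).congr (fun M v => by simp)

theorem m_dvd_iff {M : Mod} (a b : M) : a ∣ b ↔ ∃ x, x ≤ b ∧ b = a * x := by
  constructor
  · rintro ⟨x, rfl⟩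
    rcases mcases a with rfl | ⟨y, rfl⟩
    · exact ⟨0, by simp⟩
    · refine ⟨x, ?_, rfl⟩
      rw [add_mul, one_mul]; exact le_add_self
  · rintro ⟨x, -, h⟩; exact ⟨x, h⟩
instance d0_dvd (f g : Fn m) [hf : UT f] [hg : UT g] : D0 (fun M v => f M v ∣ g M v) := by
  have := ut_lift f; have := ut_lift g
  simp only [m_dvd_iff]; infer_instance
instance d0_mem (f g h i : Fn m) [hf : UT f] [hg : UT g] [hh : UT h] [hi : UT i] :
    D0 (fun M v => Mem (f M v) (g M v) (h M v) (i M v)) := by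
  unfold Mem; infer_instance
instance df_mem {M : Mod} (f g h i : (Fin m → M) → M) [hf : Tm f] [hg : Tm g] [hh : Tm h] [hi : Tm i] :
    Df (fun v => Mem (f v) (g v) (h v) (i v)) := by
  unfold Mem; infer_instance

example : D0 (m := 2) (fun _ v => ∀ x, x ≤ v 0 → (∃ y, y < x * v 1 ∧ y ∣ x + 3) → x = v 0) :=
  inferInstance
end


/-- `Σ_n` relations -/
def SgD : ℕ → ∀ {m : ℕ}, Rl m → Prop
  | 0, _, R => D0 R
  | n + 1, m, R => ∃ R' : Rl (m + 1), SgD n R' ∧ ∀ M v, R M v ↔ ∃ x, ¬ R' M (Fin.snoc v x)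

class Sg (n : ℕ) {m : ℕ} (R : Rl m) : Prop where
  ex : SgD n R

theorem snoc_cs {m : ℕ} {M : Mod} (v : Fin m → M) (x : M) :
    (fun i => (Fin.snoc v x : Fin (m+1) → M) (Fin.castSucc i)) = v := by
  funext i; simp

theorem snoc_split {m : ℕ} {M : Mod} (w : Fin (m + 1) → M) :
    (Fin.snoc (fun i => w (Fin.castSucc i)) (w (Fin.last m)) : Fin (m+1) → M) = w := by
  funext i
  refine Fin.lastCases ?_ (fun i => ?_) i <;> simp

section
variable {m n : ℕ}

theorem SgD.congr {R R' : Rl m} (h : SgD n R) (h2 : ∀ M v, R' M v ↔ R M v) : SgD n R' := by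
  have : R' = R := by funext M v; exact propext (h2 M v)
  rwa [this]
theorem Sg.congr {R R' : Rl m} (h : Sg n R) (h2 : ∀ M v, R' M v ↔ R M v) : Sg n R' := ⟨h.ex.congr h2⟩

theorem ut_snoc {k : ℕ} (f : Fin m → Fn k) (hf : ∀ i, UT (f i)) (i : Fin (m + 1)) :
    UT (fun M (w : Fin (k+1) → M) => (Fin.snoc (fun i => f i M (fun j => w j.castSucc)) (w (Fin.last k)) : Fin (m+1) → M) i) := by
  refine Fin.lastCases ?_ (fun i => ?_) i
  · simp only [Fin.snoc_last]; infer_instance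
  · simp only [Fin.snoc_castSucc]; have := hf i; exact ut_lift (f i)

theorem SgD.sub : ∀ {n m k : ℕ} {R : Rl m} (_ : SgD n R) (f : Fin m → Fn k) (_ : ∀ i, UT (f i)),
    SgD n (fun M v => R M (fun i => f i M v))
  | 0, _, _, _, hR, f, hf => D0.sub hR f hf
  | n + 1, m, k, R, ⟨R', h1, h2⟩, f, hf => by
    refine ⟨_, SgD.sub h1 (fun i M w => (Fin.snoc (fun i => f i M (fun j => w j.castSucc)) (w (Fin.last k)) : Fin (m+1) → M) i)
      (ut_snoc f hf), fun M v => ?_⟩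
    simp only [h2, Fin.snoc_castSucc, Fin.snoc_last]

theorem Sg.sub {k : ℕ} {R : Rl m} (hR : Sg n R) (f : Fin m → Fn k) (hf : ∀ i, UT (f i)) :
    Sg n (fun M v => R M (fun i => f i M v)) := ⟨hR.ex.sub f hf⟩

theorem SgD.lift {R : Rl m} (h : SgD n R) : SgD n (m := m + 1) (fun M w => R M (fun i => w i.castSucc)) :=
  h.sub (fun i _ w => w i.castSucc) (fun _ => inferInstance)

theorem SgD.succ_not {R : Rl m} (h : SgD n R) : SgD (n + 1) (fun M v => ¬ R M v) :=
  ⟨_, h.lift, fun M v => by simp⟩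

theorem SgD.not0 {R : Rl m} (h : SgD 0 R) : SgD 0 (fun M v => ¬ R M v) := by
  have : D0 R := h
  exact d0_not R

theorem SgD.succ : ∀ {n m : ℕ} {R : Rl m} (_ : SgD n R), SgD (n + 1) R
  | 0, m, R, h => h.not0.succ_not.congr (fun M v => by simp)
  | n + 1, m, R, ⟨R', h1, h2⟩ => ⟨R', SgD.succ h1, h2⟩

theorem SgD.df : ∀ {n m : ℕ} {R : Rl m} (_ : SgD n R) (M : Mod), Df (R M)
  | 0, m, R, h, M => by
    have : D0 R := h
    obtain ⟨θ, -, h2⟩ := this.ex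
    refine ⟨θ.relabel (n := 0) (Empty.elim) |>.castLE (by omega), fun v => ?_⟩
    rw [BoundedFormula.realize_castLE_of_eq (by omega), BoundedFormula.realize_relabel, ← h2]
    have : (Sum.elim id ((v ∘ Fin.cast (by omega : 0 + m = m)) ∘ Fin.castAdd m) ∘ (Empty.elim : Empty → M ⊕ Fin 0)) = default := Subsingleton.elim _ _
    rw [this]
    have : (v ∘ Fin.cast (by omega : 0 + m = m)) ∘ Fin.natAdd 0 = v := by
      funext i; simp
    rw [this]
  | n + 1, m, R, ⟨R', h1, h2⟩, M => by
    obtain ⟨θ, hθ⟩ := (SgD.df h1 M).ex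
    exact ⟨∃' ∼θ, fun v => by simp [hθ, h2]⟩

/-- the closure properties proved by simultaneous induction -/
structure Clo (n : ℕ) : Prop where
  and : ∀ {m : ℕ} {P Q : Rl m}, SgD n P → SgD n Q → SgD n (fun M v => P M v ∧ Q M v)
  or : ∀ {m : ℕ} {P Q : Rl m}, SgD n P → SgD n Q → SgD n (fun M v => P M v ∨ Q M v)
  ball : ∀ {m : ℕ} (t : Fn m) (_ : UT t) {Q : Rl (m + 1)}, SgD n Q →
    SgD n (fun M v => ∀ x, x ≤ t M v → Q M (Fin.snoc v x))
  bex : ∀ {m : ℕ} (t : Fn m) (_ : UT t) {Q : Rl (m + 1)}, SgD n Q →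
    SgD n (fun M v => ∃ x, x ≤ t M v ∧ Q M (Fin.snoc v x))

theorem clo_ex (h : Clo n) {Q : Rl (m + 1)} (hQ : SgD (n + 1) Q) :
    SgD (n + 1) (fun M v => ∃ x, Q M (Fin.snoc v x)) := by
  obtain ⟨R, h1, h2⟩ := hQ
  -- context: v, W, x, y
  have k1 : SgD n (m := m + 1 + 1 + 1) (fun M w => R M (Fin.snoc (Fin.snoc (fun i => w i.castSucc.castSucc.castSucc) (w (Fin.last (m+1)).castSucc)) (w (Fin.last (m+2))))) := by
    refine (h1.sub (k := m + 1 + 1 + 1) (fun i M w => (Fin.snoc (Fin.snoc (fun i => w i.castSucc.castSucc.castSucc) (w (Fin.last (m+1)).castSucc) : Fin (m+1) → M) (w (Fin.last (m+2))) : Fin (m+2) → M) i) ?_)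
    intro i
    refine Fin.lastCases ?_ (fun i => ?_) i
    · simp only [Fin.snoc_last]; infer_instance
    · simp only [Fin.snoc_castSucc]
      refine Fin.lastCases ?_ (fun i => ?_) i
      · simp only [Fin.snoc_last]; infer_instance
      · simp only [Fin.snoc_castSucc]; infer_instance
  have k2 := h.ball (fun _ w => w (Fin.last m).castSucc) inferInstance k1
  have k3 := h.ball (fun _ w => w (Fin.last m)) inferInstance k2
  refine ⟨_, k3, fun M v => ?_⟩
  simp only [h2, Fin.snoc_castSucc, Fin.snoc_last]
  push Not
  constructor
  · rintro ⟨x, y, h⟩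
    exact ⟨max x y, x, le_max_left _ _, y, le_max_right _ _, h⟩
  · rintro ⟨_, x, _, y, _, h⟩
    exact ⟨x, y, h⟩

theorem clo : ∀ n, Clo n
  | 0 => by
    refine ⟨?_, ?_, ?_, ?_⟩
    · intro m P Q h1 h2
      have h1 : D0 P := h1
      have h2 : D0 Q := h2
      exact d0_and P Q
    · intro m P Q h1 h2
      have h1 : D0 P := h1
      have h2 : D0 Q := h2
      exact d0_or P Q
    · intro m t ht Q h1
      have h1 : D0 Q := h1
      have : D0 (m := m + 1) (fun M w => Q M (Fin.snoc (fun i => w i.castSucc) (w (Fin.last m)))) := by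
        simpa only [snoc_split] using h1
      exact d0_ball t (fun M v x => Q M (Fin.snoc v x))
    · intro m t ht Q h1
      have h1 : D0 Q := h1
      have : D0 (m := m + 1) (fun M w => Q M (Fin.snoc (fun i => w i.castSucc) (w (Fin.last m)))) := by
        simpa only [snoc_split] using h1
      exact d0_bex t (fun M v x => Q M (Fin.snoc v x))
  | n + 1 => by
    have ih := clo n
    have swp : ∀ {m : ℕ} {R : Rl (m + 2)}, SgD n R → SgD n (m := m + 2)
        (fun M w => R M (Fin.snoc (Fin.snoc (fun i => w i.castSucc.castSucc) (w (Fin.last (m + 1)))) (w (Fin.last m).castSucc))) := by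
      intro m R h1
      refine h1.sub (k := m + 1 + 1) (fun i M w => (Fin.snoc (Fin.snoc (fun i => w i.castSucc.castSucc) (w (Fin.last (m+1))) : Fin (m+1) → M) (w (Fin.last m).castSucc) : Fin (m+2) → M) i) ?_
      intro i
      refine Fin.lastCases ?_ (fun i => ?_) i
      · simp only [Fin.snoc_last]; infer_instance
      · simp only [Fin.snoc_castSucc]
        refine Fin.lastCases ?_ (fun i => ?_) i
        · simp only [Fin.snoc_last]; infer_instance
        · simp only [Fin.snoc_castSucc]; infer_instance
    refine ⟨?_, ?_, ?_, ?_⟩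
    · rintro m P Q ⟨P', hP1, hP2⟩ ⟨Q', hQ1, hQ2⟩
      have k1 : SgD n (m := m + 2) (fun M w => P' M (Fin.snoc (fun i => w i.castSucc.castSucc) (w (Fin.last m).castSucc))) := by
        have := hP1.lift
        refine this.congr fun M v => ?_
        rw [← snoc_split (fun i => v i.castSucc)]
      have k2 := swp hQ1.lift
      have k3 := (ih.or k1 k2).succ_not
      refine (clo_ex ih (clo_ex ih k3)).congr fun M v => ?_
      rw [hP2, hQ2]
      simp
    · rintro m P Q ⟨P', hP1, hP2⟩ ⟨Q', hQ1, hQ2⟩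
      refine ⟨_, ih.and hP1 hQ1, fun M v => ?_⟩
      simp only [hP2, hQ2, ← exists_or]
      refine exists_congr fun x => ?_
      tauto
    · rintro m t ht Q ⟨Q', hQ1, hQ2⟩
      -- context v, N, x, y
      have k1 : SgD n (m := m + 1 + 1 + 1) (fun M w => Q' M (Fin.snoc (Fin.snoc (fun i => w i.castSucc.castSucc.castSucc) (w (Fin.last (m+1)).castSucc)) (w (Fin.last (m+2))))) := by
        refine (hQ1.sub (k := m + 1 + 1 + 1) (fun i M w => (Fin.snoc (Fin.snoc (fun i => w i.castSucc.castSucc.castSucc) (w (Fin.last (m+1)).castSucc) : Fin (m+1) → M) (w (Fin.last (m+2))) : Fin (m+2) → M) i) ?_)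
        intro i
        refine Fin.lastCases ?_ (fun i => ?_) i
        · simp only [Fin.snoc_last]; infer_instance
        · simp only [Fin.snoc_castSucc]
          refine Fin.lastCases ?_ (fun i => ?_) i
          · simp only [Fin.snoc_last]; infer_instance
          · simp only [Fin.snoc_castSucc]; infer_instance
      have k2 := ih.ball (fun _ w => w (Fin.last m).castSucc) inferInstance k1
      have k3 := ih.bex (fun M w => t M (fun i => w i.castSucc)) (ut_lift t) k2
      refine ⟨_, k3, fun M v => ?_⟩
      simp only [hQ2, Fin.snoc_castSucc, Fin.snoc_last]
      push Not
      constructor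
      · intro h
        have hd : Df (M := M) (m := 2) (fun w => ¬ Q' M (Fin.snoc (Fin.snoc v (w 0)) (w 1))) := by
          obtain ⟨ψ, hψ⟩ := (hQ1.df M).ex
          let s : M ⊕ Fin m → M := Sum.elim id v
          have : Df (M := M) (m := 2) (fun w => Q' M (Fin.snoc (Fin.snoc v (w 0)) (w 1))) := by
            refine ⟨(BoundedFormula.relabel (n := 2) (k := 0) (Sum.elim (fun c => Sum.inl c)
              (fun i => (Fin.snoc (Fin.snoc (fun i => Sum.inl (v i)) (Sum.inr 0) : Fin (m+1) → M ⊕ Fin 2) (Sum.inr 1) : Fin (m+2) → M ⊕ Fin 2) i)) ψ.toFormula), fun w => ?_⟩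
            rw [BoundedFormula.realize_relabel]
            have hs : (w ∘ Fin.natAdd 2 : Fin 0 → M) = default := Subsingleton.elim _ _
            have := BoundedFormula.realize_toFormula ψ (Sum.elim id (w ∘ Fin.castAdd 0) ∘ (Sum.elim (fun c => Sum.inl c)
              (fun i => (Fin.snoc (Fin.snoc (fun i => Sum.inl (v i)) (Sum.inr 0) : Fin (m+1) → M ⊕ Fin 2) (Sum.inr 1) : Fin (m+2) → M ⊕ Fin 2) i)))
            unfold Formula.Realize at this
            rw [hs, this]
            have e1 : ((Sum.elim id (w ∘ Fin.castAdd 0) ∘ (Sum.elim (fun c => Sum.inl c)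
              (fun i => (Fin.snoc (Fin.snoc (fun i => Sum.inl (v i)) (Sum.inr 0) : Fin (m+1) → M ⊕ Fin 2) (Sum.inr 1) : Fin (m+2) → M ⊕ Fin 2) i))) ∘ Sum.inl) = (id : M → M) := rfl
            rw [e1, hψ]
            refine iff_of_eq (congrArg _ ?_)
            funext i
            refine Fin.lastCases ?_ (fun i => ?_) i
            · simp
            · refine Fin.lastCases ?_ (fun i => ?_) i
              · simp
              · simp
          infer_instance
        obtain ⟨N, hN⟩ := coll _ hd (t M v + 1) (fun x hx => h x (m_lt_add_one.1 hx))
        exact ⟨N, fun x hx => hN x (m_lt_add_one.2 hx)⟩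
      · rintro ⟨N, h⟩ x hx
        obtain ⟨y, _, h2⟩ := h x hx
        exact ⟨y, h2⟩
    · rintro m t ht Q ⟨Q', hQ1, hQ2⟩
      have k2 := ih.ball (fun M w => t M (fun i => w i.castSucc)) (ut_lift t) (swp hQ1)
      refine ⟨_, k2, fun M v => ?_⟩
      simp only [hQ2, Fin.snoc_castSucc, Fin.snoc_last]
      push Not
      constructor
      · rintro ⟨x, hx, y, h⟩; exact ⟨y, x, hx, h⟩
      · rintro ⟨y, x, hx, h⟩; exact ⟨x, hx, y, h⟩

instance (priority := low) sg_d0 (R : Rl m) [h : D0 R] : Sg n R := by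
  constructor
  induction n with
  | zero => exact h
  | succ n ih => exact ih.succ
instance sg_and (P Q : Rl m) [hf : Sg n P] [hg : Sg n Q] : Sg n (fun M v => P M v ∧ Q M v) :=
  ⟨(clo n).and hf.ex hg.ex⟩
instance sg_or (P Q : Rl m) [hf : Sg n P] [hg : Sg n Q] : Sg n (fun M v => P M v ∨ Q M v) :=
  ⟨(clo n).or hf.ex hg.ex⟩
instance sg_ex (Q : ∀ M : Mod, (Fin m → M) → M → Prop)
    [hf : Sg (n + 1) (m := m + 1) (fun M w => Q M (fun i => w i.castSucc) (w (Fin.last m)))] :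
    Sg (n + 1) (fun M v => ∃ x, Q M v x) :=
  ⟨(clo_ex (clo n) hf.ex).congr fun M v => by simp⟩
instance sg_ball (t : Fn m) (Q : ∀ M : Mod, (Fin m → M) → M → Prop) [ht : UT t]
    [hf : Sg n (m := m + 1) (fun M w => Q M (fun i => w i.castSucc) (w (Fin.last m)))] :
    Sg n (fun M v => ∀ x, x ≤ t M v → Q M v x) :=
  ⟨((clo n).ball t ht hf.ex).congr fun M v => by simp⟩
instance sg_bex (t : Fn m) (Q : ∀ M : Mod, (Fin m → M) → M → Prop) [ht : UT t]
    [hf : Sg n (m := m + 1) (fun M w => Q M (fun i => w i.castSucc) (w (Fin.last m)))] :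
    Sg n (fun M v => ∃ x, x ≤ t M v ∧ Q M v x) :=
  ⟨((clo n).bex t ht hf.ex).congr fun M v => by simp⟩
instance sg_ball' (t : Fn m) (Q : ∀ M : Mod, (Fin m → M) → M → Prop) [ht : UT t]
    [hf : Sg n (m := m + 1) (fun M w => Q M (fun i => w i.castSucc) (w (Fin.last m)))] :
    Sg n (fun M v => ∀ x, x < t M v → Q M v x) := by
  have := ut_lift t
  refine (sg_ball t (fun M v x => t M v ≤ x ∨ Q M v x)).congr fun M v => ?_
  constructor
  · intro h x _; exact (le_or_gt (t M v) x).imp id (h x)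
  · intro h x hx; exact (h x hx.le).resolve_left (not_le.2 hx)
end


/-- the relation defined by a formula -/
def rlz {m : ℕ} (φ : LA.BoundedFormula Empty m) : Rl m := fun _ v => φ.Realize default v

theorem sgd_mono {n m : ℕ} {R : Rl m} (h : SgD n R) : SgD (n + 1) R := h.succ

mutual
theorem sg_fml : ∀ {n m : ℕ} {φ : LA.BoundedFormula Empty m}, IsSigmaFml n φ → SgD n (rlz φ)
  | _, _, _, .ofDelta0 h => (⟨_, h, fun _ _ => Iff.rfl⟩ : D0 _)
  | _, _, _, .ofPi h => ((pi_fml h).succ_not).congr fun M v => by simp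
  | _, _, _, .ex h => (clo_ex (clo _) (sg_fml h)).congr fun M v => by simp [rlz]
theorem pi_fml : ∀ {n m : ℕ} {φ : LA.BoundedFormula Empty m}, IsPiFml n φ → SgD n (fun M v => ¬ rlz φ M v)
  | _, _, _, .ofDelta0 h => SgD.not0 (⟨_, h, fun _ _ => Iff.rfl⟩ : D0 _)
  | _, _, _, .ofSigma h => (sg_fml h).succ_not
  | _, _, _, .all h => (clo_ex (clo _) (pi_fml h)).congr fun M v => by simp [rlz]
end

theorem fml_sg : ∀ {n m : ℕ} {R : Rl m}, SgD n R →
    (∃ φ : LA.BoundedFormula Empty m, IsSigmaFml n φ ∧ ∀ M v, φ.Realize default v ↔ R M v) ∧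
    (∃ φ : LA.BoundedFormula Empty m, IsPiFml n φ ∧ ∀ M v, φ.Realize default v ↔ ¬ R M v)
  | 0, m, R, h => by
    have h' := h.not0
    obtain ⟨θ, h1, h2⟩ := (h : D0 R).ex
    obtain ⟨θ', h1', h2'⟩ := (h' : D0 _).ex
    exact ⟨⟨θ, .ofDelta0 h1, h2⟩, ⟨θ', .ofDelta0 h1', h2'⟩⟩
  | n + 1, m, R, ⟨R', h1, h2⟩ => by
    obtain ⟨⟨φ, p1, p2⟩, ⟨ψ, q1, q2⟩⟩ := fml_sg h1
    refine ⟨⟨∃' ψ, .ex (.ofPi q1), fun M v => ?_⟩, ⟨∀' φ, .all (.ofSigma p1), fun M v => ?_⟩⟩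
    · simp [q2, h2]
    · simp [p2, h2]

theorem sg_fml0 {n : ℕ} {φ : Snt} (h : φ ∈ SigmaS n) : Sg n (m := 0) (rlz φ) := ⟨sg_fml h⟩
theorem pi_fml0 {n : ℕ} {φ : Snt} (h : φ ∈ PiS n) : Sg n (m := 0) (fun M v => ¬ rlz φ M v) := ⟨pi_fml h⟩

theorem rlz0 (φ : Snt) (M : Mod) (v : Fin 0 → M) : rlz φ M v ↔ (M : Type) ⊨ φ := by
  have : v = default := Subsingleton.elim _ _
  rw [this]; rfl

/-- Sentence from a Σ_n relation with standard arguments -/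
theorem snt_sg {n k : ℕ} {R : Rl k} (h : Sg n R) (a : Fin k → ℕ) :
    ∃ σ ∈ SigmaS n, ∀ M : Mod, (M : Type) ⊨ σ ↔ R M (fun i => (a i : M)) := by
  obtain ⟨⟨φ, h1, h2⟩, -⟩ := fml_sg (h.sub (k := 0) (fun i _ _ => (a i : ℕ)) (fun _ => inferInstance)).ex
  exact ⟨φ, h1, fun M => by rw [← rlz0 φ M default]; exact h2 M default⟩
theorem snt_pi {n k : ℕ} {R : Rl k} (h : Sg n R) (a : Fin k → ℕ) :
    ∃ σ ∈ PiS n, ∀ M : Mod, (M : Type) ⊨ σ ↔ ¬ R M (fun i => (a i : M)) := by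
  obtain ⟨-, ⟨φ, h1, h2⟩⟩ := fml_sg (h.sub (k := 0) (fun i _ _ => (a i : ℕ)) (fun _ => inferInstance)).ex
  exact ⟨φ, h1, fun M => by rw [← rlz0 φ M default]; exact h2 M default⟩

/-- provability is truth in all PA models -/
theorem prv_iff {T : Thy} (hT : ExtPA T) (φ : Snt) :
    Prv T φ ↔ ∀ M : Mod, (∀ ψ ∈ T, (M : Type) ⊨ ψ) → (M : Type) ⊨ φ := by
  constructor
  · intro h M hM
    have : (M : Type) ⊨ T := ⟨hM⟩
    have : Nonempty (M : Type) := ⟨0⟩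
    have h := h (Theory.ModelType.of T (M : Type)) default default
    exact h
  · intro h M v xs
    let N : Mod := ⟨M, inferInstance, ⟨fun ψ hψ => by
      have := hT ψ hψ M default default
      exact this⟩⟩
    have h1 := h N (fun ψ hψ => M.is_model.realize_of_mem ψ hψ)
    have hv : v = default := Subsingleton.elim _ _
    have hx : xs = default := Subsingleton.elim _ _
    rw [hv, hx]; exact h1

instance strN : LA.Structure ℕ where
  funMap := fun {n} f xs => match n, f, xs with
    | 0, _, _ => 0
    | 1, _, xs => xs 0 + 1
    | 2, false, xs => xs 0 + xs 1
    | 2, true, xs => xs 0 * xs 1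
    | (_ + 3), f, _ => Empty.elim f
  RelMap := fun {n} r xs => match n, r, xs with
    | 0, r, _ => Empty.elim r
    | 1, r, _ => Empty.elim r
    | 2, _, xs => xs 0 ≤ xs 1
    | (_ + 3), r, _ => Empty.elim r

section
variable {α : Type} {m : ℕ}
theorem nz_zero (v : α ⊕ Fin m → ℕ) : (zeroT : LA.Term (α ⊕ Fin m)).realize v = 0 := rfl
theorem nz_succ (v : α ⊕ Fin m → ℕ) (t : LA.Term (α ⊕ Fin m)) :
    (succT t).realize v = t.realize v + 1 := rfl
theorem nz_add (v : α ⊕ Fin m → ℕ) (t u : LA.Term (α ⊕ Fin m)) :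
    (addT t u).realize v = t.realize v + u.realize v := rfl
theorem nz_mul (v : α ⊕ Fin m → ℕ) (t u : LA.Term (α ⊕ Fin m)) :
    (mulT t u).realize v = t.realize v * u.realize v := rfl
theorem nz_v (v : Empty → ℕ) (w : Fin m → ℕ) (i : Fin m) :
    (vT i).realize (Sum.elim v w) = w i := rfl
theorem nz_le (v : α → ℕ) (w : Fin m → ℕ) (t u : LA.Term (α ⊕ Fin m)) :
    (leF t u).Realize v w ↔ t.realize (Sum.elim v w) ≤ u.realize (Sum.elim v w) := by
  exact BoundedFormula.realize_rel₂
end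

theorem nat_pa : (ℕ : Type) ⊨ PAAx := by
  refine ⟨fun φ hφ => ?_⟩
  rcases hφ with hφ | ⟨k, ψ, rfl⟩
  · simp only [Set.mem_insert_iff, Set.mem_singleton_iff] at hφ
    rcases hφ with rfl | rfl | rfl | rfl | rfl | rfl | rfl <;>
    simp only [Sentence.Realize, Formula.Realize, BoundedFormula.realize_all, BoundedFormula.realize_not,
      BoundedFormula.realize_bdEqual, BoundedFormula.realize_imp, BoundedFormula.realize_iff,
      BoundedFormula.realize_ex, nz_zero, nz_succ, nz_add, nz_mul, nz_v, nz_le] <;>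
    simp [Fin.snoc]
    · intro a b; exact (Nat.add_assoc a b 1).symm
    · intro a b; exact Nat.mul_succ a b
    · intro a b
      constructor
      · intro h; exact ⟨b - a, by omega⟩
      · rintro ⟨c, hc⟩; omega
  · show Formula.Realize _ _
    unfold indAxiom
    rw [BoundedFormula.realize_alls]
    intro xs
    simp only [BoundedFormula.realize_imp, BoundedFormula.realize_inf, BoundedFormula.realize_all]
    rintro ⟨h0, hs⟩ x
    induction x with
    | zero =>
      exact h0 0 (by simp [nz_v, nz_zero])
    | succ x ih =>
      have := hs x ih (x + 1) (by simp [nz_v, nz_succ])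
      rw [BoundedFormula.realize_liftAt_one (by omega)] at this
      convert this using 1
      funext i
      refine Fin.lastCases ?_ (fun i => ?_) i
      · simp
      · simp [Fin.snoc]

theorem exists_nn : ∃ N : Mod, ∀ x : N, ∃ k : ℕ, x = (Nat.cast k : N) := by
  have key : ∀ N : Mod, N = ⟨ℕ, strN, nat_pa⟩ → ∀ x : N, ∃ k : ℕ, x = (Nat.cast k : N) := by
    intro N hN
    have h1 : ∀ P : N → Prop, P 0 → (∀ x, P x → P (sc x)) → ∀ x, P x := by
      subst hN
      intro P h0 hs x
      exact Nat.rec (motive := fun x => P x) h0 (fun x => hs x) x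
    exact h1 _ ⟨0, by simp⟩ (by rintro _ ⟨k, rfl⟩; exact ⟨k + 1, by rw [sc_eq]; simp⟩)
  exact ⟨_, key _ rfl⟩

/-- the standard model -/
noncomputable def NN : Mod := Classical.choose exists_nn

theorem nn_surj (x : NN) : ∃ k : ℕ, x = (Nat.cast k : NN) := Classical.choose_spec exists_nn x

theorem term_abs {m : ℕ} (M : Mod) (v : Fin m → ℕ) (t : LA.Term (Empty ⊕ Fin m)) :
    ∃ k : ℕ, t.realize (Sum.elim default (fun i => (v i : M))) = (k : M) ∧
      t.realize (Sum.elim default (fun i => (v i : NN))) = (k : NN) := by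
  induction t with
  | var x =>
    rcases x with x | x
    · exact x.elim
    · exact ⟨v x, rfl, rfl⟩
  | @func l f ts ih =>
    choose k h1 h2 using ih
    match l, f, ts, k, h1, h2 with
    | 0, f, ts, k, h1, h2 =>
      have e : (Term.func f ts : LA.Term (Empty ⊕ Fin m)) = zeroT := by
        show _ = Term.func _ _
        congr 1; exact Subsingleton.elim _ _
      rw [e]; exact ⟨0, by simp, by simp⟩
    | 1, f, ts, k, h1, h2 =>
      have e : (Term.func f ts : LA.Term (Empty ⊕ Fin m)) = succT (ts 0) := by
        show _ = Term.func _ _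
        congr 1; funext i; fin_cases i; rfl
      rw [e]; exact ⟨k 0 + 1, by rw [rz_succ, h1, sc_eq]; simp, by rw [rz_succ, h2, sc_eq]; simp⟩
    | 2, false, ts, k, h1, h2 =>
      have e : (Term.func (L := LA) (l := 2) false ts : LA.Term (Empty ⊕ Fin m)) = addT (ts 0) (ts 1) := by
        show _ = Term.func _ _
        congr 1; funext i; fin_cases i <;> rfl
      rw [e]; exact ⟨k 0 + k 1, by rw [rz_add, h1, h1]; simp, by rw [rz_add, h2, h2]; simp⟩
    | 2, true, ts, k, h1, h2 =>
      have e : (Term.func (L := LA) (l := 2) true ts : LA.Term (Empty ⊕ Fin m)) = mulT (ts 0) (ts 1) := by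
        show _ = Term.func _ _
        congr 1; funext i; fin_cases i <;> rfl
      rw [e]; exact ⟨k 0 * k 1, by rw [rz_mul, h1, h1]; simp, by rw [rz_mul, h2, h2]; simp⟩
    | (_ + 3), f, _, _, _, _ => exact Empty.elim f

theorem snoc_nat {m : ℕ} (M : Mod) (v : Fin m → ℕ) (j : ℕ) :
    (Fin.snoc (fun i => (v i : M)) (j : M) : Fin (m+1) → M) = fun i => (((Fin.snoc v j : Fin (m+1) → ℕ) i : ℕ) : M) := by
  funext i
  refine Fin.lastCases ?_ (fun i => ?_) i <;> simp

theorem bdd_abs {M : Mod} (t : ℕ) (P : M → Prop) : (∀ x : M, x ≤ (t : M) → P x) ↔ ∀ j : ℕ, j ≤ t → P (j : M) := by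
  constructor
  · intro h j hj; exact h _ (by exact_mod_cast hj)
  · intro h x hx
    obtain ⟨j, hj, rfl⟩ := le_nat hx
    exact h j hj

theorem delta0_abs {m : ℕ} {φ : LA.BoundedFormula Empty m} (h : IsDelta0 φ) (M : Mod) : ∀ (v : Fin m → ℕ),
    rlz φ M (fun i => (v i : M)) ↔ rlz φ NN (fun i => (v i : NN)) := by
  induction h with
  | falsum => intro v; exact Iff.rfl
  | equal t u =>
    intro v
    obtain ⟨k, h1, h2⟩ := term_abs M v t
    obtain ⟨l, h3, h4⟩ := term_abs M v u
    simp [rlz, h1, h2, h3, h4]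
  | le t u =>
    intro v
    obtain ⟨k, h1, h2⟩ := term_abs M v t
    obtain ⟨l, h3, h4⟩ := term_abs M v u
    simp [rlz, h1, h2, h3, h4]
  | imp _ _ ih1 ih2 =>
    intro v
    exact imp_congr (ih1 v) (ih2 v)
  | @ball m t φ _ ih =>
    intro v
    obtain ⟨k, h1, h2⟩ := term_abs M v t
    have e : ∀ (M : Mod) (w : Fin m → M) (x : M), (Sum.elim (default : Empty → M) (Fin.snoc w x : Fin (m+1) → M)) ∘ Sum.map id Fin.castSucc = Sum.elim default w := by
      intro M w x; ext y; rcases y with y | y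
      · exact y.elim
      · simp
    simp only [rlz, BoundedFormula.realize_all, BoundedFormula.realize_imp, rz_le, Term.realize_relabel, rz_v, Fin.snoc_last, e, h1, h2, bdd_abs]
    refine forall_congr' fun j => imp_congr_right fun _ => ?_
    rw [snoc_nat, snoc_nat]
    exact ih _
  | @bex m t φ _ ih =>
    intro v
    obtain ⟨k, h1, h2⟩ := term_abs M v t
    have e : ∀ (M : Mod) (w : Fin m → M) (x : M), (Sum.elim (default : Empty → M) (Fin.snoc w x : Fin (m+1) → M)) ∘ Sum.map id Fin.castSucc = Sum.elim default w := by
      intro M w x; ext y; rcases y with y | y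
      · exact y.elim
      · simp
    rw [← not_iff_not]
    simp only [rlz, BoundedFormula.realize_ex, BoundedFormula.realize_inf, rz_le, Term.realize_relabel, rz_v, Fin.snoc_last, e, h1, h2, not_exists, not_and, bdd_abs]
    refine forall_congr' fun j => imp_congr_right fun _ => not_congr ?_
    rw [snoc_nat, snoc_nat]
    exact ih _

theorem d0_abs {m : ℕ} {R : Rl m} (h : D0 R) (M : Mod) (v : Fin m → ℕ) :
    R M (fun i => (v i : M)) ↔ R NN (fun i => (v i : NN)) := by
  obtain ⟨θ, h1, h2⟩ := h.ex
  rw [← h2, ← h2]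
  exact delta0_abs h1 M v



section
variable {M : Mod}
/-- lookup item -/
def lk (i a x : M) : M := pr 0 (pr i (pr a x))
/-- truth item -/
def vf (e a : M) : M := pr 1 (pr e a)

/-- one-step justification -/
def Just (P : M → Prop) (k : M) : Prop :=
  (∃ a x, k = lk 0 (pr x a) x) ∨
  (∃ i a x y, k = lk (i + 1) (pr y a) x ∧ P (lk i a x)) ∨
  (∃ i j l a x y, k = vf (pr 0 (pr i (pr j l))) a ∧ P (lk i a x) ∧ P (lk j a y) ∧ P (lk l a (x + y))) ∨
  (∃ i j l a x y, k = vf (pr 1 (pr i (pr j l))) a ∧ P (lk i a x) ∧ P (lk j a y) ∧ P (lk l a (x * y))) ∨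
  (∃ i j a x, k = vf (pr 2 (pr i j)) a ∧ P (lk i a x) ∧ P (lk j a (x + 1))) ∨
  (∃ f g a, k = vf (pr 3 (pr f g)) a ∧ P (vf f a) ∧ P (vf g a)) ∨
  (∃ f g a, k = vf (pr 4 (pr f g)) a ∧ (P (vf f a) ∨ P (vf g a))) ∨
  (∃ f a x, k = vf (pr 5 f) a ∧ P (vf f (pr x a))) ∨
  (∃ f a y, k = vf (pr 6 f) (pr y a) ∧ ∀ z, z ≤ y → P (vf f (pr z a)))

theorem Just.mono {P Q : M → Prop} (h : ∀ k, P k → Q k) {k : M} (hk : Just P k) : Just Q k := by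
  unfold Just at *
  rcases hk with ⟨a, x, e⟩ | ⟨i, a, x, y, e, h1⟩ | ⟨i, j, l, a, x, y, e, h1, h2, h3⟩ |
    ⟨i, j, l, a, x, y, e, h1, h2, h3⟩ | ⟨i, j, a, x, e, h1, h2⟩ | ⟨f, g, a, e, h1, h2⟩ |
    ⟨f, g, a, e, h1⟩ | ⟨f, a, x, e, h1⟩ | ⟨f, a, y, e, h1⟩
  · exact .inl ⟨a, x, e⟩
  · exact .inr (.inl ⟨i, a, x, y, e, h _ h1⟩)
  · exact .inr (.inr (.inl ⟨i, j, l, a, x, y, e, h _ h1, h _ h2, h _ h3⟩))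
  · exact .inr (.inr (.inr (.inl ⟨i, j, l, a, x, y, e, h _ h1, h _ h2, h _ h3⟩)))
  · exact .inr (.inr (.inr (.inr (.inl ⟨i, j, a, x, e, h _ h1, h _ h2⟩))))
  · exact .inr (.inr (.inr (.inr (.inr (.inl ⟨f, g, a, e, h _ h1, h _ h2⟩)))))
  · exact .inr (.inr (.inr (.inr (.inr (.inr (.inl ⟨f, g, a, e, h1.imp (h _) (h _)⟩))))))
  · exact .inr (.inr (.inr (.inr (.inr (.inr (.inr (.inl ⟨f, a, x, e, h _ h1⟩)))))))
  · exact .inr (.inr (.inr (.inr (.inr (.inr (.inr (.inr ⟨f, a, y, e, fun z hz => h _ (h1 z hz)⟩)))))))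

theorem Just.cont {P : M → M → Prop} (hm : ∀ N N' k, N ≤ N' → P N k → P N' k)
    (hP : Df (m := 2) (fun v => P (v 0) (v 1)))
    {k : M} (hk : Just (fun k => ∃ N, P N k) k) : ∃ N, Just (P N) k := by
  unfold Just at *
  rcases hk with ⟨a, x, e⟩ | ⟨i, a, x, y, e, N1, h1⟩ | ⟨i, j, l, a, x, y, e, ⟨N1, h1⟩, ⟨N2, h2⟩, N3, h3⟩ |
    ⟨i, j, l, a, x, y, e, ⟨N1, h1⟩, ⟨N2, h2⟩, N3, h3⟩ | ⟨i, j, a, x, e, ⟨N1, h1⟩, N2, h2⟩ |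
    ⟨f, g, a, e, ⟨N1, h1⟩, N2, h2⟩ | ⟨f, g, a, e, h1⟩ | ⟨f, a, x, e, N1, h1⟩ | ⟨f, a, y, e, h1⟩
  · exact ⟨0, .inl ⟨a, x, e⟩⟩
  · exact ⟨N1, .inr (.inl ⟨i, a, x, y, e, h1⟩)⟩
  · exact ⟨N1 + N2 + N3, .inr (.inr (.inl ⟨i, j, l, a, x, y, e, hm _ _ _ (by rw [add_assoc]; exact le_self_add) h1,
      hm _ _ _ (by rw [add_right_comm]; exact le_add_self) h2, hm _ _ _ le_add_self h3⟩))⟩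
  · exact ⟨N1 + N2 + N3, .inr (.inr (.inr (.inl ⟨i, j, l, a, x, y, e, hm _ _ _ (by rw [add_assoc]; exact le_self_add) h1,
      hm _ _ _ (by rw [add_right_comm]; exact le_add_self) h2, hm _ _ _ le_add_self h3⟩)))⟩
  · exact ⟨N1 + N2, .inr (.inr (.inr (.inr (.inl ⟨i, j, a, x, e, hm _ _ _ le_self_add h1, hm _ _ _ le_add_self h2⟩))))⟩
  · exact ⟨N1 + N2, .inr (.inr (.inr (.inr (.inr (.inl ⟨f, g, a, e, hm _ _ _ le_self_add h1, hm _ _ _ le_add_self h2⟩)))))⟩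
  · rcases h1 with ⟨N, h1⟩ | ⟨N, h1⟩
    · exact ⟨N, .inr (.inr (.inr (.inr (.inr (.inr (.inl ⟨f, g, a, e, .inl h1⟩))))))⟩
    · exact ⟨N, .inr (.inr (.inr (.inr (.inr (.inr (.inl ⟨f, g, a, e, .inr h1⟩))))))⟩
  · exact ⟨N1, .inr (.inr (.inr (.inr (.inr (.inr (.inr (.inl ⟨f, a, x, e, h1⟩)))))))⟩
  · obtain ⟨N, hN⟩ := coll (fun z N => P N (vf f (pr z a)))
      (by
        have h1 : Tm (fun v : Fin 2 → M => vf f (pr (v 0) a)) := by unfold vf; infer_instance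
        exact df_comp2 P hP (fun v : Fin 2 → M => v 1) (fun v => vf f (pr (v 0) a))) (y + 1)
      (fun z hz => h1 z (m_lt_add_one.1 hz))
    exact ⟨N, .inr (.inr (.inr (.inr (.inr (.inr (.inr (.inr ⟨f, a, y, e, fun z hz => by
      obtain ⟨N', h', hN'⟩ := hN z (m_lt_add_one.2 hz)
      exact hm _ _ _ h' hN'⟩)))))))⟩

/-- closed coded set -/
def Cls (B c d : M) : Prop := ∀ k, k < B → (¬ Mem k B c d ∨ Just (fun k => Mem k B c d) k)
/-- derivability -/
def Der (k : M) : Prop := ∃ B c d, Mem k B c d ∧ Cls B c d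

end

section
variable {m : ℕ}
instance ut_lk (f g h : Fn m) [UT f] [UT g] [UT h] : UT (fun M v => lk (f M v) (g M v) (h M v)) := by
  unfold lk; infer_instance
instance ut_vf (f g : Fn m) [UT f] [UT g] : UT (fun M v => vf (f M v) (g M v)) := by
  unfold vf; infer_instance
set_option maxHeartbeats 1000000 in
set_option synthInstance.maxHeartbeats 400000 in
set_option synthInstance.maxSize 2000 in
theorem sg_just : Sg 1 (m := 4) (fun _ v => Just (fun k => Mem k (v 0) (v 1) (v 2)) (v 3)) := by
  unfold Just; infer_instance
theorem sg_cls : Sg 1 (m := 3) (fun _ v => Cls (v 0) (v 1) (v 2)) := by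
  unfold Cls
  have := sg_just
  exact sg_ball' (m := 3) (fun _ v => v 0) (fun _ v k => ¬ Mem k (v 0) (v 1) (v 2) ∨ Just (fun k => Mem k (v 0) (v 1) (v 2)) k) (hf := sg_or (m := 4) _ _ (hg := this))
theorem sg_der : Sg 1 (m := 1) (fun _ v => Der (v 0)) := by
  unfold Der
  have h := sg_cls.sub (k := 4) (fun i _ v => v i.succ) (fun i => inferInstance)
  exact sg_ex (m := 1) (fun M v B => ∃ c d, Mem (v 0) B c d ∧ Cls B c d)
    (hf := sg_ex (m := 2) (fun M v c => ∃ d, Mem (v 0) (v 1) c d ∧ Cls (v 1) c d)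
    (hf := sg_ex (m := 3) (fun M v d => Mem (v 0) (v 1) (v 2) d ∧ Cls (v 1) (v 2) d)
      (hf := sg_and (m := 4) _ _ (hg := h))))
end

section
variable {M : Mod}
theorem der_iff (k : M) : Der k ↔ Just Der k := by
  constructor
  · rintro ⟨B, c, d, h1, h2⟩
    have := (h2 k h1.1).resolve_left (not_not.2 h1)
    exact this.mono fun k' hk' => ⟨B, c, d, hk', h2⟩
  · intro h
    let P : M → M → Prop := fun N k => ∃ B, B ≤ N ∧ ∃ c, c ≤ N ∧ ∃ d, d ≤ N ∧ Mem k B c d ∧ Cls B c d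
    have hP : Df (m := 2) (fun v => P (v 0) (v 1)) := by
      have h : Sg 1 (m := 5) (fun M v => Cls (v 2) (v 3) (v 4)) :=
        sg_cls.sub (k := 5) (fun i _ v => v i.succ.succ) (fun i => inferInstance)
      have := sg_bex (m := 2) (fun M v => v 0) (fun M v B => ∃ c, c ≤ v 0 ∧ ∃ d, d ≤ v 0 ∧ Mem (v 1) B c d ∧ Cls B c d)
        (hf := sg_bex (m := 3) (fun M v => v 0) (fun M v c => ∃ d, d ≤ v 0 ∧ Mem (v 1) (v 2) c d ∧ Cls (v 2) c d)
        (hf := sg_bex (m := 4) (fun M v => v 0) (fun M v d => Mem (v 1) (v 2) (v 3) d ∧ Cls (v 2) (v 3) d)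
        (hf := sg_and (m := 5) _ _ (hg := h))))
      exact SgD.df this.ex M
    have hm : ∀ N N' k, N ≤ N' → P N k → P N' k := by
      rintro N N' k hN ⟨B, h1, c, h2, d, h3, h4⟩
      exact ⟨B, h1.trans hN, c, h2.trans hN, d, h3.trans hN, h4⟩
    have h' : Just (fun k => ∃ N, P N k) k := h.mono fun k' ⟨B, c, d, h1, h2⟩ =>
      ⟨B + c + d, B, by rw [add_assoc]; exact le_self_add, c, by rw [add_right_comm]; exact le_add_self, d, le_add_self, h1, h2⟩
    obtain ⟨N, hN⟩ := Just.cont hm hP h'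
    obtain ⟨c, d, hcd⟩ := compr (fun k' => P N k' ∨ k' = k) (by
      have := df_comp2 P hP (fun v : Fin 1 → M => N) (fun v => v 0)
      infer_instance) (N + k + 1)
    have sub : ∀ k', P N k' → Mem k' (N + k + 1) c d := by
      intro k' h
      refine (hcd k').2 ⟨?_, .inl h⟩
      obtain ⟨B, h1, c, h2, d, h3, h4, -⟩ := h
      rw [m_lt_add_one]
      exact (h4.1.le.trans h1).trans le_self_add
    refine ⟨N + k + 1, c, d, (hcd k).2 ⟨by rw [m_lt_add_one]; exact le_add_self, .inr rfl⟩, fun k' _ => ?_⟩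
    by_cases hk' : Mem k' (N + k + 1) c d
    · right
      rcases ((hcd k').1 hk').2 with h | rfl
      · obtain ⟨B, h1, c', h2, d', h3, h4, h5⟩ := h
        exact ((h5 k' h4.1).resolve_left (not_not.2 h4)).mono fun k'' hk'' => sub _ ⟨B, h1, c', h2, d', h3, hk'', h5⟩
      · exact hN.mono sub
    · exact .inl hk'

theorem zero_ne_add_one (x : M) : ¬ ((0 : M) = x + 1) := by
  intro h
  have := m_lt_add_one.2 (zero_le (a := x))
  rw [← h] at this; exact lt_irrefl _ this

theorem der_lk0 (a x x' : M) : Der (lk 0 (pr x a) x') ↔ x' = x := by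
  rw [der_iff]; simp [Just, lk, vf, zero_ne_add_one, eq_comm]
theorem der_lks (i a x y : M) : Der (lk (i + 1) (pr y a) x) ↔ Der (lk i a x) := by
  rw [der_iff]; simp [Just, lk, vf]
theorem der_add (i j l a : M) : Der (vf (pr 0 (pr i (pr j l))) a) ↔
    ∃ x y, Der (lk i a x) ∧ Der (lk j a y) ∧ Der (lk l a (x + y)) := by
  rw [der_iff]; simp [Just, lk, vf]
theorem der_mul (i j l a : M) : Der (vf (pr 1 (pr i (pr j l))) a) ↔
    ∃ x y, Der (lk i a x) ∧ Der (lk j a y) ∧ Der (lk l a (x * y)) := by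
  rw [der_iff]; simp [Just, lk, vf]
theorem der_suc (i j a : M) : Der (vf (pr 2 (pr i j)) a) ↔
    ∃ x, Der (lk i a x) ∧ Der (lk j a (x + 1)) := by
  rw [der_iff]; simp [Just, lk, vf]
theorem der_and (f g a : M) : Der (vf (pr 3 (pr f g)) a) ↔ Der (vf f a) ∧ Der (vf g a) := by
  rw [der_iff]; simp [Just, lk, vf]
theorem der_or (f g a : M) : Der (vf (pr 4 (pr f g)) a) ↔ Der (vf f a) ∨ Der (vf g a) := by
  rw [der_iff]; simp [Just, lk, vf]
theorem der_ex (f a : M) : Der (vf (pr 5 f) a) ↔ ∃ x, Der (vf f (pr x a)) := by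
  rw [der_iff]; simp [Just, lk, vf]
theorem der_ball (f a y : M) : Der (vf (pr 6 f) (pr y a)) ↔ ∀ z, z ≤ y → Der (vf f (pr z a)) := by
  rw [der_iff]; simp [Just, lk, vf]

/-- environments -/
def env : ∀ {m : ℕ}, (Fin m → M) → M
  | 0, _ => 0
  | m + 1, v => pr (v (Fin.last m)) (env (fun i : Fin m => v i.castSucc))

theorem env_snoc {m : ℕ} (v : Fin m → M) (x : M) : env (Fin.snoc v x : Fin (m+1) → M) = pr x (env v) := by
  simp [env]

theorem der_var : ∀ {m : ℕ} (i : Fin m) (v : Fin m → M) (x : M),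
    Der (lk ((m - 1 - i : ℕ) : M) (env v) x) ↔ x = v i
  | 0, i, _, _ => i.elim0
  | m + 1, i, v, x => by
    refine Fin.lastCases ?_ (fun i => ?_) i
    · simp [env, der_lk0]
    · have : m + 1 - 1 - (i.castSucc : ℕ) = (m - 1 - i) + 1 := by
        have := i.2; simp; omega
      rw [this, env, Nat.cast_succ, der_lks, der_var i]
end

/-- positive Σ1 relations without terms -/
inductive GP : ∀ {m : ℕ}, Rl m → Prop
  | add {m : ℕ} (i j l : Fin m) : GP (fun _ v => v i + v j = v l)
  | mul {m : ℕ} (i j l : Fin m) : GP (fun _ v => v i * v j = v l)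
  | suc {m : ℕ} (i j : Fin m) : GP (fun _ v => v i + 1 = v j)
  | and {m : ℕ} {P Q : Rl m} : GP P → GP Q → GP (fun M v => P M v ∧ Q M v)
  | or {m : ℕ} {P Q : Rl m} : GP P → GP Q → GP (fun M v => P M v ∨ Q M v)
  | ex {m : ℕ} {Q : Rl (m + 1)} : GP Q → GP (fun M v => ∃ x, Q M (Fin.snoc v x))
  | ball {m : ℕ} {Q : Rl (m + 1)} : GP Q →
      GP (m := m + 1) (fun M v => ∀ z, z ≤ v (Fin.last m) → Q M (Fin.snoc (fun i => v i.castSucc) z))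

theorem pr_nat {M : Mod} (x y : ℕ) : pr (x : M) (y : M) = (((x + y) * (x + y) + x : ℕ) : M) := by
  simp [pr]

theorem GP.congr {m : ℕ} {R R' : Rl m} (h : GP R) (h2 : ∀ M v, R' M v ↔ R M v) : GP R' := by
  have : R' = R := by funext M v; exact propext (h2 M v)
  rwa [this]

theorem gp_code {m : ℕ} {R : Rl m} (h : GP R) : ∃ e : ℕ, ∀ M v, Der (M := M) (vf (e : M) (env v)) ↔ R M v := by
  induction h with
  | @add m i j l =>
    have hc : ∃ e : ℕ, ∀ M : Mod, (e : M) = pr 0 (pr ((m - 1 - i : ℕ) : M) (pr ((m - 1 - j : ℕ) : M) ((m - 1 - l : ℕ) : M))) :=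
      ⟨_, fun M => by rw [pr_nat, pr_nat, ← Nat.cast_zero, pr_nat]⟩
    obtain ⟨e, he⟩ := hc
    refine ⟨e, fun M v => ?_⟩
    rw [he, der_add]; simp [der_var]
  | @mul m i j l =>
    have hc : ∃ e : ℕ, ∀ M : Mod, (e : M) = pr 1 (pr ((m - 1 - i : ℕ) : M) (pr ((m - 1 - j : ℕ) : M) ((m - 1 - l : ℕ) : M))) :=
      ⟨_, fun M => by rw [pr_nat, pr_nat, ← Nat.cast_one, pr_nat]⟩
    obtain ⟨e, he⟩ := hc
    refine ⟨e, fun M v => ?_⟩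
    rw [he, der_mul]; simp [der_var]
  | @suc m i j =>
    have hc : ∃ e : ℕ, ∀ M : Mod, (e : M) = pr 2 (pr ((m - 1 - i : ℕ) : M) ((m - 1 - j : ℕ) : M)) :=
      ⟨_, fun M => by rw [pr_nat, ← Nat.cast_ofNat, pr_nat]⟩
    obtain ⟨e, he⟩ := hc
    refine ⟨e, fun M v => ?_⟩
    rw [he, der_suc]; simp [der_var]
  | and _ _ ih1 ih2 =>
    obtain ⟨f, hf⟩ := ih1
    obtain ⟨g, hg⟩ := ih2
    have hc : ∃ e : ℕ, ∀ M : Mod, (e : M) = pr 3 (pr (f : M) (g : M)) :=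
      ⟨_, fun M => by rw [pr_nat, ← Nat.cast_ofNat, pr_nat]⟩
    obtain ⟨e, he⟩ := hc
    exact ⟨e, fun M v => by rw [he, der_and, hf, hg]⟩
  | or _ _ ih1 ih2 =>
    obtain ⟨f, hf⟩ := ih1
    obtain ⟨g, hg⟩ := ih2
    have hc : ∃ e : ℕ, ∀ M : Mod, (e : M) = pr 4 (pr (f : M) (g : M)) :=
      ⟨_, fun M => by rw [pr_nat, ← Nat.cast_ofNat, pr_nat]⟩
    obtain ⟨e, he⟩ := hc
    exact ⟨e, fun M v => by rw [he, der_or, hf, hg]⟩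
  | ex _ ih =>
    obtain ⟨f, hf⟩ := ih
    have hc : ∃ e : ℕ, ∀ M : Mod, (e : M) = pr 5 (f : M) :=
      ⟨_, fun M => by rw [← Nat.cast_ofNat, pr_nat]⟩
    obtain ⟨e, he⟩ := hc
    exact ⟨e, fun M v => by simp only [he, der_ex, ← env_snoc, hf]⟩
  | ball _ ih =>
    obtain ⟨f, hf⟩ := ih
    have hc : ∃ e : ℕ, ∀ M : Mod, (e : M) = pr 6 (f : M) :=
      ⟨_, fun M => by rw [← Nat.cast_ofNat, pr_nat]⟩
    obtain ⟨e, he⟩ := hc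
    exact ⟨e, fun M v => by rw [env, he, der_ball]; simp only [← env_snoc, hf]⟩

theorem gp_term {m : ℕ} (t : LA.Term (Empty ⊕ Fin m)) : ∀ {k : ℕ} (f : Fin m → Fin k) (o : Fin k),
    GP (fun M w => w o = t.realize (Sum.elim default (fun i => w (f i)))) := by
  induction t with
  | var x =>
    intro k f o
    rcases x with x | x
    · exact x.elim
    · refine (GP.ex (.and (.add (Fin.last k) (Fin.last k) (Fin.last k)) (.add o.castSucc (Fin.last k) (f x).castSucc))).congr fun M v => ?_
      simp
  | @func l g ts ih =>
    intro k f o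
    match l, g, ts, ih with
    | 0, g, ts, ih =>
      have e : (Term.func g ts : LA.Term (Empty ⊕ Fin m)) = zeroT := by
        show _ = Term.func _ _
        congr 1; exact Subsingleton.elim _ _
      rw [e]; exact (GP.add o o o).congr fun M v => by simp
    | 1, g, ts, ih =>
      have e : (Term.func g ts : LA.Term (Empty ⊕ Fin m)) = succT (ts 0) := by
        show _ = Term.func _ _
        congr 1; funext i; fin_cases i; rfl
      rw [e]
      refine (GP.ex (.and (ih 0 (fun i => (f i).castSucc) (Fin.last k)) (.suc (Fin.last k) o.castSucc))).congr fun M v => ?_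
      simp [sc_eq, eq_comm]
    | 2, false, ts, ih =>
      have e : (Term.func (L := LA) (l := 2) false ts : LA.Term (Empty ⊕ Fin m)) = addT (ts 0) (ts 1) := by
        show _ = Term.func _ _
        congr 1; funext i; fin_cases i <;> rfl
      rw [e]
      refine (GP.ex (.ex (.and (ih 0 (fun i => (f i).castSucc.castSucc) (Fin.last _).castSucc)
        (.and (ih 1 (fun i => (f i).castSucc.castSucc) (Fin.last _)) (.add (Fin.last k).castSucc (Fin.last _) o.castSucc.castSucc))))).congr fun M v => ?_
      simp [eq_comm]
    | 2, true, ts, ih =>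
      have e : (Term.func (L := LA) (l := 2) true ts : LA.Term (Empty ⊕ Fin m)) = mulT (ts 0) (ts 1) := by
        show _ = Term.func _ _
        congr 1; funext i; fin_cases i <;> rfl
      rw [e]
      refine (GP.ex (.ex (.and (ih 0 (fun i => (f i).castSucc.castSucc) (Fin.last _).castSucc)
        (.and (ih 1 (fun i => (f i).castSucc.castSucc) (Fin.last _)) (.mul (Fin.last k).castSucc (Fin.last _) o.castSucc.castSucc))))).congr fun M v => ?_
      simp [eq_comm]
    | (_ + 3), g, _, _ => exact Empty.elim g

theorem gp_eq {m : ℕ} (t u : LA.Term (Empty ⊕ Fin m)) :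
    GP (fun M w => t.realize (Sum.elim default w) = u.realize (Sum.elim (default : Empty → M) w)) := by
  refine (GP.ex (.and (gp_term t Fin.castSucc (Fin.last m)) (gp_term u Fin.castSucc (Fin.last m)))).congr fun M v => ?_
  simp [eq_comm]
theorem gp_le {m : ℕ} (t u : LA.Term (Empty ⊕ Fin m)) :
    GP (fun M w => t.realize (Sum.elim default w) ≤ u.realize (Sum.elim (default : Empty → M) w)) := by
  refine (GP.ex (.ex (.ex (.and (gp_term t (fun i => i.castSucc.castSucc.castSucc) (Fin.last _).castSucc.castSucc)
    (.and (gp_term u (fun i => i.castSucc.castSucc.castSucc) (Fin.last _).castSucc)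
      (.add (Fin.last m).castSucc.castSucc (Fin.last _) (Fin.last _).castSucc)))))).congr fun M v => ?_
  simp only [Fin.snoc_castSucc, Fin.snoc_last, m_le_iff]
  constructor
  · rintro ⟨z, h⟩; exact ⟨_, _, z, rfl, rfl, h.symm⟩
  · rintro ⟨_, _, z, rfl, rfl, h⟩; exact ⟨z, h.symm⟩
theorem gp_lt {m : ℕ} (t u : LA.Term (Empty ⊕ Fin m)) :
    GP (fun M w => t.realize (Sum.elim default w) < u.realize (Sum.elim (default : Empty → M) w)) :=
  (gp_le (succT t) u).congr fun M v => by rw [m_lt_iff, rz_succ, sc_eq]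
theorem gp_false {m : ℕ} : GP (m := m) (fun _ _ => False) :=
  (gp_lt (zeroT : LA.Term (Empty ⊕ Fin m)) zeroT).congr fun M v => by simp
theorem gp_true {m : ℕ} : GP (m := m) (fun _ _ => True) :=
  (gp_eq (zeroT : LA.Term (Empty ⊕ Fin m)) zeroT).congr fun M v => by simp

theorem lift_env {m : ℕ} {M : Mod} (w : Fin m → M) (x : M) :
    (Sum.elim (default : Empty → M) (Fin.snoc w x : Fin (m+1) → M)) ∘ Sum.map id Fin.castSucc = Sum.elim default w := by
  ext y; rcases y with y | y
  · exact y.elim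
  · simp

theorem gp_ball {m : ℕ} (t : LA.Term (Empty ⊕ Fin m)) {Q : Rl (m + 1)} (h : GP Q) :
    GP (fun M v => ∀ x, x ≤ t.realize (Sum.elim (default : Empty → M) v) → Q M (Fin.snoc v x)) := by
  refine (GP.ex (.and (gp_term t Fin.castSucc (Fin.last m)) (.ball h))).congr fun M v => ?_
  simp

theorem gp_delta0 {m : ℕ} {φ : LA.BoundedFormula Empty m} (h : IsDelta0 φ) :
    GP (rlz φ) ∧ GP (fun M v => ¬ rlz φ M v) := by
  induction h with
  | falsum => exact ⟨gp_false, gp_true.congr fun M v => by simp [rlz]⟩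
  | equal t u =>
    exact ⟨(gp_eq t u).congr fun M v => by simp [rlz],
      (GP.or (gp_lt t u) (gp_lt u t)).congr fun M v => by simp [rlz]⟩
  | le t u =>
    exact ⟨(gp_le t u).congr fun M v => by simp [rlz], (gp_lt u t).congr fun M v => by simp [rlz]⟩
  | imp _ _ ih1 ih2 =>
    exact ⟨(GP.or ih1.2 ih2.1).congr fun M v => by simp [rlz]; tauto,
      (GP.and ih1.1 ih2.2).congr fun M v => by simp [rlz]⟩
  | @ball m t φ _ ih =>
    have e := gp_le (vT (Fin.last m)) (t.relabel (Sum.map id Fin.castSucc))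
    refine ⟨(gp_ball t ih.1).congr fun M v => ?_, (GP.ex (.and e ih.2)).congr fun M v => ?_⟩
    · simp [rlz, lift_env]
    · simp [rlz, lift_env]
  | @bex m t φ _ ih =>
    have e := gp_le (vT (Fin.last m)) (t.relabel (Sum.map id Fin.castSucc))
    refine ⟨(GP.ex (.and e ih.1)).congr fun M v => ?_, (gp_ball t ih.2).congr fun M v => ?_⟩
    · simp [rlz, lift_env]
    · simp [rlz, lift_env]

/-- universal relation for Σ_{n+1} -/
def Sat {M : Mod} : ℕ → M → M → Prop
  | 0, e, a => Der (vf e a)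
  | n + 1, e, a => ∃ x, ¬ Sat n e (pr x a)

theorem sg_sat : ∀ n : ℕ, SgD (n + 1) (m := 2) (fun _ v => Sat n (v 0) (v 1))
  | 0 => (sg_der.sub (k := 2) (fun _ _ v => vf (v 0) (v 1)) (fun i => inferInstance)).ex
  | n + 1 => by
    refine ⟨fun M v => Sat n (v 0) (pr (v 2) (v 1)), ?_, fun M v => ?_⟩
    · refine (sg_sat n).sub (k := 3) ![fun _ v => v 0, fun _ v => pr (v 2) (v 1)] fun i => ?_
      fin_cases i
      · show UT (fun _ v => v 0); infer_instance
      · show UT (fun _ v => pr (v 2) (v 1)); infer_instance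
    · show (∃ x, _) ↔ _
      refine exists_congr fun x => ?_
      rfl

theorem sat_univ : ∀ {n m : ℕ} {R : Rl m}, SgD (n + 1) R →
    ∃ e : ℕ, ∀ M v, Sat (M := M) n (e : M) (env v) ↔ R M v
  | 0, m, R, ⟨R', h1, h2⟩ => by
    obtain ⟨θ, h3, h4⟩ := (h1 : D0 R').ex
    obtain ⟨e, he⟩ := gp_code (GP.ex (gp_delta0 h3).2)
    refine ⟨e, fun M v => ?_⟩
    rw [h2]; simp only [Sat, he]
    simp only [rlz, h4]
  | n + 1, m, R, ⟨R', h1, h2⟩ => by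
    obtain ⟨e, he⟩ := sat_univ h1
    refine ⟨e, fun M v => ?_⟩
    rw [h2]; simp only [Sat, ← env_snoc, he]



/-- Σ1 relations on the naturals -/
class SN {m : ℕ} (R : (Fin m → ℕ) → Prop) : Prop where
  ex : ∃ R' : Rl m, Sg 1 R' ∧ ∀ v : Fin m → ℕ, R v ↔ R' NN (fun i => (v i : NN))
/-- functions with Σ1 graph -/
class SF {m : ℕ} (f : (Fin m → ℕ) → ℕ) : Prop where
  gr : SN (m := m + 1) (fun w => w (Fin.last m) = f (fun i => w i.castSucc))

section
variable {m : ℕ}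
theorem SN.congr {R R' : (Fin m → ℕ) → Prop} (h : SN R) (h2 : ∀ v, R' v ↔ R v) : SN R' := by
  have : R' = R := by funext v; exact propext (h2 v)
  rwa [this]
theorem SN.ren {k : ℕ} {R : (Fin m → ℕ) → Prop} (h : SN R) (s : Fin m → Fin k) : SN (fun w => R (fun i => w (s i))) := by
  obtain ⟨R', h1, h2⟩ := h.ex
  exact ⟨fun M w => R' M (fun i => w (s i)), h1.sub (fun i _ v => v (s i)) (fun i => inferInstance), fun v => h2 _⟩

instance sn_and (P Q : (Fin m → ℕ) → Prop) [hf : SN P] [hg : SN Q] : SN (fun v => P v ∧ Q v) := by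
  obtain ⟨P', h1, h2⟩ := hf.ex
  obtain ⟨Q', h3, h4⟩ := hg.ex
  exact ⟨fun M v => P' M v ∧ Q' M v, inferInstance, fun v => and_congr (h2 v) (h4 v)⟩
instance sn_or (P Q : (Fin m → ℕ) → Prop) [hf : SN P] [hg : SN Q] : SN (fun v => P v ∨ Q v) := by
  obtain ⟨P', h1, h2⟩ := hf.ex
  obtain ⟨Q', h3, h4⟩ := hg.ex
  exact ⟨fun M v => P' M v ∨ Q' M v, inferInstance, fun v => or_congr (h2 v) (h4 v)⟩
instance sn_const (p : Prop) : SN (m := m) (fun _ => p) := ⟨fun _ _ => p, inferInstance, fun _ => Iff.rfl⟩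
instance sn_ex (Q : (Fin m → ℕ) → ℕ → Prop)
    [hf : SN (m := m + 1) (fun w => Q (fun i => w i.castSucc) (w (Fin.last m)))] :
    SN (fun v => ∃ x, Q v x) := by
  obtain ⟨Q', h1, h2⟩ := hf.ex
  refine ⟨fun M v => ∃ x, Q' M (Fin.snoc v x), ⟨clo_ex (clo 0) h1.ex⟩, fun v => ?_⟩
  constructor
  · rintro ⟨x, hx⟩
    refine ⟨(x : NN), ?_⟩
    rw [snoc_nat, ← h2]; simpa using hx
  · rintro ⟨x, hx⟩
    obtain ⟨k, rfl⟩ := nn_surj x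
    rw [snoc_nat, ← h2] at hx
    exact ⟨k, by simpa using hx⟩
theorem sn_ball0 (o : Fin m) (Q : (Fin m → ℕ) → ℕ → Prop)
    (hf : SN (m := m + 1) (fun w => Q (fun i => w i.castSucc) (w (Fin.last m)))) :
    SN (fun v => ∀ x, x < v o → Q v x) := by
  obtain ⟨Q', h1, h2⟩ := hf.ex
  refine ⟨fun M v => ∀ x, x < v o → Q' M (Fin.snoc v x), ?_, fun v => ?_⟩
  · exact sg_ball' (fun M v => v o) (fun M v x => Q' M (Fin.snoc v x)) (hf := h1.congr fun M v => by rw [snoc_split])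
  constructor
  · intro h x hx
    obtain ⟨k, rfl⟩ := nn_surj x
    rw [snoc_nat, ← h2]
    simpa using h k (by simpa using hx)
  · intro h k hk
    have := h (k : NN) (by simpa using hk)
    rw [snoc_nat, ← h2] at this
    simpa using this

theorem sn_d0 {R : Rl m} (hR : D0 R) (R' : (Fin m → ℕ) → Prop) (h : ∀ v : Fin m → ℕ, R' v ↔ R NN (fun i => (v i : NN))) : SN R' :=
  ⟨R, inferInstance, h⟩

theorem sf_lift (f : (Fin m → ℕ) → ℕ) [hf : SF f] : SF (m := m + 1) (fun w => f (fun i => w i.castSucc)) := by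
  refine ⟨(hf.gr.ren (k := m + 2) (fun i => if h : i = Fin.last m then Fin.last _ else (i.castPred h).castSucc.castSucc)).congr fun w => ?_⟩
  simp

instance sf_var (i : Fin m) : SF (fun v => v i) :=
  ⟨sn_d0 (R := fun M v => v (Fin.last m) = v i.castSucc) inferInstance _ fun v => by simp⟩
instance sf_const (k : ℕ) : SF (m := m) (fun _ => k) :=
  ⟨sn_d0 (R := fun M v => v (Fin.last m) = (k : M)) inferInstance _ fun v => by simp⟩

theorem sn_sub1 {Q : (Fin m → ℕ) → ℕ → Prop} (f : (Fin m → ℕ) → ℕ) [hf : SF f]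
    [hQ : SN (m := m + 1) (fun w => Q (fun i => w i.castSucc) (w (Fin.last m)))] : SN (fun v => Q v (f v)) := by
  have := hf.gr
  exact (sn_ex (fun v x => x = f v ∧ Q v x)).congr fun v => by simp

theorem sn_comp1 {R : ℕ → Prop} (hR : SN (m := 1) (fun v => R (v 0))) (f : (Fin m → ℕ) → ℕ) [hf : SF f] :
    SN (fun v => R (f v)) :=
  sn_sub1 (Q := fun _ x => R x) f (hQ := hR.ren (fun _ => Fin.last m))
theorem sn_comp2 {R : ℕ → ℕ → Prop} (hR : SN (m := 2) (fun v => R (v 0) (v 1))) (f g : (Fin m → ℕ) → ℕ) [hf : SF f] [hg : SF g] :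
    SN (fun v => R (f v) (g v)) := by
  have := sf_lift g
  exact sn_sub1 (Q := fun v x => R x (g v)) f
    (hQ := sn_sub1 (m := m + 1) (Q := fun v y => R (v (Fin.last m)) y) _
      (hQ := hR.ren (k := m + 2) ![(Fin.last m).castSucc, Fin.last (m + 1)]))
theorem sn_comp3 {R : ℕ → ℕ → ℕ → Prop} (hR : SN (m := 3) (fun v => R (v 0) (v 1) (v 2))) (f g h : (Fin m → ℕ) → ℕ)
    [hf : SF f] [hg : SF g] [hh : SF h] : SN (fun v => R (f v) (g v) (h v)) := by
  have := sf_lift g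
  have := sf_lift h
  have := sf_lift (m := m + 1) (fun w => h (fun i => w i.castSucc))
  exact sn_sub1 (Q := fun v x => R x (g v) (h v)) f
    (hQ := sn_sub1 (m := m + 1) (Q := fun v y => R (v (Fin.last m)) y (h fun i => v i.castSucc)) _
      (hQ := sn_sub1 (m := m + 2) (Q := fun v z => R (v (Fin.last m).castSucc) (v (Fin.last (m+1))) z) _
      (hQ := hR.ren (k := m + 3) ![(Fin.last m).castSucc.castSucc, (Fin.last (m + 1)).castSucc, Fin.last (m + 2)])))

instance sn_eq (f g : (Fin m → ℕ) → ℕ) [SF f] [SF g] : SN (fun v => f v = g v) :=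
  sn_comp2 (R := fun x y => x = y) (sn_d0 (m := 2) (R := fun _ v => v 0 = v 1) inferInstance _ fun v => by simp) f g
instance sn_ne (f g : (Fin m → ℕ) → ℕ) [SF f] [SF g] : SN (fun v => ¬ f v = g v) :=
  sn_comp2 (R := fun x y => ¬ x = y) (sn_d0 (m := 2) (R := fun _ v => ¬ v 0 = v 1) inferInstance _ fun v => by simp) f g
instance sn_le (f g : (Fin m → ℕ) → ℕ) [SF f] [SF g] : SN (fun v => f v ≤ g v) :=
  sn_comp2 (R := fun x y => x ≤ y) (sn_d0 (m := 2) (R := fun _ v => v 0 ≤ v 1) inferInstance _ fun v => by simp) f g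
instance sn_lt (f g : (Fin m → ℕ) → ℕ) [SF f] [SF g] : SN (fun v => f v < g v) :=
  sn_comp2 (R := fun x y => x < y) (sn_d0 (m := 2) (R := fun _ v => v 0 < v 1) inferInstance _ fun v => by simp) f g
theorem sf_comp1 {F : ℕ → ℕ} (hF : SN (m := 2) (fun v => v 1 = F (v 0))) (f : (Fin m → ℕ) → ℕ) [SF f] :
    SF (fun v => F (f v)) := by
  have := sf_lift f
  exact ⟨sn_comp2 (R := fun x y => y = F x) hF (fun w : Fin (m + 1) → ℕ => f (fun i => w i.castSucc)) (fun w => w (Fin.last m))⟩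
theorem sf_comp2 {F : ℕ → ℕ → ℕ} (hF : SN (m := 3) (fun v => v 2 = F (v 0) (v 1))) (f g : (Fin m → ℕ) → ℕ) [SF f] [SF g] :
    SF (fun v => F (f v) (g v)) := by
  have := sf_lift f
  have := sf_lift g
  exact ⟨sn_comp3 (R := fun x y z => z = F x y) hF (fun w : Fin (m + 1) → ℕ => f (fun i => w i.castSucc))
    (fun w : Fin (m + 1) → ℕ => g (fun i => w i.castSucc)) (fun w => w (Fin.last m))⟩
instance sf_add (f g : (Fin m → ℕ) → ℕ) [SF f] [SF g] : SF (fun v => f v + g v) :=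
  sf_comp2 (F := fun x y => x + y) (sn_d0 (m := 3) (R := fun _ v => v 2 = v 0 + v 1) inferInstance _ fun v => by dsimp only; norm_cast) f g
instance sf_mul (f g : (Fin m → ℕ) → ℕ) [SF f] [SF g] : SF (fun v => f v * g v) :=
  sf_comp2 (F := fun x y => x * y) (sn_d0 (m := 3) (R := fun _ v => v 2 = v 0 * v 1) inferInstance _ fun v => by dsimp only; norm_cast) f g
instance sf_pair (f g : (Fin m → ℕ) → ℕ) [SF f] [SF g] : SF (fun v => Nat.pair (f v) (g v)) := by
  refine sf_comp2 (F := Nat.pair) ?_ f g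
  refine SN.congr (R := fun v : Fin 3 → ℕ => (v 0 < v 1 ∧ v 2 = v 1 * v 1 + v 0) ∨ (v 1 ≤ v 0 ∧ v 2 = v 0 * v 0 + v 0 + v 1)) inferInstance fun v => ?_
  unfold Nat.pair
  split_ifs with h
  · have : ¬ v 1 ≤ v 0 := by omega
    simp [h, this]
  · have : v 1 ≤ v 0 := by omega
    simp [h, this]
instance sn_ball (t : (Fin m → ℕ) → ℕ) (Q : (Fin m → ℕ) → ℕ → Prop) [ht : SF t]
    [hf : SN (m := m + 1) (fun w => Q (fun i => w i.castSucc) (w (Fin.last m)))] :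
    SN (fun v => ∀ x, x < t v → Q v x) := by
  refine sn_sub1 (Q := fun v y => ∀ x, x < y → Q v x) t (hQ := sn_ball0 (Fin.last m) (fun w x => Q (fun i => w i.castSucc) x) ?_)
  refine (hf.ren (k := m + 2) (fun i => if h : i = Fin.last m then Fin.last _ else (i.castPred h).castSucc.castSucc)).congr fun w => ?_
  simp

/-- remainder relation -/
def Rm (c d i r : ℕ) : Prop := r < (i + 1) * d + 1 ∧ ∃ q, c = q * ((i + 1) * d + 1) + r
instance sn_rm (f g h k : (Fin m → ℕ) → ℕ) [SF f] [SF g] [SF h] [SF k] : SN (fun v => Rm (f v) (g v) (h v) (k v)) := by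
  have := sf_lift f
  have := sf_lift g
  have := sf_lift h
  have := sf_lift k
  unfold Rm; infer_instance
theorem rm_iff (c d i r : ℕ) : Rm c d i r ↔ r = c % ((i + 1) * d + 1) := by
  unfold Rm
  constructor
  · rintro ⟨h, q, rfl⟩
    rw [add_comm, Nat.add_mul_mod_self_right, Nat.mod_eq_of_lt h]
  · rintro rfl
    exact ⟨Nat.mod_lt _ (by omega), c / ((i + 1) * d + 1), by rw [mul_comm, Nat.div_add_mod]⟩

theorem beta_ex (s : ℕ → ℕ) (n : ℕ) : ∃ c d, ∀ i, i ≤ n → Rm c d i (s i) := by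
  let l := List.ofFn (fun i : Fin (n + 1) => s i)
  refine ⟨(Nat.unbeta l).unpair.1, (Nat.unbeta l).unpair.2, fun i hi => ?_⟩
  rw [rm_iff]
  have hl : l.length = n + 1 := by simp [l]
  have := Nat.beta_unbeta_coe l ⟨i, by omega⟩
  unfold Nat.beta at this
  rw [this]; simp only [l, Fin.getElem_fin, List.getElem_ofFn]

theorem prec_iff (f g : ℕ →. ℕ) (a : ℕ) : ∀ n z : ℕ,
    (z ∈ (n.rec (f a) (fun y IH => IH >>= fun i => g (Nat.pair a (Nat.pair y i))) : Part ℕ) ↔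
      ∃ c d x, Rm c d 0 x ∧ x ∈ f a ∧ Rm c d n z ∧
        ∀ y, y < n → ∃ u w, Rm c d y u ∧ Rm c d (y + 1) w ∧ w ∈ g (Nat.pair a (Nat.pair y u))) := by
  intro n z
  constructor
  · intro h
    have : ∃ s : ℕ → ℕ, s 0 ∈ f a ∧ s n = z ∧ ∀ y, y < n → s (y + 1) ∈ g (Nat.pair a (Nat.pair y (s y))) := by
      induction n generalizing z with
      | zero => exact ⟨fun _ => z, h, rfl, by simp⟩
      | succ n ih =>
        obtain ⟨i, hi, hz⟩ := Part.mem_bind_iff.1 h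
        obtain ⟨s, h1, h2, h3⟩ := ih i hi
        refine ⟨fun j => if j ≤ n then s j else z, by simpa using h1, by simp, fun y hy => ?_⟩
        rcases Nat.lt_succ_iff_lt_or_eq.1 hy with hy | rfl
        · have e1 : y + 1 ≤ n := hy
          have e2 : y ≤ n := by omega
          simpa [e1, e2] using h3 y hy
        · simpa [h2] using hz
    obtain ⟨s, h1, h2, h3⟩ := this
    obtain ⟨c, d, hcd⟩ := beta_ex s n
    exact ⟨c, d, s 0, hcd 0 (by omega), h1, h2 ▸ hcd n le_rfl, fun y hy => ⟨s y, s (y + 1), hcd _ (by omega), hcd _ hy, h3 y hy⟩⟩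
  · rintro ⟨c, d, x, h1, h2, h3, h4⟩
    induction n generalizing z with
    | zero =>
      rw [rm_iff] at h1 h3
      rw [h3, ← h1]; exact h2
    | succ n ih =>
      obtain ⟨u, w, h5, h6, h7⟩ := h4 n (by omega)
      refine Part.mem_bind_iff.2 ⟨u, ih u h5 (fun y hy => h4 y (by omega)), ?_⟩
      rw [rm_iff] at h3 h6
      rw [h3, ← h6]; exact h7

theorem partrec_sn {f : ℕ →. ℕ} (h : Nat.Partrec f) : SN (m := 2) (fun v => v 1 ∈ f (v 0)) := by
  induction h with
  | zero => exact (inferInstance : SN (m := 2) (fun v => v 1 = 0)).congr fun v => Part.mem_some_iff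
  | succ => exact (inferInstance : SN (m := 2) (fun v => v 1 = v 0 + 1)).congr fun v => Part.mem_some_iff
  | left =>
    refine (inferInstance : SN (m := 2) (fun v => ∃ x, v 0 = Nat.pair (v 1) x)).congr fun v => Part.mem_some_iff.trans ?_
    constructor
    · intro h; exact ⟨(Nat.unpair (v 0)).2, by simp [h]⟩
    · rintro ⟨x, h⟩; simp [h]
  | right =>
    refine (inferInstance : SN (m := 2) (fun v => ∃ x, v 0 = Nat.pair x (v 1))).congr fun v => Part.mem_some_iff.trans ?_
    constructor
    · intro h; exact ⟨(Nat.unpair (v 0)).1, by simp [h]⟩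
    · rintro ⟨x, h⟩; simp [h]
  | @pair f g _ _ hf hg =>
    have h1 := sn_comp2 (R := fun x y => y ∈ f x) hf (fun v : Fin 4 → ℕ => v 0) (fun v => v 2)
    have h2 := sn_comp2 (R := fun x y => y ∈ g x) hg (fun v : Fin 4 → ℕ => v 0) (fun v => v 3)
    refine SN.congr (R := fun v : Fin 2 → ℕ => ∃ x y, x ∈ f (v 0) ∧ y ∈ g (v 0) ∧ v 1 = Nat.pair x y) ?_ fun v => ?_
    · refine sn_ex (m := 2) _ (hf := sn_ex (m := 3) _ (hf := ?_))
      exact sn_and _ _ (hf := h1) (hg := sn_and _ _ (hf := h2) (hg := by infer_instance))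
    · simp [Seq.seq, eq_comm]
  | @comp f g _ _ hf hg =>
    have h1 := sn_comp2 (R := fun x y => y ∈ g x) hg (fun v : Fin 3 → ℕ => v 0) (fun v => v 2)
    have h2 := sn_comp2 (R := fun x y => y ∈ f x) hf (fun v : Fin 3 → ℕ => v 2) (fun v => v 1)
    refine SN.congr (R := fun v : Fin 2 → ℕ => ∃ x, x ∈ g (v 0) ∧ v 1 ∈ f x) ?_ fun v => ?_
    · exact sn_ex (m := 2) _ (hf := sn_and _ _ (hf := h1) (hg := h2))
    · exact Part.mem_bind_iff
  | @prec f g _ _ hf hg =>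
    have h1 := sn_comp2 (R := fun x y => y ∈ f x) hf (fun v : Fin 7 → ℕ => v 2) (fun v => v 6)
    have h2 := sn_comp2 (R := fun x y => y ∈ g x) hg (fun v : Fin 10 → ℕ => Nat.pair (v 2) (Nat.pair (v 7) (v 8))) (fun v => v 9)
    refine SN.congr (R := fun v : Fin 2 → ℕ => ∃ a n, v 0 = Nat.pair a n ∧ ∃ c d x, Rm c d 0 x ∧ x ∈ f a ∧ Rm c d n (v 1) ∧
        ∀ y, y < n → ∃ u w, Rm c d y u ∧ Rm c d (y + 1) w ∧ w ∈ g (Nat.pair a (Nat.pair y u))) ?_ fun v => ?_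
    · refine sn_ex (m := 2) _ (hf := sn_ex (m := 3) _ (hf := sn_and (m := 4) _ _ (hf := by infer_instance)
        (hg := sn_ex (m := 4) _ (hf := sn_ex (m := 5) _ (hf := sn_ex (m := 6) _ (hf := sn_and _ _ (hf := by infer_instance) (hg := sn_and _ _ (hf := h1)
          (hg := sn_and _ _ (hf := by infer_instance) (hg := sn_ball (m := 7) (fun v => v 3) _ (hf := ?_))))))))))
      exact sn_ex (m := 8) _ (hf := sn_ex (m := 9) _ (hf := sn_and _ _ (hf := by infer_instance) (hg := sn_and _ _ (hf := by infer_instance) (hg := h2))))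
    · show v 1 ∈ Nat.unpaired _ _ ↔ _
      unfold Nat.unpaired
      have := prec_iff f g (v 0).unpair.1 (v 0).unpair.2 (v 1)
      constructor
      · intro h; exact ⟨_, _, (Nat.pair_unpair _).symm, this.1 h⟩
      · rintro ⟨a, n, e, h⟩
        rw [e, Nat.unpair_pair] at this ⊢
        exact this.2 h
  | @rfind f _ hf =>
    have h1 := sn_comp2 (R := fun x y => y ∈ f x) hf (fun v : Fin 2 → ℕ => Nat.pair (v 0) (v 1)) (fun _ => 0)
    have h2 := sn_comp2 (R := fun x y => y ∈ f x) hf (fun v : Fin 4 → ℕ => Nat.pair (v 0) (v 2)) (fun v => v 3)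
    refine SN.congr (R := fun v : Fin 2 → ℕ => 0 ∈ f (Nat.pair (v 0) (v 1)) ∧
      ∀ y, y < v 1 → ∃ u, u ∈ f (Nat.pair (v 0) y) ∧ ¬ u = 0) ?_ fun v => ?_
    · exact sn_and _ _ (hf := h1) (hg := sn_ball (m := 2) (fun v => v 1) _ (hf := sn_ex (m := 3) _ (hf := sn_and _ _ (hf := h2) (hg := by infer_instance))))
    · exact Nat.mem_rfind.trans (by simp)

theorem sn_computable {p : ℕ → Prop} (h : ComputablePred p) : SN (m := 1) (fun v => p (v 0)) := by
  have := partrec_sn (Partrec.nat_iff.1 ((h.to_re).map (Computable.const 0).to₂))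
  refine (sn_comp2 (m := 1) (R := fun x y => y ∈ Part.map (fun _ => 0) (Part.assert (p x) fun _ => Part.some ())) this (fun v => v 0) (fun _ => 0)).congr fun v => ?_
  simp

theorem sn_primrec1 {F : ℕ → ℕ} (h : Primrec F) : SN (m := 2) (fun v => v 1 = F (v 0)) :=
  (partrec_sn (Nat.Partrec.of_primrec (Primrec.nat_iff.1 h))).congr fun v => by simp
theorem sn_primrec2 {F : ℕ → ℕ → ℕ} (h : Primrec₂ F) : SN (m := 3) (fun v => v 2 = F (v 0) (v 1)) := by
  have := sn_primrec1 (F := fun p => F p.unpair.1 p.unpair.2) (by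
    exact h.comp (Primrec.fst.comp Primrec.unpair) (Primrec.snd.comp Primrec.unpair))
  refine (sn_comp2 (m := 3) (R := fun x y => y = F x.unpair.1 x.unpair.2) this (fun v => Nat.pair (v 0) (v 1)) (fun v => v 2)).congr fun v => ?_
  simp
end


/-- list decoded from a natural number -/
def dl (n : ℕ) : List ℕ := Denumerable.ofNat (List ℕ) n
/-- code of a list -/
def el (l : List ℕ) : ℕ := Encodable.encode l
/-- cons on codes -/
def lc (x l : ℕ) : ℕ := Nat.pair x l + 1
/-- append on codes -/
def app (a b : ℕ) : ℕ := el (dl a ++ dl b)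
/-- snoc on codes -/
def lsn (a x : ℕ) : ℕ := el (dl a ++ [x])
/-- element of a coded list -/
def lget (a i : ℕ) : ℕ := (dl a).getD i 0
/-- length of a coded list -/
def llen (a : ℕ) : ℕ := (dl a).length

@[simp] theorem dl_el (l : List ℕ) : dl (el l) = l := Denumerable.ofNat_encode l
@[simp] theorem el_dl (n : ℕ) : el (dl n) = n := Denumerable.encode_ofNat n
@[simp] theorem dl_zero : dl 0 = [] := Denumerable.list_ofNat_zero
theorem el_cons (x : ℕ) (l : List ℕ) : el (x :: l) = lc x (el l) := rfl
@[simp] theorem dl_lc (x l : ℕ) : dl (lc x l) = x :: dl l := by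
  rw [← dl_el (x :: dl l), el_cons, el_dl]
@[simp] theorem dl_app (a b : ℕ) : dl (app a b) = dl a ++ dl b := dl_el _
@[simp] theorem dl_lsn (a b : ℕ) : dl (lsn a b) = dl a ++ [b] := dl_el _
@[simp] theorem llen_zero : llen 0 = 0 := by simp [llen]
@[simp] theorem llen_lsn (a x : ℕ) : llen (lsn a x) = llen a + 1 := by simp [llen]
theorem dl_inj {a b : ℕ} (h : dl a = dl b) : a = b := by rw [← el_dl a, h, el_dl]

theorem lget_lsn_lt {a x i : ℕ} (h : i < llen a) : lget (lsn a x) i = lget a i := by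
  unfold lget; unfold llen at h
  rw [dl_lsn, List.getD_append _ _ _ _ h]
theorem lget_lsn_last (a x : ℕ) : lget (lsn a x) (llen a) = x := by
  unfold lget llen
  rw [dl_lsn, List.getD_append_right _ _ _ _ le_rfl]; simp
theorem mem_dl_lt : ∀ (l : List ℕ) (x : ℕ), x ∈ l → x < el l
  | [], x, h => by simp at h
  | y :: l, x, h => by
    rw [el_cons]
    unfold lc
    rcases List.mem_cons.1 h with rfl | h
    · exact Nat.lt_succ_of_le (Nat.left_le_pair _ _)
    · exact (mem_dl_lt l x h).trans_le ((Nat.right_le_pair _ _).trans (Nat.le_succ _))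
theorem lget_le (a i : ℕ) : lget a i ≤ a := by
  unfold lget
  by_cases h : i < (dl a).length
  · rw [List.getD_eq_getElem _ _ h]
    have := mem_dl_lt (dl a) _ (List.getElem_mem h)
    rw [el_dl] at this
    exact this.le
  · rw [List.getD_eq_default _ _ (by omega)]; omega

section
variable {m : ℕ}
theorem pr_dl : Primrec dl := Primrec.ofNat (List ℕ)
theorem pr_el : Primrec el := Primrec.encode
instance sf_lc (f g : (Fin m → ℕ) → ℕ) [SF f] [SF g] : SF (fun v => lc (f v) (g v)) := by
  unfold lc; infer_instance
instance sf_app (f g : (Fin m → ℕ) → ℕ) [SF f] [SF g] : SF (fun v => app (f v) (g v)) := by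
  refine sf_comp2 (F := app) (sn_primrec2 ?_) f g
  exact pr_el.comp (Primrec.list_append.comp (pr_dl.comp Primrec.fst) (pr_dl.comp Primrec.snd))
instance sf_lsn (f g : (Fin m → ℕ) → ℕ) [SF f] [SF g] : SF (fun v => lsn (f v) (g v)) := by
  refine sf_comp2 (F := lsn) (sn_primrec2 ?_) f g
  exact pr_el.comp (Primrec.list_concat.comp (pr_dl.comp Primrec.fst) (Primrec.snd))
instance sf_lget (f g : (Fin m → ℕ) → ℕ) [SF f] [SF g] : SF (fun v => lget (f v) (g v)) := by
  refine sf_comp2 (F := lget) (sn_primrec2 ?_) f g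
  exact (Primrec.list_getD 0).comp (pr_dl.comp Primrec.fst) Primrec.snd
instance sf_llen (f : (Fin m → ℕ) → ℕ) [SF f] : SF (fun v => llen (f v)) :=
  sf_comp1 (F := llen) (sn_primrec1 (Primrec.list_length.comp pr_dl)) f
/-- power of two -/
def tw (n : ℕ) : ℕ := 2 ^ n
theorem pr_tw : Primrec tw := by
  refine (Primrec.nat_rec₁ (f := fun _ x => x * 2) 1 (Primrec.nat_mul.comp Primrec.snd (Primrec.const 2))).of_eq fun n => ?_
  unfold tw
  induction n with
  | zero => rfl
  | succ n ih => rw [pow_succ, ← ih]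
/-- bit extraction -/
def tb (c n : ℕ) : ℕ := c / tw n % 2
instance sf_tw (f : (Fin m → ℕ) → ℕ) [SF f] : SF (fun v => tw (f v)) :=
  sf_comp1 (F := tw) (sn_primrec1 pr_tw) f
instance sf_tb (f g : (Fin m → ℕ) → ℕ) [SF f] [SF g] : SF (fun v => tb (f v) (g v)) := by
  refine sf_comp2 (F := tb) (sn_primrec2 ?_) f g
  exact Primrec.nat_mod.comp (Primrec.nat_div.comp Primrec.fst (pr_tw.comp Primrec.snd)) (Primrec.const 2)
end

theorem tb_exists (v : ℕ → Prop) (N : ℕ) : ∃ c < tw N, ∀ n < N, (v n → tb c n = 1) ∧ (¬ v n → tb c n = 0) := by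
  classical
  let f : Fin N → Bool := fun i => decide (v i)
  refine ⟨Nat.ofBits f, Nat.ofBits_lt_two_pow f, fun n hn => ?_⟩
  have h := Nat.testBit_ofBits_lt f n hn
  have e : (Nat.ofBits f).testBit n = decide (tb (Nat.ofBits f) n = 1) := by
    rw [Nat.testBit_eq_decide_div_mod_eq]; rfl
  rw [e] at h
  have h' : (tb (Nat.ofBits f) n = 1) ↔ v n := by simpa [f] using h
  have : tb (Nat.ofBits f) n < 2 := Nat.mod_lt _ (by norm_num)
  exact ⟨fun h => h'.2 h, fun h => by have := mt h'.1 h; omega⟩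

/-- code of a token -/
def tok (k : ℕ) : ℕ := 2 * (2 * k + 1) + 1

theorem dl_enc {α : Type} [Encodable α] : ∀ l : List α, dl (Encodable.encode l) = l.map Encodable.encode
  | [] => dl_zero
  | a :: l => by
    rw [Encodable.encode_list_cons]
    exact (dl_lc _ _).trans (by rw [dl_enc l]; rfl)
theorem enc_append {α : Type} [Encodable α] (l k : List α) :
    Encodable.encode (l ++ k) = app (Encodable.encode l) (Encodable.encode k) :=
  dl_inj (by simp [dl_enc])
theorem enc_cons {α : Type} [Encodable α] (a : α) (l : List α) :
    Encodable.encode (a :: l) = lc (Encodable.encode a) (Encodable.encode l) := rfl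
theorem enc_nil {α : Type} [Encodable α] :
    Encodable.encode ([] : List α) = 0 := rfl

/-- code of a term -/
def tc {n : ℕ} (t : LA.Term (Empty ⊕ Fin n)) : ℕ := Encodable.encode t.listEncode
theorem encode_term {n : ℕ} (t : LA.Term (Empty ⊕ Fin n)) : Encodable.encode t = tc t := rfl
/-- code of a formula -/
def fc {n : ℕ} (φ : LA.BoundedFormula Empty n) : ℕ := Encodable.encode φ.listEncode
theorem gnum_fc (φ : Snt) : gnum φ = fc φ := rfl

theorem tc_inj {n : ℕ} {t u : LA.Term (Empty ⊕ Fin n)} (h : tc t = tc u) : t = u :=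
  Term.listEncode_injective (Encodable.encode_injective h)
theorem fc_inj {n k : ℕ} {φ : LA.BoundedFormula Empty n} {ψ : LA.BoundedFormula Empty k} (h : fc φ = fc ψ) :
    (⟨n, φ⟩ : Σ n, LA.BoundedFormula Empty n) = ⟨k, ψ⟩ := by
  have : BoundedFormula.encoding.encode (⟨n, φ⟩ : Σ n, LA.BoundedFormula Empty n) = BoundedFormula.encoding.encode ⟨k, ψ⟩ :=
    Encodable.encode_injective h
  exact BoundedFormula.encoding.encode_injective this
theorem fc_inj' {n : ℕ} {φ ψ : LA.BoundedFormula Empty n} (h : fc φ = fc ψ) : φ = ψ := by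
  have := fc_inj h
  simpa using this

/-- code of function symbol -/
def fz : ℕ := 2 * Nat.pair 0 (Encodable.encode (show LA.Functions 0 from Unit.unit)) + 1
/-- code of function symbol -/
def fs : ℕ := 2 * Nat.pair 1 (Encodable.encode (show LA.Functions 1 from Unit.unit)) + 1
/-- code of function symbol -/
def fa : ℕ := 2 * Nat.pair 2 (Encodable.encode (show LA.Functions 2 from false)) + 1
/-- code of function symbol -/
def fm : ℕ := 2 * Nat.pair 2 (Encodable.encode (show LA.Functions 2 from true)) + 1
/-- code of relation symbol -/
def rle : ℕ := 2 * (2 * Nat.pair 2 (Encodable.encode (show LA.Relations 2 from Unit.unit))) + 1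

section
variable {n : ℕ}
theorem tc_var (i : Fin n) : tc (Term.var (L := LA) (α := Empty ⊕ Fin n) (Sum.inr i)) = lc (2 * (2 * i + 1)) 0 := by
  unfold tc
  rw [Term.listEncode, enc_cons, enc_nil, Encodable.encode_inl, Encodable.encode_inr]; rfl
theorem tc_zero : tc (zeroT : LA.Term (Empty ⊕ Fin n)) = lc fz 0 := by
  unfold tc zeroT
  rw [Constants.term, Term.listEncode, enc_cons]; rfl
theorem tc_succ (t : LA.Term (Empty ⊕ Fin n)) : tc (succT t) = lc fs (tc t) := by
  unfold tc succT
  rw [Functions.apply₁, Term.listEncode, enc_cons]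
  simp [List.finRange_succ, -Encodable.encode_sigma_val]; rfl
theorem tc_add (t u : LA.Term (Empty ⊕ Fin n)) : tc (addT t u) = lc fa (app (tc t) (tc u)) := by
  unfold tc addT
  rw [Functions.apply₂, Term.listEncode, enc_cons]
  simp [List.finRange_succ, enc_append, -Encodable.encode_sigma_val]; rfl
theorem tc_mul (t u : LA.Term (Empty ⊕ Fin n)) : tc (mulT t u) = lc fm (app (tc t) (tc u)) := by
  unfold tc mulT
  rw [Functions.apply₂, Term.listEncode, enc_cons]
  simp [List.finRange_succ, enc_append, -Encodable.encode_sigma_val]; rfl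
theorem fc_fal : fc (⊥ : LA.BoundedFormula Empty n) = lc (tok (n + 2)) 0 := rfl
theorem fc_eq (t u : LA.Term (Empty ⊕ Fin n)) :
    fc (t =' u) = lc (2 * Nat.pair n (tc t)) (lc (2 * Nat.pair n (tc u)) 0) := rfl
theorem fc_le (t u : LA.Term (Empty ⊕ Fin n)) :
    fc (leF t u) = lc rle (lc (tok n) (lc (2 * Nat.pair n (tc t)) (lc (2 * Nat.pair n (tc u)) 0))) := by
  unfold fc leF
  rw [Relations.boundedFormula₂, Relations.boundedFormula, BoundedFormula.listEncode]
  simp [List.finRange_succ, -Encodable.encode_sigma_val]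
  rfl
theorem fc_imp (φ ψ : LA.BoundedFormula Empty n) : fc (φ ⟹ ψ) = lc (tok 0) (app (fc φ) (fc ψ)) := by
  unfold fc
  rw [BoundedFormula.listEncode, List.cons_append, enc_cons, enc_append]; rfl
theorem fc_all (φ : LA.BoundedFormula Empty (n + 1)) : fc (∀' φ) = lc (tok 1) (fc φ) := rfl
end


/-- domain constructor -/
def dz : ℕ := Nat.pair 0 0
/-- domain constructor -/
def ds (x : ℕ) : ℕ := Nat.pair 1 x
/-- domain constructor -/
def da (x y : ℕ) : ℕ := Nat.pair 2 (Nat.pair x y)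
/-- domain constructor -/
def dm (x y : ℕ) : ℕ := Nat.pair 3 (Nat.pair x y)
/-- Henkin constant -/
def dh (x y : ℕ) : ℕ := Nat.pair 4 (Nat.pair x y)
/-- atom: truth -/
def aV (l a : ℕ) : ℕ := Nat.pair 0 (Nat.pair l a)
/-- atom: well-formedness -/
def aW (l a : ℕ) : ℕ := Nat.pair 1 (Nat.pair l a)
/-- atom: term evaluation -/
def aT (t a x : ℕ) : ℕ := Nat.pair 2 (Nat.pair (Nat.pair t a) x)
/-- atom: equality -/
def aE (l a : ℕ) : ℕ := Nat.pair 3 (Nat.pair l a)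
/-- atom: order -/
def aL (l a : ℕ) : ℕ := Nat.pair 4 (Nat.pair l a)
/-- code of falsum -/
def cF (n : ℕ) : ℕ := lc (tok (n + 2)) 0
/-- code of equation -/
def cE (n t u : ℕ) : ℕ := lc (2 * Nat.pair n t) (lc (2 * Nat.pair n u) 0)
/-- code of inequality -/
def cL (n t u : ℕ) : ℕ := lc rle (lc (tok n) (lc (2 * Nat.pair n t) (lc (2 * Nat.pair n u) 0)))
/-- code of implication -/
def cI (l k : ℕ) : ℕ := lc (tok 0) (app l k)
/-- code of universal formula -/
def cA (l : ℕ) : ℕ := lc (tok 1) l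

/-- the Henkin clauses -/
def Cl (A : ℕ → Prop) (θ tg : ℕ) : ℕ → ℕ → ℕ → Prop
  | 0, neg, pos => ∃ a i, i < llen a ∧ neg = 0 ∧ pos = lc (aT (lc (2 * (2 * i + 1)) 0) a (lget a i)) 0
  | 1, neg, pos => ∃ a, neg = 0 ∧ pos = lc (aT (lc fz 0) a dz) 0
  | 2, neg, pos => ∃ t a x, neg = lc (aT t a x) 0 ∧ pos = lc (aT (lc fs t) a (ds x)) 0
  | 3, neg, pos => ∃ t u a x y, neg = lc (aT t a x) (lc (aT u a y) 0) ∧ pos = lc (aT (lc fa (app t u)) a (da x y)) 0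
  | 4, neg, pos => ∃ t u a x y, neg = lc (aT t a x) (lc (aT u a y) 0) ∧ pos = lc (aT (lc fm (app t u)) a (dm x y)) 0
  | 5, neg, pos => ∃ a, neg = lc (aV (cF (llen a)) a) 0 ∧ pos = 0
  | 6, neg, pos => ∃ t u a x y, neg = lc (aT t a x) (lc (aT u a y) (lc (aV (cE (llen a) t u) a) 0)) ∧ pos = lc (aE x y) 0
  | 7, neg, pos => ∃ t u a x y, neg = lc (aT t a x) (lc (aT u a y) (lc (aE x y) 0)) ∧ pos = lc (aV (cE (llen a) t u) a) 0
  | 8, neg, pos => ∃ t u a x y, neg = lc (aT t a x) (lc (aT u a y) (lc (aV (cL (llen a) t u) a) 0)) ∧ pos = lc (aL x y) 0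
  | 9, neg, pos => ∃ t u a x y, neg = lc (aT t a x) (lc (aT u a y) (lc (aL x y) 0)) ∧ pos = lc (aV (cL (llen a) t u) a) 0
  | 10, neg, pos => ∃ l k a, neg = lc (aW l a) (lc (aW k a) (lc (aV (cI l k) a) (lc (aV l a) 0))) ∧ pos = lc (aV k a) 0
  | 11, neg, pos => ∃ l k a, neg = lc (aW l a) (lc (aW k a) 0) ∧ pos = lc (aV (cI l k) a) (lc (aV l a) 0)
  | 12, neg, pos => ∃ l k a, neg = lc (aW l a) (lc (aW k a) (lc (aV k a) 0)) ∧ pos = lc (aV (cI l k) a) 0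
  | 13, neg, pos => ∃ l a x, neg = lc (aW l (lsn a x)) (lc (aV (cA l) a) 0) ∧ pos = lc (aV l (lsn a x)) 0
  | 14, neg, pos => ∃ l a x, neg = lc (aW l (lsn a x)) (lc (aV l (lsn a (dh l a))) 0) ∧ pos = lc (aV (cA l) a) 0
  | 15, neg, pos => ∃ a, neg = 0 ∧ pos = lc (aW (cF (llen a)) a) 0
  | 16, neg, pos => ∃ t u a x y, neg = lc (aT t a x) (lc (aT u a y) 0) ∧ pos = lc (aW (cE (llen a) t u) a) 0
  | 17, neg, pos => ∃ t u a x y, neg = lc (aT t a x) (lc (aT u a y) 0) ∧ pos = lc (aW (cL (llen a) t u) a) 0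
  | 18, neg, pos => ∃ l k a, neg = lc (aW l a) (lc (aW k a) 0) ∧ pos = lc (aW (cI l k) a) 0
  | 19, neg, pos => ∃ l a x, neg = lc (aW l (lsn a x)) 0 ∧ pos = lc (aW (cA l) a) 0
  | 20, neg, pos => ∃ x, neg = 0 ∧ pos = lc (aE x x) 0
  | 21, neg, pos => ∃ x y z, neg = lc (aE x y) (lc (aE x z) 0) ∧ pos = lc (aE y z) 0
  | 22, neg, pos => ∃ x y, neg = lc (aE x y) 0 ∧ pos = lc (aE (ds x) (ds y)) 0
  | 23, neg, pos => ∃ x y z w, neg = lc (aE x y) (lc (aE z w) 0) ∧ pos = lc (aE (da x z) (da y w)) 0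
  | 24, neg, pos => ∃ x y z w, neg = lc (aE x y) (lc (aE z w) 0) ∧ pos = lc (aE (dm x z) (dm y w)) 0
  | 25, neg, pos => ∃ x y z w, neg = lc (aE x y) (lc (aE z w) (lc (aL x z) 0)) ∧ pos = lc (aL y w) 0
  | 26, neg, pos => ∃ l, A l ∧ neg = 0 ∧ pos = lc (aV l 0) 0
  | 27, neg, pos => neg = lc (aV θ tg) 0 ∧ pos = 0
  | _, _, _ => False

/-- satisfaction of all clauses -/
def Sats (A : ℕ → Prop) (θ tg : ℕ) (v : ℕ → Prop) : Prop :=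
  ∀ j neg pos, Cl A θ tg j neg pos → (∀ x ∈ dl neg, v x) → ∃ x ∈ dl pos, v x
/-- falsification of a clause by partial bits -/
def Fals (A : ℕ → Prop) (θ tg N c : ℕ) : Prop :=
  ∃ neg pos, (∃ j < 28, Cl A θ tg j neg pos) ∧ (∀ i < llen neg, lget neg i < N ∧ tb c (lget neg i) = 1) ∧
    (∀ i < llen pos, lget pos i < N ∧ tb c (lget pos i) = 0)

theorem all_dl (l : ℕ) (P : ℕ → Prop) : (∀ i < llen l, P (lget l i)) ↔ ∀ x ∈ dl l, P x := by
  unfold llen lget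
  rw [List.forall_mem_iff_getElem]
  refine forall_congr' fun i => ⟨fun h hi => ?_, fun h hi => ?_⟩
  · rw [← List.getD_eq_getElem _ 0 hi]; exact h hi
  · rw [List.getD_eq_getElem _ 0 hi]; exact h hi

theorem cl_lt {A θ tg j neg pos} (h : Cl A θ tg j neg pos) : j < 28 := by
  by_contra h2
  obtain ⟨k, rfl⟩ := Nat.exists_eq_add_of_le (not_lt.1 h2)
  rw [Nat.add_comm] at h
  exact h

theorem unsat_iff (A : ℕ → Prop) (θ tg : ℕ) :
    (¬ ∃ v, Sats A θ tg v) ↔ ∃ N, ∀ c, c < tw N → Fals A θ tg N c := by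
  constructor
  · intro h
    by_contra h2
    push Not at h2
    choose c hc hF using h2
    let U := Filter.hyperfilter ℕ
    refine h ⟨fun n => ∀ᶠ N in (U : Filter ℕ), tb (c N) n = 1, ?_⟩
    intro j neg pos hcl hneg
    by_contra hpos
    push Not at hpos
    have h1 : ∀ᶠ N in (U : Filter ℕ), ∀ x ∈ {x | x ∈ dl neg}, tb (c N) x = 1 :=
      (Filter.eventually_all_finite (List.finite_toSet _)).2 hneg
    have h2 : ∀ᶠ N in (U : Filter ℕ), ∀ x ∈ {x | x ∈ dl pos}, tb (c N) x = 0 :=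
      (Filter.eventually_all_finite (List.finite_toSet _)).2 fun x hx => by
        filter_upwards [hpos x hx] with N hN
        have : tb (c N) x < 2 := Nat.mod_lt _ (by norm_num)
        omega
    have h3 : ∀ l, ∀ᶠ N in (U : Filter ℕ), ∀ x ∈ {x | x ∈ dl l}, x < N := fun l =>
      (Filter.eventually_all_finite (List.finite_toSet _)).2 fun x hx => by
        have : ∀ᶠ N in Filter.cofinite, x < N := by
          rw [Nat.cofinite_eq_atTop]; exact Filter.eventually_gt_atTop x
        exact Filter.hyperfilter_le_cofinite this
    obtain ⟨N, ⟨h1, h2⟩, h3, h4⟩ := ((h1.and h2).and ((h3 neg).and (h3 pos))).exists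
    refine hF N ⟨neg, pos, ⟨j, cl_lt hcl, hcl⟩, ?_, ?_⟩
    · exact (all_dl neg (fun x => x < N ∧ tb (c N) x = 1)).2 fun x hx => ⟨h3 x hx, h1 x hx⟩
    · exact (all_dl pos (fun x => x < N ∧ tb (c N) x = 0)).2 fun x hx => ⟨h4 x hx, h2 x hx⟩
  · rintro ⟨N, hN⟩ ⟨v, hv⟩
    obtain ⟨c, hc, hb⟩ := tb_exists v N
    obtain ⟨neg, pos, ⟨j, _, hcl⟩, h1, h2⟩ := hN c hc
    have h1 := (all_dl neg (fun x => x < N ∧ tb c x = 1)).1 h1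
    have h2 := (all_dl pos (fun x => x < N ∧ tb c x = 0)).1 h2
    obtain ⟨x, hx, hvx⟩ := hv j neg pos hcl fun x hx => by
      by_contra hn
      have := (hb x (h1 x hx).1).2 hn
      have := (h1 x hx).2
      omega
    have := (hb x (h2 x hx).1).1 hvx
    have := (h2 x hx).2
    omega

section
variable {m : ℕ}
variable (f g h : (Fin m → ℕ) → ℕ) [SF f] [SF g] [SF h]
instance sf_ds : SF (fun v => ds (f v)) := by unfold ds; infer_instance
instance sf_da : SF (fun v => da (f v) (g v)) := by unfold da; infer_instance
instance sf_dm : SF (fun v => dm (f v) (g v)) := by unfold dm; infer_instance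
instance sf_dh : SF (fun v => dh (f v) (g v)) := by unfold dh; infer_instance
instance sf_aV : SF (fun v => aV (f v) (g v)) := by unfold aV; infer_instance
instance sf_aW : SF (fun v => aW (f v) (g v)) := by unfold aW; infer_instance
instance sf_aE : SF (fun v => aE (f v) (g v)) := by unfold aE; infer_instance
instance sf_aL : SF (fun v => aL (f v) (g v)) := by unfold aL; infer_instance
instance sf_aT : SF (fun v => aT (f v) (g v) (h v)) := by unfold aT; infer_instance
instance sf_tok : SF (fun v => tok (f v)) := by unfold tok; infer_instance
instance sf_cF : SF (fun v => cF (f v)) := by unfold cF; infer_instance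
instance sf_cE : SF (fun v => cE (f v) (g v) (h v)) := by unfold cE; infer_instance
instance sf_cL : SF (fun v => cL (f v) (g v) (h v)) := by unfold cL; infer_instance
instance sf_cI : SF (fun v => cI (f v) (g v)) := by unfold cI; infer_instance
instance sf_cA : SF (fun v => cA (f v)) := by unfold cA; infer_instance
end

theorem sn_bdd {m : ℕ} (R : ℕ → (Fin m → ℕ) → Prop) : ∀ J, (∀ j < J, SN (R j)) → SN (fun v => ∃ j < J, R j v)
  | 0, _ => (sn_const False).congr fun v => by simp
  | J + 1, h => by
    have h1 := sn_bdd R J fun j hj => h j (by omega)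
    have h2 := h J (by omega)
    refine (sn_or _ _ (hf := h1) (hg := h2)).congr fun v => ?_
    constructor
    · rintro ⟨j, hj, hR⟩
      rcases Nat.lt_succ_iff_lt_or_eq.1 hj with hj | rfl
      · exact Or.inl ⟨j, hj, hR⟩
      · exact Or.inr hR
    · rintro (⟨j, hj, hR⟩ | hR)
      · exact ⟨j, by omega, hR⟩
      · exact ⟨J, by omega, hR⟩

set_option maxHeartbeats 1000000 in
set_option synthInstance.maxHeartbeats 400000 in
set_option synthInstance.maxSize 2000 in
theorem sn_cl {A : ℕ → Prop} (hA : SN (m := 1) (fun v => A (v 0))) (θ : ℕ) :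
    ∀ j < 28, SN (m := 5) (fun v => Cl A θ (v 0) j (v 3) (v 4)) := by
  intro j hj
  have hA' := sn_comp1 (R := A) hA (fun v : Fin 6 → ℕ => v 5)
  by_cases hj6 : j = 26
  · subst hj6
    exact sn_ex (m := 5) _ (hf := sn_and _ _ (hf := hA') (hg := by infer_instance))
  interval_cases j
  all_goals first
    | exact absurd rfl hj6
    | (unfold Cl; infer_instance)

theorem sn_fals {A : ℕ → Prop} (hA : SN (m := 1) (fun v => A (v 0))) (θ : ℕ) :
    SN (m := 3) (fun v => Fals A θ (v 0) (v 1) (v 2)) := by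
  unfold Fals
  refine sn_ex (m := 3) _ (hf := sn_ex (m := 4) _ (hf := sn_and _ _ (hf := sn_bdd _ _ (sn_cl hA θ)) (hg := ?_)))
  infer_instance
theorem sn_unsat {A : ℕ → Prop} (hA : SN (m := 1) (fun v => A (v 0))) (θ : ℕ) :
    SN (m := 1) (fun v => ¬ ∃ w, Sats A θ (v 0) w) := by
  refine SN.congr (R := fun v : Fin 1 → ℕ => ∃ N, ∀ c, c < tw N → Fals A θ (v 0) N c) ?_ fun v => unsat_iff _ _ _
  exact sn_ex (m := 1) _ (hf := sn_ball (m := 2) (fun v => tw (v 1)) _ (hf := sn_fals hA θ))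


section
variable {n : ℕ}
theorem gF : cF n = fc (⊥ : LA.BoundedFormula Empty n) := rfl
theorem gE (t u : LA.Term (Empty ⊕ Fin n)) : cE n (tc t) (tc u) = fc (t =' u) := rfl
theorem gL (t u : LA.Term (Empty ⊕ Fin n)) : cL n (tc t) (tc u) = fc (leF t u) := (fc_le t u).symm
theorem gI (φ ψ : LA.BoundedFormula Empty n) : cI (fc φ) (fc ψ) = fc (φ ⟹ ψ) := (fc_imp φ ψ).symm
theorem gA (φ : LA.BoundedFormula Empty (n + 1)) : cA (fc φ) = fc (∀' φ) := rfl
end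

section Sound
variable {M : Mod}

theorem srec (G : ℕ → (ℕ → M) → M) : ∃ I : ℕ → M, ∀ n, I n = G n (fun k => if k < n then I k else 0) := by
  refine ⟨WellFounded.fix (C := fun _ => M) Nat.lt_wfRel.wf (fun n F => G n (fun k => if h : k < n then F k h else 0)), fun n => ?_⟩
  rw [WellFounded.fix_eq]
  congr 1

theorem wit_ex (M : Mod) : ∃ H : ℕ → ℕ → (ℕ → M) → M, ∀ (l a : ℕ) (e : ℕ → M) (φ : LA.BoundedFormula Empty (llen a + 1)),
    fc φ = l → φ.Realize default (Fin.snoc (fun i : Fin (llen a) => e i) (H l a e)) →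
      ∀ y, φ.Realize default (Fin.snoc (fun i : Fin (llen a) => e i) y) := by
  have : ∀ (l a : ℕ) (e : ℕ → M), ∃ w : M, ∀ (φ : LA.BoundedFormula Empty (llen a + 1)),
    fc φ = l → φ.Realize default (Fin.snoc (fun i : Fin (llen a) => e i) w) →
      ∀ y, φ.Realize default (Fin.snoc (fun i : Fin (llen a) => e i) y) := by
    intro l a e
    by_cases h : ∃ φ : LA.BoundedFormula Empty (llen a + 1), fc φ = l ∧ ∃ y, ¬ φ.Realize default (Fin.snoc (fun i : Fin (llen a) => e i) y)
    · obtain ⟨φ, h1, y, hy⟩ := h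
      refine ⟨y, fun ψ h2 h3 => ?_⟩
      rw [fc_inj' (h2.trans h1.symm)] at h3
      exact absurd h3 hy
    · push Not at h
      exact ⟨0, fun φ h1 _ => h φ h1⟩
  choose H hH using this
  exact ⟨H, hH⟩

theorem interp_ex (M : Mod) : ∃ I : ℕ → M, I dz = 0 ∧ (∀ x, I (ds x) = sc (I x)) ∧ (∀ x y, I (da x y) = I x + I y) ∧
    (∀ x y, I (dm x y) = I x * I y) ∧ ∀ (l a : ℕ) (φ : LA.BoundedFormula Empty (llen a + 1)),
    fc φ = l → φ.Realize default (Fin.snoc (fun i : Fin (llen a) => I (lget a i)) (I (dh l a))) →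
      ∀ y, φ.Realize default (Fin.snoc (fun i : Fin (llen a) => I (lget a i)) y) := by
  obtain ⟨H, hH⟩ := wit_ex M
  obtain ⟨I, hI⟩ := srec (M := M) (fun n f => if n.unpair.1 = 1 then sc (f n.unpair.2) else
    if n.unpair.1 = 2 then f n.unpair.2.unpair.1 + f n.unpair.2.unpair.2 else
    if n.unpair.1 = 3 then f n.unpair.2.unpair.1 * f n.unpair.2.unpair.2 else
    if n.unpair.1 = 4 then H n.unpair.2.unpair.1 n.unpair.2.unpair.2 (fun i => f (lget n.unpair.2.unpair.2 i)) else 0)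
  have lt1 : ∀ k x, x < Nat.pair (k + 1) x := fun k x => by
    have := Nat.add_le_pair (k + 1) x; omega
  have lt2 : ∀ k x y, x < Nat.pair (k + 1) (Nat.pair x y) := fun k x y =>
    (Nat.left_le_pair x y).trans_lt (lt1 k _)
  have lt3 : ∀ k x y, y < Nat.pair (k + 1) (Nat.pair x y) := fun k x y =>
    (Nat.right_le_pair x y).trans_lt (lt1 k _)
  refine ⟨I, ?_, fun x => ?_, fun x y => ?_, fun x y => ?_, fun l a φ h1 h2 => ?_⟩
  · rw [hI, dz]; simp
  · rw [hI, ds]; simp [lt1 0 x]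
  · rw [hI, da]; simp [lt2 1 x y, lt3 1 x y]
  · rw [hI, dm]; simp [lt2 2 x y, lt3 2 x y]
  · have e : I (dh l a) = H l a (fun i => I (lget a i)) := by
      have : ∀ i, lget a i < Nat.pair 4 (Nat.pair l a) := fun i => (lget_le a i).trans_lt (lt3 3 l a)
      rw [hI, dh]; simp [this]
    rw [e] at h2
    exact hH l a _ φ h1 h2

variable (I : ℕ → M)
/-- semantic truth -/
def VV (l a : ℕ) : Prop := ∃ (n : ℕ) (φ : LA.BoundedFormula Empty n), n = llen a ∧ fc φ = l ∧ φ.Realize default (fun i : Fin n => I (lget a i))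
/-- semantic well-formedness -/
def WW (l a : ℕ) : Prop := ∃ (n : ℕ) (φ : LA.BoundedFormula Empty n), n = llen a ∧ fc φ = l
/-- semantic evaluation -/
def TT (t a x : ℕ) : Prop := ∃ (n : ℕ) (τ : LA.Term (Empty ⊕ Fin n)), n = llen a ∧ tc τ = t ∧
  τ.realize (Sum.elim default (fun i : Fin n => I (lget a i))) = I x
/-- the semantic assignment -/
def asg (c : ℕ) : Prop :=
  match c.unpair.1 with
  | 0 => VV I c.unpair.2.unpair.1 c.unpair.2.unpair.2
  | 1 => WW c.unpair.2.unpair.1 c.unpair.2.unpair.2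
  | 2 => TT I c.unpair.2.unpair.1.unpair.1 c.unpair.2.unpair.1.unpair.2 c.unpair.2.unpair.2
  | 3 => I c.unpair.2.unpair.1 = I c.unpair.2.unpair.2
  | 4 => I c.unpair.2.unpair.1 ≤ I c.unpair.2.unpair.2
  | _ => False
@[simp] theorem asg_V (l a : ℕ) : asg I (aV l a) ↔ VV I l a := by simp [asg, aV]
@[simp] theorem asg_W (l a : ℕ) : asg I (aW l a) ↔ WW l a := by simp [asg, aW]
@[simp] theorem asg_T (l a x : ℕ) : asg I (aT l a x) ↔ TT I l a x := by simp [asg, aT]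
@[simp] theorem asg_E (l a : ℕ) : asg I (aE l a) ↔ I l = I a := by simp [asg, aE]
@[simp] theorem asg_L (l a : ℕ) : asg I (aL l a) ↔ I l ≤ I a := by simp [asg, aL]

theorem VV_iff {n a l : ℕ} (hn : n = llen a) (φ : LA.BoundedFormula Empty n) (hl : l = fc φ) :
    VV I l a ↔ φ.Realize default (fun i : Fin n => I (lget a i)) := by
  subst hl
  constructor
  · rintro ⟨k, ψ, rfl, h1, h2⟩
    subst hn
    rwa [← fc_inj' h1]
  · intro h; exact ⟨n, φ, hn, rfl, h⟩

theorem env_lsn (a x : ℕ) : (fun i : Fin (llen a + 1) => I (lget (lsn a x) i)) =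
    Fin.snoc (fun i : Fin (llen a) => I (lget a i)) (I x) := by
  funext i
  refine Fin.lastCases ?_ (fun i => ?_) i
  · simp [lget_lsn_last]
  · simp [lget_lsn_lt]

theorem sound {X : Thy} {A : ℕ → Prop} (hA : ∀ l, A l ↔ ∃ φ ∈ X, gnum φ = l) (hM : (M : Type) ⊨ X)
    {r : ℕ} (Θ : LA.BoundedFormula Empty r) (tg : ℕ) (hr : r = llen tg)
    (hI : I dz = 0 ∧ (∀ x, I (ds x) = sc (I x)) ∧ (∀ x y, I (da x y) = I x + I y) ∧
    (∀ x y, I (dm x y) = I x * I y) ∧ ∀ (l a : ℕ) (φ : LA.BoundedFormula Empty (llen a + 1)),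
    fc φ = l → φ.Realize default (Fin.snoc (fun i : Fin (llen a) => I (lget a i)) (I (dh l a))) →
      ∀ y, φ.Realize default (Fin.snoc (fun i : Fin (llen a) => I (lget a i)) y))
    (hΘ : ¬ Θ.Realize default (fun i : Fin r => I (lget tg i))) : Sats A (fc Θ) tg (asg I) := by
  obtain ⟨hz, hs, ha, hm, hh⟩ := hI
  intro j neg pos hcl
  have hj := cl_lt hcl
  interval_cases j
  · obtain ⟨a, i, hi, rfl, rfl⟩ := hcl
    simp
    exact ⟨_, vT ⟨i, hi⟩, rfl, tc_var _, rfl⟩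
  · obtain ⟨a, rfl, rfl⟩ := hcl
    simp
    exact ⟨_, zeroT, rfl, tc_zero, by simp [hz]⟩
  · obtain ⟨t, a, x, rfl, rfl⟩ := hcl
    simp
    rintro ⟨_, τ, rfl, rfl, h⟩
    exact ⟨_, succT τ, rfl, tc_succ _, by simp [h, hs]⟩
  · obtain ⟨t, u, a, x, y, rfl, rfl⟩ := hcl
    simp
    rintro ⟨_, τ, rfl, rfl, h⟩ ⟨_, υ, rfl, rfl, h'⟩
    exact ⟨_, addT τ υ, rfl, tc_add _ _, by simp [h, h', ha]⟩
  · obtain ⟨t, u, a, x, y, rfl, rfl⟩ := hcl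
    simp
    rintro ⟨_, τ, rfl, rfl, h⟩ ⟨_, υ, rfl, rfl, h'⟩
    exact ⟨_, mulT τ υ, rfl, tc_mul _ _, by simp [h, h', hm]⟩
  · obtain ⟨a, rfl, rfl⟩ := hcl
    simp
    rw [VV_iff I rfl ⊥ gF]
    simp
  · obtain ⟨t, u, a, x, y, rfl, rfl⟩ := hcl
    simp
    rintro ⟨_, τ, rfl, rfl, h⟩ ⟨_, υ, rfl, rfl, h'⟩
    rw [VV_iff I rfl (τ =' υ) (gE _ _)]
    simp [h, h']
  · obtain ⟨t, u, a, x, y, rfl, rfl⟩ := hcl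
    simp
    rintro ⟨_, τ, rfl, rfl, h⟩ ⟨_, υ, rfl, rfl, h'⟩
    rw [VV_iff I rfl (τ =' υ) (gE _ _)]
    simp [h, h']
  · obtain ⟨t, u, a, x, y, rfl, rfl⟩ := hcl
    simp
    rintro ⟨_, τ, rfl, rfl, h⟩ ⟨_, υ, rfl, rfl, h'⟩
    rw [VV_iff I rfl (leF τ υ) (gL _ _)]
    simp [h, h']
  · obtain ⟨t, u, a, x, y, rfl, rfl⟩ := hcl
    simp
    rintro ⟨_, τ, rfl, rfl, h⟩ ⟨_, υ, rfl, rfl, h'⟩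
    rw [VV_iff I rfl (leF τ υ) (gL _ _)]
    simp [h, h']
  · obtain ⟨l, k, a, rfl, rfl⟩ := hcl
    simp
    rintro ⟨_, φ, rfl, rfl⟩ ⟨_, ψ, rfl, rfl⟩
    rw [VV_iff I rfl (φ ⟹ ψ) (gI _ _), VV_iff I rfl φ rfl, VV_iff I rfl ψ rfl]
    simp
  · obtain ⟨l, k, a, rfl, rfl⟩ := hcl
    simp
    rintro ⟨_, φ, rfl, rfl⟩ ⟨_, ψ, rfl, rfl⟩
    rw [VV_iff I rfl (φ ⟹ ψ) (gI _ _), VV_iff I rfl φ rfl]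
    simp; tauto
  · obtain ⟨l, k, a, rfl, rfl⟩ := hcl
    simp
    rintro ⟨_, φ, rfl, rfl⟩ ⟨_, ψ, rfl, rfl⟩
    rw [VV_iff I rfl (φ ⟹ ψ) (gI _ _), VV_iff I rfl ψ rfl]
    simp; tauto
  · obtain ⟨l, a, x, rfl, rfl⟩ := hcl
    simp
    rintro ⟨n, φ, hn, rfl⟩
    rw [llen_lsn] at hn; subst hn
    rw [VV_iff I rfl (∀' φ) (gA _), VV_iff I (llen_lsn a x).symm φ rfl, env_lsn]
    simp only [BoundedFormula.realize_all]
    intro h; exact h _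
  · obtain ⟨l, a, x, rfl, rfl⟩ := hcl
    simp
    rintro ⟨n, φ, hn, rfl⟩
    rw [llen_lsn] at hn; subst hn
    rw [VV_iff I rfl (∀' φ) (gA _), VV_iff I (llen_lsn a _).symm φ rfl, env_lsn]
    exact fun h => hh _ _ _ rfl h
  · obtain ⟨a, rfl, rfl⟩ := hcl
    simp
    exact ⟨_, ⊥, rfl, gF.symm⟩
  · obtain ⟨t, u, a, x, y, rfl, rfl⟩ := hcl
    simp
    rintro ⟨_, τ, rfl, rfl, h⟩ ⟨_, υ, rfl, rfl, h'⟩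
    exact ⟨_, τ =' υ, rfl, (gE _ _).symm⟩
  · obtain ⟨t, u, a, x, y, rfl, rfl⟩ := hcl
    simp
    rintro ⟨_, τ, rfl, rfl, h⟩ ⟨_, υ, rfl, rfl, h'⟩
    exact ⟨_, leF τ υ, rfl, (gL _ _).symm⟩
  · obtain ⟨l, k, a, rfl, rfl⟩ := hcl
    simp
    rintro ⟨_, φ, rfl, rfl⟩ ⟨_, ψ, rfl, rfl⟩
    exact ⟨_, φ ⟹ ψ, rfl, (gI _ _).symm⟩
  · obtain ⟨l, a, x, rfl, rfl⟩ := hcl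
    simp
    rintro ⟨n, φ, hn, rfl⟩
    rw [llen_lsn] at hn; subst hn
    exact ⟨_, ∀' φ, rfl, (gA _).symm⟩
  · obtain ⟨x, rfl, rfl⟩ := hcl
    simp
  · obtain ⟨x, y, z, rfl, rfl⟩ := hcl
    simp
    intro h1 h2; rw [← h1, h2]
  · obtain ⟨x, y, rfl, rfl⟩ := hcl
    simp [hs]
    intro h; rw [h]
  · obtain ⟨x, y, z, w, rfl, rfl⟩ := hcl
    simp [ha]
    intro h h2; rw [h, h2]
  · obtain ⟨x, y, z, w, rfl, rfl⟩ := hcl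
    simp [hm]
    intro h h2; rw [h, h2]
  · obtain ⟨x, y, z, w, rfl, rfl⟩ := hcl
    simp
    intro h h2; rw [h, h2]; exact id
  · obtain ⟨l, hl, rfl, rfl⟩ := hcl
    obtain ⟨φ, hφ, rfl⟩ := (hA l).1 hl
    simp
    refine (VV_iff I llen_zero.symm φ (gnum_fc φ)).2 ?_
    have := hM.realize_of_mem φ hφ
    exact (rlz0 φ M _).2 this
  · obtain ⟨rfl, rfl⟩ := hcl
    simp
    rw [VV_iff I hr Θ rfl]
    exact hΘ
end Sound


section Complete
variable {A : ℕ → Prop} {θ tg : ℕ} {v : ℕ → Prop}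

/-- the equality setoid -/
def stE (hv : Sats A θ tg v) : Setoid ℕ where
  r x y := v (aE x y)
  iseqv := by
    have h1 : ∀ x, v (aE x x) := fun x => by simpa using hv 20 _ _ ⟨x, rfl, rfl⟩
    have h2 : ∀ x y z, v (aE x y) → v (aE x z) → v (aE y z) := fun x y z => by
      simpa using hv 21 _ _ ⟨x, y, z, rfl, rfl⟩
    exact ⟨h1, fun {x y} h => h2 x y x h (h1 x), fun {x y z} h h' => h2 y x z (h2 x y x h (h1 x)) h'⟩
/-- the term model -/
def Dn (hv : Sats A θ tg v) : Type := Quotient (stE hv)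
/-- class of an element -/
def qD (hv : Sats A θ tg v) (x : ℕ) : Dn hv := Quotient.mk (stE hv) x
/-- representative -/
noncomputable def oD (hv : Sats A θ tg v) (x : Dn hv) : ℕ := Quotient.out x
variable (hv : Sats A θ tg v)
theorem q_o (x : Dn hv) : qD hv (oD hv x) = x := Quotient.out_eq x
theorem q_iff (x y : ℕ) : qD hv x = qD hv y ↔ v (aE x y) := Quotient.eq (r := stE hv)
theorem o_q (x : ℕ) : v (aE (oD hv (qD hv x)) x) := (q_iff hv _ _).1 (q_o hv _)
theorem o_q' (x : ℕ) : v (aE x (oD hv (qD hv x))) := (q_iff hv _ _).1 (q_o hv _).symm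

noncomputable instance stD : LA.Structure (Dn hv) where
  funMap := fun {n} => match n with
    | 0 => fun _ _ => qD hv dz
    | 1 => fun _ a => qD hv (ds (oD hv (a 0)))
    | 2 => fun f a => match f with
      | false => qD hv (da (oD hv (a 0)) (oD hv (a 1)))
      | true => qD hv (dm (oD hv (a 0)) (oD hv (a 1)))
    | (_ + 3) => fun _ _ => qD hv dz
  RelMap := fun {n} => match n with
    | 2 => fun _ a => v (aL (oD hv (a 0)) (oD hv (a 1)))
    | _ => fun _ _ => False

theorem dn_s (x : ℕ) : qD hv (ds (oD hv (qD hv x))) = qD hv (ds x) := by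
  rw [q_iff]
  have := fun z0 z1 => hv 22 _ _ ⟨z0, z1, rfl, rfl⟩
  simp at this
  exact this _ _ (o_q hv x)
theorem dn_a (x y : ℕ) : qD hv (da (oD hv (qD hv x)) (oD hv (qD hv y))) = qD hv (da x y) := by
  rw [q_iff]
  have := fun z0 z1 z2 z3 => hv 23 _ _ ⟨z0, z1, z2, z3, rfl, rfl⟩
  simp at this
  exact this _ _ _ _ (o_q hv x) (o_q hv y)
theorem dn_m (x y : ℕ) : qD hv (dm (oD hv (qD hv x)) (oD hv (qD hv y))) = qD hv (dm x y) := by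
  rw [q_iff]
  have := fun z0 z1 z2 z3 => hv 24 _ _ ⟨z0, z1, z2, z3, rfl, rfl⟩
  simp at this
  exact this _ _ _ _ (o_q hv x) (o_q hv y)
theorem dn_l (x y : ℕ) : v (aL (oD hv (qD hv x)) (oD hv (qD hv y))) ↔ v (aL x y) := by
  have h := fun x y z w => hv 25 _ _ ⟨x, y, z, w, rfl, rfl⟩
  simp at h
  exact ⟨h _ _ _ _ (o_q hv x) (o_q hv y), h _ _ _ _ (o_q' hv x) (o_q' hv y)⟩

/-- environment in the term model -/
def eD (a n : ℕ) : Fin n → Dn hv := fun i => qD hv (lget a i)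

theorem ev_D {n a : ℕ} (hn : n = llen a) (t : LA.Term (Empty ⊕ Fin n)) :
    ∃ x, v (aT (tc t) a x) ∧ t.realize (Sum.elim default (eD hv a n)) = qD hv x := by
  subst hn
  induction t with
  | var x =>
    rcases x with x | x
    · exact x.elim
    · refine ⟨lget a x, ?_, rfl⟩
      have := hv 0 _ _ ⟨a, x, x.2, rfl, rfl⟩
      simp at this
      rwa [tc_var]
  | @func l f ts ih =>
    choose k h1 h2 using ih
    match l, f, ts, k, h1, h2 with
    | 0, f, ts, k, h1, h2 =>
      have e : (Term.func f ts : LA.Term (Empty ⊕ Fin (llen a))) = zeroT := by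
        show _ = Term.func _ _
        congr 1; exact Subsingleton.elim _ _
      rw [e, tc_zero]
      exact ⟨dz, by simpa using hv 1 _ _ ⟨a, rfl, rfl⟩, rfl⟩
    | 1, f, ts, k, h1, h2 =>
      have e : (Term.func f ts : LA.Term (Empty ⊕ Fin (llen a))) = succT (ts 0) := by
        show _ = Term.func _ _
        congr 1; funext i; fin_cases i; rfl
      rw [e, tc_succ]
      have := fun z0 z1 z2 => hv 2 _ _ ⟨z0, z1, z2, rfl, rfl⟩
      simp at this
      refine ⟨_, this _ _ _ (h1 0), ?_⟩
      rw [succT, Term.realize_functions_apply₁, h2]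
      exact dn_s hv _
    | 2, false, ts, k, h1, h2 =>
      have e : (Term.func (L := LA) (l := 2) false ts : LA.Term (Empty ⊕ Fin (llen a))) = addT (ts 0) (ts 1) := by
        show _ = Term.func _ _
        congr 1; funext i; fin_cases i <;> rfl
      rw [e, tc_add]
      have := fun z0 z1 z2 z3 z4 => hv 3 _ _ ⟨z0, z1, z2, z3, z4, rfl, rfl⟩
      simp at this
      refine ⟨_, this _ _ _ _ _ (h1 0) (h1 1), ?_⟩
      rw [addT, Term.realize_functions_apply₂, h2, h2]
      exact dn_a hv _ _
    | 2, true, ts, k, h1, h2 =>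
      have e : (Term.func (L := LA) (l := 2) true ts : LA.Term (Empty ⊕ Fin (llen a))) = mulT (ts 0) (ts 1) := by
        show _ = Term.func _ _
        congr 1; funext i; fin_cases i <;> rfl
      rw [e, tc_mul]
      have := fun z0 z1 z2 z3 z4 => hv 4 _ _ ⟨z0, z1, z2, z3, z4, rfl, rfl⟩
      simp at this
      refine ⟨_, this _ _ _ _ _ (h1 0) (h1 1), ?_⟩
      rw [mulT, Term.realize_functions_apply₂, h2, h2]
      exact dn_m hv _ _
    | (_ + 3), f, _, _, _, _ => exact Empty.elim f

theorem rel_cases {n l : ℕ} (R : LA.Relations l) (ts : Fin l → LA.Term (Empty ⊕ Fin n)) :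
    ∃ t u, (BoundedFormula.rel R ts : LA.BoundedFormula Empty n) = leF t u := by
  match l, R, ts with
  | 0, R, _ => exact Empty.elim R
  | 1, R, _ => exact Empty.elim R
  | 2, R, ts =>
    refine ⟨ts 0, ts 1, ?_⟩
    show _ = BoundedFormula.rel _ _
    congr 1; funext i; fin_cases i <;> rfl
  | (_ + 3), R, _ => exact Empty.elim R

theorem w_D (hv : Sats A θ tg v) {n : ℕ} (φ : LA.BoundedFormula Empty n) : ∀ a, n = llen a → v (aW (fc φ) a) := by
  induction φ with
  | falsum =>
    rintro a rfl
    have := hv 15 _ _ ⟨a, rfl, rfl⟩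
    simp at this
    exact this
  | equal t u =>
    rintro a rfl
    obtain ⟨x, hx, _⟩ := ev_D hv rfl t
    obtain ⟨y, hy, _⟩ := ev_D hv rfl u
    have := fun z0 z1 z2 z3 z4 => hv 16 _ _ ⟨z0, z1, z2, z3, z4, rfl, rfl⟩
    simp at this
    exact this _ _ _ _ _ hx hy
  | rel R ts =>
    rintro a rfl
    obtain ⟨t, u, e⟩ := rel_cases R ts
    rw [e]
    obtain ⟨x, hx, _⟩ := ev_D hv rfl t
    obtain ⟨y, hy, _⟩ := ev_D hv rfl u
    have := fun z0 z1 z2 z3 z4 => hv 17 _ _ ⟨z0, z1, z2, z3, z4, rfl, rfl⟩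
    simp at this
    rw [← gL]
    exact this _ _ _ _ _ hx hy
  | imp φ ψ ih1 ih2 =>
    rintro a rfl
    have := fun z0 z1 z2 => hv 18 _ _ ⟨z0, z1, z2, rfl, rfl⟩
    simp at this
    rw [← gI]
    exact this _ _ _ (ih1 a rfl) (ih2 a rfl)
  | all φ ih =>
    rintro a rfl
    have := hv 19 _ _ ⟨fc φ, a, 0, rfl, rfl⟩
    simp at this
    exact this (ih (lsn a 0) (by simp))

theorem eD_lsn (a x : ℕ) : eD hv (lsn a x) (llen a + 1) = Fin.snoc (eD hv a (llen a)) (qD hv x) := by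
  funext i
  refine Fin.lastCases ?_ (fun i => ?_) i
  · simp [eD, lget_lsn_last]
  · simp [eD, lget_lsn_lt]

theorem v_D {n : ℕ} (φ : LA.BoundedFormula Empty n) : ∀ a, n = llen a →
    (v (aV (fc φ) a) ↔ φ.Realize default (eD hv a n)) := by
  induction φ with
  | falsum =>
    rintro a rfl
    have := hv 5 _ _ ⟨a, rfl, rfl⟩
    simp at this
    exact ⟨fun h => this h, fun h => h.elim⟩
  | equal t u =>
    rintro a rfl
    obtain ⟨x, hx, ex⟩ := ev_D hv rfl t
    obtain ⟨y, hy, ey⟩ := ev_D hv rfl u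
    have h1 := fun z0 z1 z2 z3 z4 => hv 6 _ _ ⟨z0, z1, z2, z3, z4, rfl, rfl⟩
    have h2 := fun z0 z1 z2 z3 z4 => hv 7 _ _ ⟨z0, z1, z2, z3, z4, rfl, rfl⟩
    simp at h1 h2
    have e : (BoundedFormula.equal t u).Realize default (eD hv a (llen a)) ↔ v (aE x y) := by
      rw [← q_iff hv, ← ex, ← ey]; rfl
    rw [e]
    exact ⟨h1 _ _ _ _ _ hx hy, h2 _ _ _ _ _ hx hy⟩
  | rel R ts =>
    rintro a rfl
    obtain ⟨t, u, e⟩ := rel_cases R ts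
    rw [e]
    obtain ⟨x, hx, ex⟩ := ev_D hv rfl t
    obtain ⟨y, hy, ey⟩ := ev_D hv rfl u
    have h1 := fun z0 z1 z2 z3 z4 => hv 8 _ _ ⟨z0, z1, z2, z3, z4, rfl, rfl⟩
    have h2 := fun z0 z1 z2 z3 z4 => hv 9 _ _ ⟨z0, z1, z2, z3, z4, rfl, rfl⟩
    simp at h1 h2
    have e : (leF t u).Realize default (eD hv a (llen a)) ↔ v (aL x y) := by
      rw [← dn_l hv, ← ex, ← ey]
      exact BoundedFormula.realize_rel₂
    rw [e, ← gL]
    exact ⟨h1 _ _ _ _ _ hx hy, h2 _ _ _ _ _ hx hy⟩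
  | imp φ ψ ih1 ih2 =>
    rintro a rfl
    have w1 := w_D hv φ a rfl
    have w2 := w_D hv ψ a rfl
    have h1 := fun z0 z1 z2 => hv 10 _ _ ⟨z0, z1, z2, rfl, rfl⟩
    have h2 := fun z0 z1 z2 => hv 11 _ _ ⟨z0, z1, z2, rfl, rfl⟩
    have h3 := fun z0 z1 z2 => hv 12 _ _ ⟨z0, z1, z2, rfl, rfl⟩
    simp at h1 h2 h3
    have h1 := h1 _ _ _ w1 w2
    have h2 := h2 _ _ _ w1 w2
    have h3 := h3 _ _ _ w1 w2
    rw [BoundedFormula.realize_imp, ← ih1 a rfl, ← ih2 a rfl, ← gI]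
    tauto
  | all φ ih =>
    rintro a rfl
    have w1 := fun x => w_D hv φ (lsn a x) (by simp)
    have h1 := fun x => hv 13 _ _ ⟨fc φ, a, x, rfl, rfl⟩
    have h2 := hv 14 _ _ ⟨fc φ, a, 0, rfl, rfl⟩
    simp at h1 h2
    have ih' : ∀ x, v (aV (fc φ) (lsn a x)) ↔ φ.Realize default (Fin.snoc (eD hv a (llen a)) (qD hv x)) := by
      intro x; rw [ih (lsn a x) (by simp), eD_lsn]
    constructor
    · intro h
      rw [BoundedFormula.realize_all]
      intro y
      rw [← q_o hv y, ← ih']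
      exact h1 _ (w1 _) h
    · intro h
      exact h2 (w1 0) ((ih' _).2 (h _))

/-- numerals in the domain -/
def nm (k : ℕ) : ℕ := Nat.rec dz (fun _ x => ds x) k

/-- the term model as a model of PA -/
noncomputable def modD (hv : Sats A θ tg v) (hp : Dn hv ⊨ PAAx) : Mod := ⟨Dn hv, stD hv, hp⟩

theorem complete (hv : Sats A θ tg v) {X : Thy} (hX : ExtPA X) (hA : ∀ l, A l ↔ ∃ φ ∈ X, gnum φ = l) {r : ℕ} (Θ : LA.BoundedFormula Empty r)
    (hΘ : θ = fc Θ) (k : Fin r → ℕ) (htg : tg = el (List.ofFn fun i => nm (k i))) :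
    ∃ M : Mod, (M : Type) ⊨ X ∧ ¬ rlz Θ M (fun i => (k i : M)) := by
  have hne : Nonempty (Dn hv) := ⟨qD hv 0⟩
  have hm : Dn hv ⊨ X := by
    refine ⟨fun φ hφ => ?_⟩
    have := hv 26 _ _ ⟨gnum φ, (hA _).2 ⟨φ, hφ, rfl⟩, rfl, rfl⟩
    simp at this
    rw [gnum_fc, v_D hv φ 0 llen_zero.symm] at this
    have e : eD hv 0 0 = default := Subsingleton.elim _ _
    rw [e] at this
    exact this
  have hp : Dn hv ⊨ PAAx := ⟨fun φ hφ => (hX φ hφ).realize_sentence (Dn hv)⟩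
  refine ⟨modD hv hp, hm, fun h => ?_⟩
  have hr : r = llen tg := by rw [htg]; simp [llen]
  have := hv 27 _ _ ⟨rfl, rfl⟩
  simp at this
  refine this ?_
  rw [hΘ, v_D hv Θ tg hr]
  have e : ∀ j : ℕ, (Nat.cast j : modD hv hp) = qD hv (nm j) := by
    intro j
    induction j with
    | zero => rw [Nat.cast_zero]; rfl
    | succ j ih =>
      rw [Nat.cast_succ, ← sc_eq]
      show qD hv (ds (oD hv (Nat.cast j : modD hv hp))) = _
      rw [ih]; exact dn_s hv _
  have e2 : eD hv tg r = fun i => (Nat.cast (k i) : modD hv hp) := by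
    funext i
    have : lget tg i = nm (k i) := by
      rw [lget, htg, dl_el, List.getD_eq_getElem _ _ (by simp)]
      simp only [List.getElem_ofFn]
    rw [e, eD, this]
  rw [e2]
  exact h
end Complete

theorem pr_nm : Primrec nm := Primrec.nat_rec₁ (f := fun _ x => ds x) dz
  (Primrec₂.natPair.comp (Primrec.const 1) Primrec.snd)
instance sf_nm {m : ℕ} (f : (Fin m → ℕ) → ℕ) [SF f] : SF (fun v => nm (f v)) :=
  sf_comp1 (F := nm) (sn_primrec1 pr_nm) f

theorem sf_list {m : ℕ} : ∀ (r : ℕ) (f : Fin r → (Fin m → ℕ) → ℕ), (∀ i, SF (f i)) → SF (fun v => el (List.ofFn fun i => f i v))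
  | 0, _, _ => by simpa using sf_const _
  | r + 1, f, h => by
    have := sf_list r (fun i => f i.succ) fun i => h _
    have := h 0
    simp only [List.ofFn_succ, el_cons]
    infer_instance

/-- semantic consequence for instances of a relation -/
theorem re_cons {X : Thy} (hX : ExtPA X) (hc : CompThy X) {r : ℕ} (Θ : LA.BoundedFormula Empty r) :
    SN (fun k : Fin r → ℕ => ∀ M : Mod, (M : Type) ⊨ X → rlz Θ M (fun i => (k i : M))) := by
  have hA := sn_computable hc
  have h1 := sn_unsat (A := fun l => ∃ φ ∈ X, gnum φ = l) hA (fc Θ)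
  have h2 := sf_list (m := r) r (fun i k => nm (k i)) fun i => inferInstance
  refine (sn_comp1 (R := fun t => ¬ ∃ w, Sats _ (fc Θ) t w) h1 (fun k : Fin r → ℕ => el (List.ofFn fun i => nm (k i)))).congr fun k => ?_
  constructor
  · rintro h ⟨w, hw⟩
    obtain ⟨M, hM, hn⟩ := complete hw hX (fun l => Iff.rfl) Θ rfl k rfl
    exact hn (h M hM)
  · intro h M hM
    by_contra hn
    obtain ⟨I, hI⟩ := interp_ex M
    refine h ⟨asg I, sound I (fun l => Iff.rfl) hM Θ _ (by simp [llen]) hI ?_⟩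
    have e : ∀ j : ℕ, I (nm j) = (j : M) := by
      intro j
      induction j with
      | zero => rw [Nat.cast_zero]; exact hI.1
      | succ j ih =>
        rw [Nat.cast_succ, ← sc_eq, ← ih]; exact hI.2.1 _
    have e2 : (fun i : Fin r => I (lget (el (List.ofFn fun i => nm (k i))) i)) = fun i => (k i : M) := by
      funext i
      rw [← e, lget, dl_el, List.getD_eq_getElem _ _ (by simp)]
      simp only [List.getElem_ofFn]
    rw [e2]
    exact hn


/-- first-order definable relations, uniformly in all models -/
def FD {m : ℕ} (R : Rl m) : Prop := ∃ Θ : LA.BoundedFormula Empty m, ∀ M v, rlz Θ M v ↔ R M v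

theorem FD.sg {n m : ℕ} {R : Rl m} (h : Sg n R) : FD R := by
  obtain ⟨⟨φ, -, h2⟩, -⟩ := fml_sg h.ex
  exact ⟨φ, h2⟩
theorem FD.imp {m : ℕ} {R Q : Rl m} (h : FD R) (h' : FD Q) : FD (fun M v => R M v → Q M v) := by
  obtain ⟨φ, h⟩ := h
  obtain ⟨ψ, h'⟩ := h'
  exact ⟨φ ⟹ ψ, fun M v => by simp only [← h, ← h']; exact BoundedFormula.realize_imp⟩
theorem FD.not {m : ℕ} {R : Rl m} (h : FD R) : FD (fun M v => ¬ R M v) := by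
  obtain ⟨φ, h⟩ := h
  exact ⟨∼φ, fun M v => by simp only [← h]; exact BoundedFormula.realize_not⟩
theorem FD.and {m : ℕ} {R Q : Rl m} (h : FD R) (h' : FD Q) : FD (fun M v => R M v ∧ Q M v) := by
  obtain ⟨φ, h⟩ := h
  obtain ⟨ψ, h'⟩ := h'
  exact ⟨φ ⊓ ψ, fun M v => by simp only [← h, ← h']; exact BoundedFormula.realize_inf⟩

theorem kern {X : Thy} (hX : ExtPA X) (hc : CompThy X) {r : ℕ} {R : Rl r} (hR : FD R) :
    ∃ K : Rl (r + 1), D0 K ∧ ∀ k : Fin r → ℕ, (∀ M : Mod, (M : Type) ⊨ X → R M (fun i => (k i : M))) ↔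
      ∃ z : ℕ, K NN (fun i => ((Fin.snoc k z : Fin (r + 1) → ℕ) i : NN)) := by
  obtain ⟨Θ, hΘ⟩ := hR
  obtain ⟨R', ⟨⟨K, hK, hK2⟩⟩, h2⟩ := (re_cons hX hc Θ).ex
  have hK : D0 K := hK
  refine ⟨fun M v => ¬ K M v, inferInstance, fun k => ?_⟩
  simp only [← hΘ]
  rw [h2, hK2]
  constructor
  · rintro ⟨x, hx⟩
    obtain ⟨z, rfl⟩ := nn_surj x
    exact ⟨z, by rwa [← snoc_nat]⟩
  · rintro ⟨z, hz⟩
    exact ⟨z, by rwa [snoc_nat]⟩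

theorem kern2 {X : Thy} (hX : ExtPA X) (hc : CompThy X) {R : ∀ M : Mod, M → M → Prop}
    (hR : FD (m := 2) (fun M v => R M (v 0) (v 1))) :
    ∃ ρ : ∀ M : Mod, M → M → M → Prop,
      (∀ (m : ℕ) (f g h : Fn m) [UT f] [UT g] [UT h], D0 (fun M v => ρ M (f M v) (g M v) (h M v))) ∧
      (∀ a b : ℕ, (∀ M : Mod, (M : Type) ⊨ X → R M a b) ↔ ∃ z : ℕ, ρ NN a b z) ∧
      (∀ (M : Mod) (a b z : ℕ), ρ M a b z ↔ ρ NN a b z) := by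
  obtain ⟨K, hK, h⟩ := kern hX hc hR
  have e : ∀ (M : Mod) (a b z : ℕ), (![(a : M), b, z] : Fin 3 → M) = fun i => ((Fin.snoc ![a, b] z : Fin 3 → ℕ) i : M) := by
    intro M a b z; funext i; fin_cases i <;> rfl
  refine ⟨fun M a b z => K M ![a, b, z], ?_, ?_, ?_⟩
  · intro m f g h _ _ _
    refine (hK.sub ![f, g, h] ?_).congr fun M v => ?_
    · intro i; fin_cases i <;> assumption
    · have : (fun i => (![f, g, h] : Fin 3 → Fn m) i M v) = ![f M v, g M v, h M v] := by
        funext i; fin_cases i <;> rfl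
      rw [this]
  · intro a b
    have := h ![a, b]
    simp only [e]
    exact this
  · intro M a b z
    simp only [e]
    exact d0_abs hK M _

theorem kern4 {X : Thy} (hX : ExtPA X) (hc : CompThy X) {R : ∀ M : Mod, M → M → M → M → Prop}
    (hR : FD (m := 4) (fun M v => R M (v 0) (v 1) (v 2) (v 3))) :
    ∃ ρ : ∀ M : Mod, M → M → M → M → M → Prop,
      (∀ (m : ℕ) (f g h i j : Fn m) [UT f] [UT g] [UT h] [UT i] [UT j],
        D0 (fun M v => ρ M (f M v) (g M v) (h M v) (i M v) (j M v))) ∧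
      (∀ a b s p : ℕ, (∀ M : Mod, (M : Type) ⊨ X → R M a b s p) ↔ ∃ z : ℕ, ρ NN a b s p z) ∧
      (∀ (M : Mod) (a b s p z : ℕ), ρ M a b s p z ↔ ρ NN a b s p z) := by
  obtain ⟨K, hK, h⟩ := kern hX hc hR
  have e : ∀ (M : Mod) (a b s p z : ℕ), (![(a : M), b, s, p, z] : Fin 5 → M) =
      fun i => ((Fin.snoc ![a, b, s, p] z : Fin 5 → ℕ) i : M) := by
    intro M a b s p z; funext i; fin_cases i <;> rfl
  refine ⟨fun M a b s p z => K M ![a, b, s, p, z], ?_, ?_, ?_⟩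
  · intro m f g h i j _ _ _ _ _
    refine (hK.sub ![f, g, h, i, j] ?_).congr fun M v => ?_
    · intro i; fin_cases i <;> assumption
    · have : (fun k => (![f, g, h, i, j] : Fin 5 → Fn m) k M v) = ![f M v, g M v, h M v, i M v, j M v] := by
        funext i; fin_cases i <;> rfl
      rw [this]
  · intro a b s p
    have := h ![a, b, s, p]
    simp only [e]
    exact this
  · intro M a b s p z
    simp only [e]
    exact d0_abs hK M _

instance sg_sat_i (N : ℕ) {m : ℕ} (f g : Fn m) [hf : UT f] [hg : UT g] :
    Sg (N + 1) (fun M v => Sat N (f M v) (g M v)) := by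
  have : Sg (N + 1) (m := 2) (fun _ v => Sat N (v 0) (v 1)) := ⟨sg_sat N⟩
  refine (this.sub ![f, g] ?_).congr fun M v => Iff.rfl
  intro i; fin_cases i <;> assumption

/-- the pair of parameters as an environment -/
def en {M : Mod} (a b : M) : M := pr b (pr a 0)
instance ut_en {m : ℕ} (f g : Fn m) [UT f] [UT g] : UT (fun M v => en (f M v) (g M v)) := by
  unfold en; infer_instance
/-- self-applied difference -/
def Ph (N : ℕ) (M : Mod) (a b : M) : Prop := Sat N a (en a b) ∧ ¬ Sat N b (en a b)

theorem sat2 (N : ℕ) (A : ∀ M : Mod, M → M → Prop) (hA : Sg (N + 1) (m := 2) (fun M v => A M (v 0) (v 1))) :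
    ∃ e : ℕ, ∀ (M : Mod) (a b : M), Sat N (e : M) (en a b) ↔ A M a b := by
  obtain ⟨e, he⟩ := sat_univ hA.ex
  exact ⟨e, fun M a b => he M ![a, b]⟩
theorem sat0 (N : ℕ) (A : Rl 0) (hA : Sg (N + 1) A) :
    ∃ e : ℕ, ∀ (M : Mod), Sat N (e : M) 0 ↔ A M default := by
  obtain ⟨e, he⟩ := sat_univ hA.ex
  exact ⟨e, fun M => he M default⟩

theorem mod_iff (M : Mod) (X : Thy) : (M : Type) ⊨ X ↔ ∀ ψ ∈ X, (M : Type) ⊨ ψ :=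
  ⟨fun h => h.realize_of_mem, fun h => ⟨h⟩⟩

theorem con_model {X : Thy} (hX : ExtPA X) (h : Con X) : ∃ M : Mod, (M : Type) ⊨ X := by
  unfold Con at h
  rw [prv_iff hX] at h
  push Not at h
  obtain ⟨M, hM, -⟩ := h
  exact ⟨M, ⟨hM⟩⟩

theorem ext_mono {X Y : Thy} (hX : ExtPA X) (h : X ⊆ Y) : ExtPA Y := fun φ hφ =>
  Theory.models_of_models_theory (T' := X) (fun _ hψ => Theory.models_sentence_of_mem (h hψ)) (hX φ hφ)



theorem kernels {X : Thy} (hX : ExtPA X) (hc : CompThy X) (N : ℕ) :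
    ∃ (ρ : ∀ M : Mod, M → M → M → Prop) (δ : ∀ M : Mod, M → M → M → M → M → Prop),
      (∀ (m : ℕ) (f g h : Fn m) [UT f] [UT g] [UT h], D0 (fun M v => ρ M (f M v) (g M v) (h M v))) ∧
      (∀ (m : ℕ) (f g h i j : Fn m) [UT f] [UT g] [UT h] [UT i] [UT j],
        D0 (fun M v => δ M (f M v) (g M v) (h M v) (i M v) (j M v))) ∧
      (∀ a b : ℕ, (∀ M : Mod, (M : Type) ⊨ X → Ph N M a b) ↔ ∃ z : ℕ, ρ NN a b z) ∧
      (∀ (M : Mod) (a b z : ℕ), ρ M a b z ↔ ρ NN a b z) ∧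
      (∀ a b s p : ℕ, (∀ M : Mod, (M : Type) ⊨ X → Ph N M a b → Sat N (s : M) 0 ∧ ¬ Sat N (p : M) 0) ↔
        ∃ z : ℕ, δ NN a b s p z) ∧
      (∀ (M : Mod) (a b s p z : ℕ), δ M a b s p z ↔ δ NN a b s p z) := by
  have h1 : FD (m := 2) (fun M v => Ph N M (v 0) (v 1)) :=
    FD.and (FD.sg (n := N + 1) inferInstance) (FD.not (FD.sg (n := N + 1) inferInstance))
  have h2 : FD (m := 4) (fun M v => Ph N M (v 0) (v 1) → Sat N (v 2) 0 ∧ ¬ Sat N (v 3) 0) :=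
    FD.imp (FD.and (FD.sg (n := N + 1) inferInstance) (FD.not (FD.sg (n := N + 1) inferInstance)))
      (FD.and (FD.sg (n := N + 1) inferInstance) (FD.not (FD.sg (n := N + 1) inferInstance)))
  obtain ⟨ρ, a1, a2, a3⟩ := kern2 hX hc h1
  obtain ⟨δ, b1, b2, b3⟩ := kern4 hX hc (R := fun M a b s p => Ph N M a b → Sat N s 0 ∧ ¬ Sat N p 0) h2
  exact ⟨ρ, δ, a1, b1, a2, a3, b2, b3⟩

set_option maxHeartbeats 1000000 in
theorem core (N : ℕ) {T U : Thy} (hT : GoodThy T) (hU : GoodThy U) (hC : Con (T ∪ ThIn (PiS (N + 1)) U)) :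
    ∃ φ ∈ SigAndPiS (N + 1), HSPCons (N + 1) T φ ∧ HSPCons (N + 1) U φ ∧ ¬ Prv T φ ∧ ¬ Prv U φ := by
  obtain ⟨cT, -, eT⟩ := hT
  obtain ⟨cU, -, eU⟩ := hU
  obtain ⟨ρT, δT, iρT, iδT, pT, aT, qT, bT⟩ := kernels eT cT N
  obtain ⟨ρU, δU, iρU, iδU, pU, aU, qU, bU⟩ := kernels eU cU N
  obtain ⟨W, hW⟩ := con_model (ext_mono eT Set.subset_union_left) hC
  have hWT : (W : Type) ⊨ T := hW.mono Set.subset_union_left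
  have hWU : ∀ ξ ∈ PiS (N + 1), Prv U ξ → (W : Type) ⊨ ξ := fun ξ h1 h2 =>
    hW.realize_of_mem ξ (Or.inr ⟨h1, h2⟩)
  obtain ⟨a, ha⟩ := sat2 N (fun M x y =>
    (∃ w s p, (δT M x y s p w ∨ δU M x y s p w) ∧ (∀ u, u ≤ w + s + p → ¬ (ρT M x y u ∨ ρU M x y u)) ∧ Sat N p 0) ∨
    (∃ z, ρU M x y z ∧ ∀ u, u ≤ z → ¬ ρT M x y u)) inferInstance
  obtain ⟨b, hb⟩ := sat2 N (fun M x y =>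
    ∃ z, ρU M x y z ∧ (∀ u, u ≤ z → ¬ ρT M x y u) ∧
      ∀ w, w ≤ z → ∀ s, s ≤ z → ∀ p, p ≤ z → (¬ (δT M x y s p w ∨ δU M x y s p w)) ∨ Sat N s 0) inferInstance
  obtain ⟨σ, hσ, eσ⟩ := snt_sg (n := N + 1) (k := 2) (R := fun M v => Sat N (v 0) (en (v 0) (v 1))) inferInstance ![a, b]
  obtain ⟨π, hπ, eπ⟩ := snt_pi (n := N + 1) (k := 2) (R := fun M v => Sat N (v 1) (en (v 0) (v 1))) inferInstance ![a, b]
  have eφ : ∀ M : Mod, (M : Type) ⊨ σ ⊓ π ↔ Ph N M a b := fun M =>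
    BoundedFormula.realize_inf.trans (and_congr (eσ M) (eπ M))
  have prv : ∀ X : Thy, ExtPA X → (Prv X (σ ⊓ π) ↔ ∀ M : Mod, (M : Type) ⊨ X → Ph N M a b) := fun X hX => by
    rw [prv_iff hX]; simp only [eφ, mod_iff]
  have unf : ∀ M : Mod, Ph N M a b ↔ _ := fun M => and_congr (ha M a b) (not_congr (hb M a b))
  -- no proofs
  have key : ∀ z : ℕ, ¬ (ρT NN a b z ∨ ρU NN a b z) := by
    by_contra hk
    push Not at hk
    classical
    obtain ⟨z, hz, hmin⟩ : ∃ z : ℕ, (ρT NN a b z ∨ ρU NN a b z) ∧ ∀ y : ℕ, y < z → ¬ (ρT NN a b y ∨ ρU NN a b y) := by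
      have hk' : ∃ z : ℕ, ρT NN a b z ∨ ρU NN a b z := by
        obtain ⟨z, hz⟩ := hk; exact ⟨z, by tauto⟩
      exact ⟨Nat.find hk', Nat.find_spec hk', fun y hy => Nat.find_min hk' hy⟩
    by_cases hzT : ρT NN a b z
    · have prT := (pT a b).2 ⟨z, hzT⟩
      obtain ⟨ξ, hξ, eξ⟩ := snt_pi (n := N + 1) (k := 3) (R := fun M v => ∃ w, w ≤ v 2 ∧ ∃ s, s ≤ v 2 ∧ ∃ p, p ≤ v 2 ∧
        w + s + p < v 2 ∧ δU M (v 0) (v 1) s p w ∧ Sat N p 0) inferInstance ![a, b, z]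
      have e1 : Prv U ξ := by
        rw [prv_iff eU]
        intro M hM
        have hM : (M : Type) ⊨ U := ⟨hM⟩
        rw [eξ]
        rintro ⟨w, hw, s, hs, p, hp, hlt, hd, hS⟩
        obtain ⟨w, -, rfl⟩ := le_nat hw
        obtain ⟨s, -, rfl⟩ := le_nat hs
        obtain ⟨p, -, rfl⟩ := le_nat hp
        have hlt : w + s + p < z := by exact_mod_cast (show ((w : M) + s + p < z) from hlt)
        have hd : δU M a b s p w := hd
        have hd' := (qU a b s p).2 ⟨w, (bU M a b s p w).1 hd⟩ M hM
        refine (hd' ?_).2 hS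
        rw [unf]
        constructor
        · refine Or.inl ⟨w, s, p, Or.inr hd, fun u hu => ?_, hS⟩
          obtain ⟨u, hu', rfl⟩ := le_nat (k := w + s + p) (by push_cast; exact hu)
          rw [aT, aU]
          exact hmin u (by omega)
        · rintro ⟨z', h1, h2, -⟩
          rcases le_or_gt (z : M) z' with h | h
          · exact h2 z h ((aT _ _ _ _).2 hzT)
          · obtain ⟨u, hu', rfl⟩ := le_nat h.le
            exact hmin u (by exact_mod_cast h) (Or.inr ((aU _ _ _ _).1 h1))
      have e2 := hWU ξ hξ e1
      rw [eξ] at e2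
      apply e2
      have hφ := prT W hWT
      have hφ' := hφ
      rw [unf] at hφ'
      rcases hφ'.1 with ⟨w, s, p, hd, hu, hS⟩ | ⟨z', h1, h2⟩
      · have hlt : w + s + p < (z : W) := by
          by_contra hc
          exact hu z (not_lt.1 hc) (Or.inl ((aT _ _ _ _).2 hzT))
        have l1 : w ≤ (z : W) := le_trans (le_trans le_self_add le_self_add) hlt.le
        have l2 : s ≤ (z : W) := le_trans (le_trans le_add_self le_self_add) hlt.le
        have l3 : p ≤ (z : W) := le_trans le_add_self hlt.le
        refine ⟨w, l1, s, l2, p, l3, hlt, ?_, hS⟩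
        rcases hd with hd | hd
        · exfalso
          obtain ⟨w, -, rfl⟩ := le_nat l1
          obtain ⟨s, -, rfl⟩ := le_nat l2
          obtain ⟨p, -, rfl⟩ := le_nat l3
          exact ((qT a b s p).2 ⟨w, (bT W a b s p w).1 hd⟩ W hWT hφ).2 hS
        · exact hd
      · exfalso
        rcases le_or_gt (z : W) z' with h | h
        · exact h2 z h ((aT _ _ _ _).2 hzT)
        · obtain ⟨u, hu', rfl⟩ := le_nat h.le
          exact hmin u (by exact_mod_cast h) (Or.inr ((aU _ _ _ _).1 h1))
    · have hzU := hz.resolve_left hzT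
      have hnT : ∀ y : ℕ, y ≤ z → ¬ ρT NN a b y := by
        intro y hy
        rcases hy.lt_or_eq with h | rfl
        · exact fun h' => hmin y h (Or.inl h')
        · exact hzT
      have prU := (pU a b).2 ⟨z, hzU⟩
      obtain ⟨ξ, hξ, eξ⟩ := snt_pi (n := N + 1) (k := 3) (R := fun M v => ∀ w, w ≤ v 2 → ∀ s, s ≤ v 2 → ∀ p, p ≤ v 2 →
        (¬ δT M (v 0) (v 1) s p w ∨ Sat N s 0)) inferInstance ![a, b, z]
      have nT : ∀ M : Mod, ∀ u, u ≤ (z : M) → ¬ ρT M a b u := by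
        intro M u hu
        obtain ⟨u, hu', rfl⟩ := le_nat hu
        rw [aT]; exact hnT u hu'
      have e1 : Prv U ξ := by
        rw [prv_iff eU]
        intro M hM
        have hM : (M : Type) ⊨ U := ⟨hM⟩
        rw [eξ]
        intro hall
        have hφ := prU M hM
        have hφ' := hφ
        rw [unf] at hφ'
        refine hφ'.2 ⟨z, (aU _ _ _ _).2 hzU, nT M, fun w hw s hs p hp => ?_⟩
        by_cases hd : δT M a b s p w ∨ δU M a b s p w
        · right
          rcases hd with hd | hd
          · exact (hall w hw s hs p hp).resolve_left (not_not.2 hd)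
          · obtain ⟨w, -, rfl⟩ := le_nat hw
            obtain ⟨s, -, rfl⟩ := le_nat hs
            obtain ⟨p, -, rfl⟩ := le_nat hp
            exact ((qU a b s p).2 ⟨w, (bU M a b s p w).1 hd⟩ M hM hφ).1
        · exact Or.inl hd
      have e2 := hWU ξ hξ e1
      rw [eξ] at e2
      apply e2
      intro w hw s hs p hp
      by_contra hc
      push Not at hc
      obtain ⟨hd, hS⟩ := hc
      have hw0 : w ≤ (z : W) := hw
      have hs0 : s ≤ (z : W) := hs
      have hp0 : p ≤ (z : W) := hp
      have hd0 : δT W a b s p w := hd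
      obtain ⟨w, -, rfl⟩ := le_nat hw0
      obtain ⟨s, -, rfl⟩ := le_nat hs0
      obtain ⟨p, -, rfl⟩ := le_nat hp0
      refine hS ((qT a b s p).2 ⟨w, (bT W a b s p w).1 hd0⟩ W hWT ?_).1
      rw [unf]
      constructor
      · exact Or.inr ⟨z, (aU _ _ _ _).2 hzU, nT W⟩
      · rintro ⟨z', h1, h2, h3⟩
        have hz' : (z : W) ≤ z' := by
          by_contra h
          obtain ⟨u, hu', rfl⟩ := le_nat (not_le.1 h).le
          exact hmin u (by exact_mod_cast (not_le.1 h)) (Or.inr ((aU _ _ _ _).1 h1))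
        rcases h3 w (hw0.trans hz') s (hs0.trans hz') p (hp0.trans hz') with h | h
        · exact h (Or.inl hd0)
        · exact hS h
  have noρ : ∀ (M : Mod) (u : ℕ), ¬ (ρT M a b u ∨ ρU M a b u) := fun M u => by rw [aT, aU]; exact key u
  have cons : ∀ X : Thy, ExtPA X → (∀ s p : ℕ, (∀ M : Mod, (M : Type) ⊨ X → Ph N M a b → Sat N (s : M) 0 ∧ ¬ Sat N (p : M) 0) →
      ∃ w : ℕ, ∀ M : Mod, δT M a b s p w ∨ δU M a b s p w) → HSPCons (N + 1) X (σ ⊓ π) := by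
    intro X hX hδ V hV σ' hσ' π' hπ' h
    obtain ⟨s, hs⟩ := sat0 N _ (sg_fml0 hσ')
    obtain ⟨p, hp⟩ := sat0 N _ (pi_fml0 hπ')
    simp only [rlz0] at hs hp
    have e1 : ∀ M : Mod, (M : Type) ⊨ V → Ph N M a b → Sat N (s : M) 0 ∧ ¬ Sat N (p : M) 0 := by
      intro M hM hφ
      rw [prv_iff (ext_mono (Y := add V (σ ⊓ π)) hV.1 (Set.subset_insert _ _))] at h
      have := h M (fun ψ hψ => by
        rcases hψ with rfl | hψ
        · exact (eφ M).2 hφ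
        · exact hM.realize_of_mem ψ hψ)
      rw [hs, hp, not_not]
      exact BoundedFormula.realize_inf.1 this
    have e2 : Prv X ((σ ⊓ π) ⟹ (σ' ⊓ π')) := by
      apply hV.2
      rw [prv_iff hV.1]
      intro M hM
      have := e1 M ⟨hM⟩
      rw [hs, hp, not_not] at this
      refine BoundedFormula.realize_imp.2 fun h => BoundedFormula.realize_inf.2 ?_
      exact this ((eφ M).1 h)
    obtain ⟨w, hw⟩ := hδ s p (by
      intro M hM hφ
      rw [prv_iff hX] at e2
      have := BoundedFormula.realize_imp.1 (e2 M hM.realize_of_mem) ((eφ M).2 hφ)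
      rw [hs, hp, not_not]
      exact BoundedFormula.realize_inf.1 this)
    rw [prv_iff hV.1]
    intro M hM
    refine BoundedFormula.realize_sup.2 ?_
    have goal : Sat N (s : M) 0 ∨ ¬ Sat N (p : M) 0 := by
      by_cases hφ : Ph N M a b
      · exact Or.inl (e1 M ⟨hM⟩ hφ).1
      · rw [unf, not_and_or, not_not] at hφ
        rcases hφ with hφ | ⟨z, h1, h2, h3⟩
        · right
          intro hS
          refine hφ (Or.inl ⟨w, s, p, hw M, fun u hu => ?_, hS⟩)
          obtain ⟨u, hu', rfl⟩ := le_nat (k := w + s + p) (by push_cast; exact hu)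
          exact noρ M u
        · left
          have hns : ∀ j : ℕ, z ≠ j := by
            rintro j rfl
            exact noρ M j (Or.inr h1)
          exact (h3 w (nat_lt_nonst hns w).le s (nat_lt_nonst hns s).le p (nat_lt_nonst hns p).le).resolve_left
            (not_not.2 (hw M))
    rw [hs, hp, not_not] at goal
    exact goal
  refine ⟨σ ⊓ π, ⟨σ, hσ, π, hπ, rfl⟩, cons T eT ?_, cons U eU ?_, ?_, ?_⟩
  · intro s p h
    obtain ⟨w, hw⟩ := (qT a b s p).1 h
    exact ⟨w, fun M => Or.inl ((bT M a b s p w).2 hw)⟩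
  · intro s p h
    obtain ⟨w, hw⟩ := (qU a b s p).1 h
    exact ⟨w, fun M => Or.inr ((bU M a b s p w).2 hw)⟩
  · rw [prv T eT, pT]
    rintro ⟨z, hz⟩; exact key z (Or.inl hz)
  · rw [prv U eU, pU]
    rintro ⟨z, hz⟩; exact key z (Or.inr hz)



theorem pi_and {n : ℕ} {π₁ π₂ : Snt} (h1 : π₁ ∈ PiS n) (h2 : π₂ ∈ PiS n) :
    ∃ π ∈ PiS n, ∀ M : Mod, (M : Type) ⊨ π ↔ (M : Type) ⊨ π₁ ∧ (M : Type) ⊨ π₂ := by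
  have := pi_fml0 h1
  have := pi_fml0 h2
  obtain ⟨π, h, e⟩ := snt_pi (n := n) (k := 0) (R := fun M v => ¬ rlz π₁ M v ∨ ¬ rlz π₂ M v) inferInstance default
  refine ⟨π, h, fun M => ?_⟩
  rw [e]
  simp only [rlz0]
  tauto

theorem fin_pi {n : ℕ} {T U : Thy} (hU : ExtPA U) (F : Finset Snt) : (F : Set Snt) ⊆ T ∪ ThIn (PiS n) U →
    ∃ π ∈ PiS n, Prv U π ∧ ∀ M : Mod, (M : Type) ⊨ T → (M : Type) ⊨ π → ∀ ψ ∈ F, (M : Type) ⊨ ψ := by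
  classical
  induction F using Finset.induction_on with
  | empty =>
    intro _
    obtain ⟨π, h, e⟩ := snt_pi (n := n) (k := 0) (R := fun _ _ => False) inferInstance default
    refine ⟨π, h, ?_, fun _ _ _ ψ hψ => absurd hψ (Finset.notMem_empty _)⟩
    rw [prv_iff hU]
    intro M _
    rw [e]; exact id
  | insert χ F _ ih =>
    intro hF
    obtain ⟨π, h1, h2, h3⟩ := ih (fun x hx => hF (by simp [Finset.mem_coe.1 hx]))
    rcases hF (show χ ∈ ((insert χ F : Finset Snt) : Set Snt) by simp) with h | ⟨h, h'⟩
    · refine ⟨π, h1, h2, fun M hM hp ψ hψ => ?_⟩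
      rcases Finset.mem_insert.1 hψ with rfl | hψ
      · exact hM.realize_of_mem _ h
      · exact h3 M hM hp ψ hψ
    · obtain ⟨π', k1, k2⟩ := pi_and h1 h
      refine ⟨π', k1, ?_, fun M hM hp ψ hψ => ?_⟩
      · rw [prv_iff hU]
        intro M hM
        rw [k2]
        exact ⟨(prv_iff hU _).1 h2 M hM, (prv_iff hU _).1 h' M hM⟩
      · rw [k2] at hp
        rcases Finset.mem_insert.1 hψ with rfl | hψ
        · exact hp.2
        · exact h3 M hM hp.1 ψ hψ

theorem incon_pi {n : ℕ} {T U : Thy} (hU : ExtPA U) (h : ¬ Con (T ∪ ThIn (PiS n) U)) :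
    ∃ π ∈ PiS n, Prv U π ∧ ∀ M : Mod, (M : Type) ⊨ T → ¬ (M : Type) ⊨ π := by
  unfold Con at h
  rw [not_not] at h
  obtain ⟨F, hF, hF2⟩ := Theory.models_iff_finset_models.1 h
  obtain ⟨π, h1, h2, h3⟩ := fin_pi hU F hF
  refine ⟨π, h1, h2, fun M hM hp => ?_⟩
  have : (M : Type) ⊨ (F : Thy) := ⟨h3 M hM hp⟩
  have : Nonempty (M : Type) := ⟨0⟩
  exact hF2 (Theory.ModelType.of (F : Thy) (M : Type)) default default

theorem back {n : ℕ} {T U : Thy} (hT : ExtPA T) (hU : ExtPA U) {φ : Snt} (h : HSPCons n T φ) (hn : ¬ Prv U φ) :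
    Cmpair n T U := by
  by_contra hc
  unfold Cmpair at hc
  push Not at hc
  obtain ⟨πU, a1, a2, a3⟩ := incon_pi hU hc.1
  obtain ⟨πT, b1, b2, b3⟩ := incon_pi hT hc.2
  obtain ⟨σ, s1, s2⟩ := snt_sg (k := 0) (pi_fml0 a1) default
  simp only [rlz0] at s2
  have hP : ExtPA PAAx := fun ψ hψ => Theory.models_sentence_of_mem hψ
  let V : Thy := add PAAx (φ ⟹ (σ ⊓ πT))
  have hV : ExtPA V := ext_mono hP (Set.subset_insert _ _)
  have hV2 : SubThy V T := by
    refine ⟨hV, fun ψ hψ => ?_⟩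
    rw [prv_iff hV] at hψ
    rw [prv_iff hT]
    intro M hM
    refine hψ M fun χ hχ => ?_
    rcases hχ with rfl | hχ
    · refine BoundedFormula.realize_imp.2 fun _ => BoundedFormula.realize_inf.2 ⟨?_, ?_⟩
      · exact (s2 M).2 (a3 M ⟨hM⟩)
      · exact (prv_iff hT _).1 b2 M hM
    · exact M.pa.realize_of_mem χ hχ
  have h1 : Prv (add V φ) (σ ⊓ πT) := by
    rw [prv_iff (ext_mono (Y := add V φ) hV (Set.subset_insert _ _))]
    intro M hM
    have e1 := hM φ (Or.inl rfl)
    have e2 := hM (φ ⟹ (σ ⊓ πT)) (Or.inr (Or.inl rfl))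
    exact BoundedFormula.realize_imp.1 e2 e1
  have h2 := h V hV2 σ s1 πT b1 h1
  rw [prv_iff hV] at h2
  apply hn
  rw [prv_iff hU]
  intro M hM
  by_contra hφ
  have h3 := h2 M fun χ hχ => by
    rcases hχ with rfl | hχ
    · exact BoundedFormula.realize_imp.2 fun h => absurd h hφ
    · exact M.pa.realize_of_mem χ hχ
  rcases BoundedFormula.realize_sup.1 h3 with h3 | h3
  · exact (s2 M).1 h3 ((prv_iff hU _).1 a2 M hM)
  · exact b3 M ⟨hM⟩ h3

/-- Theorem 5.13. -/
theorem stmt_9 (T U : Thy) (hT : GoodThy T) (hU : GoodThy U) (n : ℕ) (hn : 1 ≤ n) :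
    List.TFAE
      [Cmpair n T U,
       ∃ φ ∈ SigAndPiS n, HSPCons n T φ ∧ HSPCons n U φ ∧ φ ∉ Th T ∪ Th U,
       ∃ φ : Snt, HSPCons n T φ ∧ HSPCons n U φ ∧ φ ∉ Th T ∪ Th U,
       ∃ φ : Snt, HSPCons n T φ ∧ φ ∉ Th U] := by
  obtain ⟨N, rfl⟩ : ∃ N, n = N + 1 := ⟨n - 1, by omega⟩
  tfae_have 1 → 2 := by
    rintro (h | h)
    · obtain ⟨φ, h1, h2, h3, h4, h5⟩ := core N hT hU h
      exact ⟨φ, h1, h2, h3, fun h => h.elim h4 h5⟩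
    · obtain ⟨φ, h1, h2, h3, h4, h5⟩ := core N hU hT h
      exact ⟨φ, h1, h3, h2, fun h => h.elim h5 h4⟩
  tfae_have 2 → 3 := by
    rintro ⟨φ, -, h⟩
    exact ⟨φ, h⟩
  tfae_have 3 → 4 := by
    rintro ⟨φ, h1, -, h3⟩
    exact ⟨φ, h1, fun h => h3 (Or.inr h)⟩
  tfae_have 4 → 1 := by
    rintro ⟨φ, h1, h2⟩
    exact back hT.2.2 hU.2.2 h1 h2
  tfae_finish


end Guaspari
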